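/- arXiv:1507.07333 — 3 statements merged into one kernel-verified Lean document; each statement's English description precedes it below -/
import Mathlib

section
/- Let 𝒞 be a Hom-finite k-linear triangulated category having a Serre functor S. Then any recollement (𝒞′, 𝒞, 𝒞″, i^*, i_*, i^!, j_!, j^*, j_*) of 𝒞 sits in an unbounded ladder of period 1. (In this situation 𝒞′ has a right Serre functor S_{𝒞′} = i^! S i_* with inverse i^* S^{-1} i_*, and 𝒞″ has a right Serre functor S_{𝒞″} = j^* S j_! with inverse j^* S^{-1} j_*.) -/
/-!
STATEMENT 5: Let 𝒞 be a Hom-finite k-linear triangulated category having a Serre functor S.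
Then any recollement (𝒞′, 𝒞, 𝒞″, i^*, i_*, i^!, j_!, j^*, j_*) of 𝒞 sits in an unbounded
ladder of period 1. (In this situation 𝒞′ has a right Serre functor S_{𝒞′} = i^! S i_* with
inverse i^* S^{-1} i_*, and 𝒞″ has a right Serre functor S_{𝒞″} = j^* S j_! with inverse
j^* S^{-1} j_*.)
-/
open CategoryTheory CategoryTheory.Limits CategoryTheory.Pretriangulated

section TriangulatedPreliminaries

universe v v' v'' u u' u''

variable {C : Type u} {C' : Type u'} {C'' : Type u''}
  [Category.{v} C] [Category.{v'} C'] [Category.{v''} C'']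
  [HasShift C ℤ] [HasShift C' ℤ] [HasShift C'' ℤ]
  [Preadditive C] [Preadditive C'] [Preadditive C'']
  [HasZeroObject C] [HasZeroObject C'] [HasZeroObject C'']
  [∀ n : ℤ, (shiftFunctor C n).Additive] [∀ n : ℤ, (shiftFunctor C' n).Additive]
  [∀ n : ℤ, (shiftFunctor C'' n).Additive]
  [Pretriangulated C] [Pretriangulated C'] [Pretriangulated C'']

/-- A functor between pretriangulated categories is a triangle functor if it admits a
commutation structure with the shifts for which it preserves distinguished triangles. -/
def IsTriangleFunctor (F : C ⥤ C') : Prop :=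
  ∃ c : F.CommShift ℤ, @Functor.IsTriangulated _ _ _ _ _ _ F c _ _ _ _ _ _ _ _

/-- The kernel of a functor: the class of objects sent to a zero object. -/
def kerSet (F : C ⥤ C') : Set C := { X | IsZero (F.obj X) }

/-- A left recollement `(𝒞', 𝒞, 𝒞'', i^*, i_*, j_!, j^*)`: there are adjoint pairs
`(i^*, i_*)` and `(j_!, j^*)`, the functors `i_*`, `j_!` are fully faithful, `j^* i_* = 0`,
and every object `X` fits in a distinguished triangle
`j_! j^* X ⟶ X ⟶ i_* i^* X ⟶ (j_! j^* X)[1]` whose morphisms into and out of `X` are the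
counit and the unit of the adjunctions. -/
def IsLeftRecollement (iStar : C ⥤ C') (iPush : C' ⥤ C)
    (jShriek : C'' ⥤ C) (jStar : C ⥤ C'') : Prop :=
  ∃ (adjI : iStar ⊣ iPush) (adjJ : jShriek ⊣ jStar),
    iPush.Full ∧ iPush.Faithful ∧ jShriek.Full ∧ jShriek.Faithful ∧
    (∀ X' : C', IsZero (jStar.obj (iPush.obj X'))) ∧
    (∀ X : C, ∃ h : iPush.obj (iStar.obj X) ⟶ (jShriek.obj (jStar.obj X))⟦(1 : ℤ)⟧,
      Triangle.mk (adjJ.counit.app X) (adjI.unit.app X) h ∈ distTriang C)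

/-- A recollement `(𝒞', 𝒞, 𝒞'', i^*, i_*, i^!, j_!, j^*, j_*)`, i.e. the data of
conditions (R1)-(R4): adjoint pairs `(i^*, i_*)`, `(i_*, i^!)`, `(j_!, j^*)`, `(j^*, j_*)`;
`i_*`, `j_!`, `j_*` fully faithful; `j^* i_* = 0`; and the two recollement distinguished
triangles `j_! j^* X ⟶ X ⟶ i_* i^* X ⟶ ⋅[1]` and `i_* i^! X ⟶ X ⟶ j_* j^* X ⟶ ⋅[1]`, whose
morphisms into and out of `X` are counits and units of the adjunctions. -/
def IsRecollement (iStar : C ⥤ C') (iPush : C' ⥤ C) (iShriek : C ⥤ C')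
    (jShriek : C'' ⥤ C) (jStar : C ⥤ C'') (jPush : C'' ⥤ C) : Prop :=
  ∃ (adjI₁ : iStar ⊣ iPush) (adjI₂ : iPush ⊣ iShriek)
    (adjJ₁ : jShriek ⊣ jStar) (adjJ₂ : jStar ⊣ jPush),
    iPush.Full ∧ iPush.Faithful ∧ jShriek.Full ∧ jShriek.Faithful ∧
    jPush.Full ∧ jPush.Faithful ∧
    (∀ X' : C', IsZero (jStar.obj (iPush.obj X'))) ∧
    (∀ X : C, ∃ h : iPush.obj (iStar.obj X) ⟶ (jShriek.obj (jStar.obj X))⟦(1 : ℤ)⟧,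
      Triangle.mk (adjJ₁.counit.app X) (adjI₁.unit.app X) h ∈ distTriang C) ∧
    (∀ X : C, ∃ h : jPush.obj (jStar.obj X) ⟶ (iPush.obj (iShriek.obj X))⟦(1 : ℤ)⟧,
      Triangle.mk (adjI₂.counit.app X) (adjJ₂.unit.app X) h ∈ distTriang C)

/-- An unbounded ladder of triangle functors, encoded by the four families
`a n = i_{2n} : 𝒞' ⥤ 𝒞`, `b n = i_{2n-1} : 𝒞'' ⥤ 𝒞`, `p n = j_{2n-1} : 𝒞 ⥤ 𝒞'` and
`q n = j_{2n} : 𝒞 ⥤ 𝒞''` (`n ∈ ℤ`): any two consecutive rows form a left or a right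
recollement of `𝒞` relative to `𝒞'` and `𝒞''`. -/
structure IsUnboundedLadder (a : ℤ → C' ⥤ C) (b : ℤ → C'' ⥤ C)
    (p : ℤ → C ⥤ C') (q : ℤ → C ⥤ C'') : Prop where
  tri_a : ∀ n, IsTriangleFunctor (a n)
  tri_b : ∀ n, IsTriangleFunctor (b n)
  tri_p : ∀ n, IsTriangleFunctor (p n)
  tri_q : ∀ n, IsTriangleFunctor (q n)
  left : ∀ n : ℤ, IsLeftRecollement (p n) (a n) (b n) (q n)
  right : ∀ n : ℤ, IsLeftRecollement (q n) (b (n + 1)) (a n) (p (n + 1))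

/-- The recollement `(i^*, i_*, i^!, j_!, j^*, j_*)` sits in an unbounded ladder, namely as
the `0`-th recollement `(j_{-1}, i_0, j_1, i_{-1}, j_0, i_1)` of the ladder. -/
def SitsInUnboundedLadder (iStar : C ⥤ C') (iPush : C' ⥤ C) (iShriek : C ⥤ C')
    (jShriek : C'' ⥤ C) (jStar : C ⥤ C'') (jPush : C'' ⥤ C) : Prop :=
  ∃ (a : ℤ → C' ⥤ C) (b : ℤ → C'' ⥤ C) (p : ℤ → C ⥤ C') (q : ℤ → C ⥤ C''),
    IsUnboundedLadder a b p q ∧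
    p 0 = iStar ∧ a 0 = iPush ∧ p 1 = iShriek ∧
    b 0 = jShriek ∧ q 0 = jStar ∧ b 1 = jPush

end TriangulatedPreliminaries
section RecollementEquivalences

variable {C₁ C₁' C₁'' C₂ C₂' C₂'' : Type*}
  [Category C₁] [Category C₁'] [Category C₁''] [Category C₂] [Category C₂'] [Category C₂'']
  [HasShift C₁ ℤ] [HasShift C₁' ℤ] [HasShift C₁'' ℤ]
  [HasShift C₂ ℤ] [HasShift C₂' ℤ] [HasShift C₂'' ℤ]
  [Preadditive C₁] [Preadditive C₁'] [Preadditive C₁'']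
  [Preadditive C₂] [Preadditive C₂'] [Preadditive C₂'']
  [HasZeroObject C₁] [HasZeroObject C₁'] [HasZeroObject C₁'']
  [HasZeroObject C₂] [HasZeroObject C₂'] [HasZeroObject C₂'']
  [∀ n : ℤ, (shiftFunctor C₁ n).Additive] [∀ n : ℤ, (shiftFunctor C₁' n).Additive]
  [∀ n : ℤ, (shiftFunctor C₁'' n).Additive]
  [∀ n : ℤ, (shiftFunctor C₂ n).Additive] [∀ n : ℤ, (shiftFunctor C₂' n).Additive]
  [∀ n : ℤ, (shiftFunctor C₂'' n).Additive]
  [Pretriangulated C₁] [Pretriangulated C₁'] [Pretriangulated C₁'']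
  [Pretriangulated C₂] [Pretriangulated C₂'] [Pretriangulated C₂'']

/-- An equivalence of left recollements: a triple `(F', F, F'')` of triangle-equivalences
commuting with the four functors up to natural isomorphism. -/
def IsLeftRecollementEquiv (F' : C₁' ⥤ C₂') (F : C₁ ⥤ C₂) (F'' : C₁'' ⥤ C₂'')
    (iStar₁ : C₁ ⥤ C₁') (iPush₁ : C₁' ⥤ C₁) (jShriek₁ : C₁'' ⥤ C₁) (jStar₁ : C₁ ⥤ C₁'')
    (iStar₂ : C₂ ⥤ C₂') (iPush₂ : C₂' ⥤ C₂) (jShriek₂ : C₂'' ⥤ C₂) (jStar₂ : C₂ ⥤ C₂'') :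
    Prop :=
  F'.IsEquivalence ∧ F.IsEquivalence ∧ F''.IsEquivalence ∧
  IsTriangleFunctor F' ∧ IsTriangleFunctor F ∧ IsTriangleFunctor F'' ∧
  Nonempty (iStar₁ ⋙ F' ≅ F ⋙ iStar₂) ∧ Nonempty (iPush₁ ⋙ F ≅ F' ⋙ iPush₂) ∧
  Nonempty (jShriek₁ ⋙ F ≅ F'' ⋙ jShriek₂) ∧ Nonempty (jStar₁ ⋙ F'' ≅ F ⋙ jStar₂)

/-- An equivalence of recollements: a triple `(F', F, F'')` of triangle-equivalences
commuting with the six functors up to natural isomorphism. -/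
def IsRecollementEquiv (F' : C₁' ⥤ C₂') (F : C₁ ⥤ C₂) (F'' : C₁'' ⥤ C₂'')
    (iStar₁ : C₁ ⥤ C₁') (iPush₁ : C₁' ⥤ C₁) (iShriek₁ : C₁ ⥤ C₁')
    (jShriek₁ : C₁'' ⥤ C₁) (jStar₁ : C₁ ⥤ C₁'') (jPush₁ : C₁'' ⥤ C₁)
    (iStar₂ : C₂ ⥤ C₂') (iPush₂ : C₂' ⥤ C₂) (iShriek₂ : C₂ ⥤ C₂')
    (jShriek₂ : C₂'' ⥤ C₂) (jStar₂ : C₂ ⥤ C₂'') (jPush₂ : C₂'' ⥤ C₂) : Prop :=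
  F'.IsEquivalence ∧ F.IsEquivalence ∧ F''.IsEquivalence ∧
  IsTriangleFunctor F' ∧ IsTriangleFunctor F ∧ IsTriangleFunctor F'' ∧
  Nonempty (iStar₁ ⋙ F' ≅ F ⋙ iStar₂) ∧ Nonempty (iPush₁ ⋙ F ≅ F' ⋙ iPush₂) ∧
  Nonempty (iShriek₁ ⋙ F' ≅ F ⋙ iShriek₂) ∧
  Nonempty (jShriek₁ ⋙ F ≅ F'' ⋙ jShriek₂) ∧ Nonempty (jStar₁ ⋙ F'' ≅ F ⋙ jStar₂) ∧
  Nonempty (jPush₁ ⋙ F ≅ F'' ⋙ jPush₂)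

end RecollementEquivalences

section LadderPeriod

variable {C C' C'' : Type*}
  [Category C] [Category C'] [Category C'']
  [HasShift C ℤ] [HasShift C' ℤ] [HasShift C'' ℤ]
  [Preadditive C] [Preadditive C'] [Preadditive C'']
  [HasZeroObject C] [HasZeroObject C'] [HasZeroObject C'']
  [∀ n : ℤ, (shiftFunctor C n).Additive] [∀ n : ℤ, (shiftFunctor C' n).Additive]
  [∀ n : ℤ, (shiftFunctor C'' n).Additive]
  [Pretriangulated C] [Pretriangulated C'] [Pretriangulated C'']

/-- In a ladder, the `s`-th left recollement is equivalent to the `t`-th one. -/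
def LadderLeftRecEquivAt (a : ℤ → C' ⥤ C) (b : ℤ → C'' ⥤ C)
    (p : ℤ → C ⥤ C') (q : ℤ → C ⥤ C'') (s t : ℤ) : Prop :=
  ∃ (F' : C' ⥤ C') (F : C ⥤ C) (F'' : C'' ⥤ C''),
    IsLeftRecollementEquiv F' F F'' (p s) (a s) (b s) (q s) (p t) (a t) (b t) (q t)

/-- An unbounded ladder is periodic of period `t`: `t` is the minimal positive integer such
that the `t`-th left recollement is equivalent to the `0`-th one. -/
def LadderHasPeriod (a : ℤ → C' ⥤ C) (b : ℤ → C'' ⥤ C)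
    (p : ℤ → C ⥤ C') (q : ℤ → C ⥤ C'') (t : ℤ) : Prop :=
  0 < t ∧ LadderLeftRecEquivAt a b p q t 0 ∧
    ∀ s : ℤ, 0 < s → s < t → ¬ LadderLeftRecEquivAt a b p q s 0

/-- The recollement `(i^*, i_*, i^!, j_!, j^*, j_*)` sits in an unbounded ladder
of period `t`. -/
def SitsInUnboundedLadderOfPeriod (iStar : C ⥤ C') (iPush : C' ⥤ C) (iShriek : C ⥤ C')
    (jShriek : C'' ⥤ C) (jStar : C ⥤ C'') (jPush : C'' ⥤ C) (t : ℤ) : Prop :=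
  ∃ (a : ℤ → C' ⥤ C) (b : ℤ → C'' ⥤ C) (p : ℤ → C ⥤ C') (q : ℤ → C ⥤ C''),
    IsUnboundedLadder a b p q ∧
    p 0 = iStar ∧ a 0 = iPush ∧ p 1 = iShriek ∧
    b 0 = jShriek ∧ q 0 = jStar ∧ b 1 = jPush ∧
    LadderHasPeriod a b p q t

end LadderPeriod
section Serre

variable (k : Type*) [Field k]
variable (E : Type*) [Category E] [Preadditive E] [CategoryTheory.Linear k E]

/-- The data exhibiting `S` as a right Serre functor on a Hom-finite `k`-linear category:
`k`-linear isomorphisms `Hom(X, Y) ≅ Hom(Y, S X)^*`, natural in `X` and `Y`. -/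
structure RightSerreData (S : E ⥤ E) where
  e : ∀ X Y : E, (X ⟶ Y) ≃ₗ[k] Module.Dual k (Y ⟶ S.obj X)
  nat_right : ∀ {X Y Y' : E} (h : X ⟶ Y) (g : Y ⟶ Y') (u : Y' ⟶ S.obj X),
    e X Y' (h ≫ g) u = e X Y h (g ≫ u)
  nat_left : ∀ {X X' Y : E} (f : X' ⟶ X) (h : X ⟶ Y) (u : Y ⟶ S.obj X'),
    e X' Y (f ≫ h) u = e X Y h (u ≫ S.map f)

/-- A category has a Serre functor if it has a right Serre functor which is an
equivalence. -/
def HasSerreFunctor : Prop :=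
  ∃ S : E ⥤ E, Nonempty (RightSerreData k E S) ∧ S.IsEquivalence

end Serre

section ThetaFunctional

theorem theta_linIndep (K2 R E : Type*) [Field K2] [CommRing R]
    [Algebra K2 R] [AddCommGroup E] [Module R E] [Module K2 E] [IsScalarTower K2 R E]
    {ι : Type*} (m : ι → Ideal R) (hm : ∀ i, (m i).IsMaximal) (hinj : Function.Injective m)
    (v : ι → E) (hv : ∀ i, v i ∈ Submodule.torsionBySet R E (m i)) (hv0 : ∀ i, v i ≠ 0) :
    LinearIndependent K2 v := by
  classical
  rw [linearIndependent_iff_finset_linearIndependent]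
  intro s
  have h1 : s.SupIndep fun i => Submodule.torsionBySet R E (m i) :=
    Submodule.supIndep_torsionBySet_ideal (fun i _ j _ hij =>
      (hm i).coprime_of_ne (hm j) (fun h => hij (hinj h)))
  have h2 : iSupIndep fun i : s => Submodule.torsionBySet R E (m i) :=
    iSupIndep_comp_coe_iff_supIndep.mpr h1
  have h3 : iSupIndep fun i : s => (Submodule.torsionBySet R E (m i)).restrictScalars K2 := by
    rw [iSupIndep_def] at h2 ⊢
    intro i
    have := h2 i
    rw [disjoint_iff] at this ⊢
    have h4 := congrArg (Submodule.restrictScalarsLatticeHom K2 R E) this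
    rw [map_inf, map_iSup₂, map_bot] at h4
    exact h4
  exact iSupIndep.linearIndependent _ h3 (fun i => hv i) (fun i => hv0 i)

theorem theta_simple (K1 R E : Type*) [Field K1] [CommRing R] [Algebra K1 R]
    [AddCommGroup E] [Module R E] [Module K1 E] [IsScalarTower K1 R E]
    (ev : E →ₗ[K1] K1) (nondeg : ∀ x : E, (∀ r : R, ev (r • x) = 0) → x = 0)
    (S : Submodule R E) (hS : IsAtom S) [FiniteDimensional K1 (S.restrictScalars K1)] :
    Submodule.torsionBySet R E (Module.annihilator R S) = S := by
  classical
  set T := Submodule.torsionBySet R E (Module.annihilator R S : Set R) with hT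
  have hST : S ≤ T := by
    intro x hx
    rw [hT, Submodule.mem_torsionBySet_iff]
    rintro ⟨a, ha⟩
    exact congrArg Subtype.val ((Module.mem_annihilator.mp ha) ⟨x, hx⟩)
  obtain ⟨g, hgS, hg0⟩ := Submodule.exists_mem_ne_zero_of_ne_bot hS.1
  have hspan : Submodule.span R {g} = S := by
    refine (hS.le_iff.mp ?_).resolve_left ?_
    · simpa [Submodule.span_le] using hgS
    · simpa using hg0
  have hann : ∀ r : R, r • g = 0 → r ∈ Module.annihilator R S := by
    intro r hr
    rw [Module.mem_annihilator]
    rintro ⟨x, hx⟩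
    rw [← hspan, Submodule.mem_span_singleton] at hx
    obtain ⟨a, rfl⟩ := hx
    ext
    simp [smul_comm r a, hr]
  let π : R →ₗ[K1] (S.restrictScalars K1) :=
    { toFun := fun r => ⟨r • g, S.smul_mem r hgS⟩
      map_add' := fun a b => by ext; simp [add_smul]
      map_smul' := fun a b => by ext; simp }
  have hπ : Function.Surjective π := by
    rintro ⟨x, hx⟩
    have hx' : x ∈ S := hx
    rw [← hspan, Submodule.mem_span_singleton] at hx'
    obtain ⟨a, rfl⟩ := hx'
    exact ⟨a, rfl⟩
  obtain ⟨σ, hσ⟩ := LinearMap.exists_rightInverse_of_surjective π (LinearMap.range_eq_top.mpr hπ)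
  let L : (T.restrictScalars K1) →ₗ[K1] Module.Dual K1 (S.restrictScalars K1) :=
    LinearMap.mk₂ K1 (fun f s => ev (σ s • (f : E)))
      (fun a b s => by simp) (fun c a s => by simp [smul_comm _ c])
      (fun a s t => by simp [add_smul]) (fun c a s => by simp)
  have hL : Function.Injective L := by
    rw [injective_iff_map_eq_zero]
    rintro ⟨f, hf⟩ h
    have hf' : f ∈ T := hf
    rw [hT, Submodule.mem_torsionBySet_iff] at hf'
    ext
    apply nondeg
    intro r
    have h1 : π (r - σ (π r)) = 0 := by
      rw [map_sub, sub_eq_zero]; exact (LinearMap.congr_fun hσ (π r)).symm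
    have h2 := hf' ⟨_, hann _ (congrArg Subtype.val h1)⟩
    have h3 : ev (σ (π r) • f) = 0 := LinearMap.congr_fun h (π r)
    simp only [sub_smul, sub_eq_zero] at h2
    simp only [h2, h3]
  have : FiniteDimensional K1 (T.restrictScalars K1) := FiniteDimensional.of_injective L hL
  have h5 := LinearMap.finrank_le_finrank_of_injective hL
  rw [Subspace.dual_finrank_eq] at h5
  have h6 : S.restrictScalars K1 = T.restrictScalars K1 :=
    Submodule.eq_of_le_of_finrank_le hST h5
  exact (Submodule.restrictScalars_injective K1 R E h6).symm

theorem theta_exists (K1 K2 R E : Type*) [Field K1] [Field K2] [CommRing R] [Algebra K1 R]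
    [Algebra K2 R] [AddCommGroup E] [Module R E] [Module K1 E] [Module K2 E]
    [IsScalarTower K1 R E] [IsScalarTower K2 R E]
    (ev : E →ₗ[K1] K1) (nondeg : ∀ x : E, (∀ r : R, ev (r • x) = 0) → x = 0) :
    ∃ θ : E →ₗ[K2] K2, ∀ N : Submodule R E, N ≠ ⊥ →
      FiniteDimensional K1 (N.restrictScalars K1) → ∃ x ∈ N, θ x ≠ 0 := by
  classical
  let ι := {m : Ideal R // m.IsMaximal ∧ Submodule.torsionBySet R E (m : Set R) ≠ ⊥}
  have hex : ∀ i : ι, ∃ x ∈ Submodule.torsionBySet R E (i.1 : Set R), x ≠ 0 := fun i =>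
    Submodule.exists_mem_ne_zero_of_ne_bot i.2.2
  choose v hv hv0 using hex
  have hli : LinearIndependent K2 v := theta_linIndep K2 R E (fun i : ι => i.1) (fun i => i.2.1)
    Subtype.val_injective v hv hv0
  obtain ⟨θ, hθ⟩ : ∃ θ : E →ₗ[K2] K2, ∀ i, θ (v i) = 1 := by
    let b := Module.Basis.span hli
    obtain ⟨θ, hθ⟩ := LinearMap.exists_extend (b.constr K2 (fun _ : ι => (1 : K2)))
    refine ⟨θ, fun i => ?_⟩
    have := LinearMap.congr_fun hθ (b i)
    rw [Module.Basis.constr_basis] at this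
    rw [← this]
    simp [b, Module.Basis.span_apply]
  refine ⟨θ, fun N hN hfin => ?_⟩
  have hart : IsArtinian R N := by
    have : IsArtinian K1 N := inferInstanceAs (IsArtinian K1 (N.restrictScalars K1))
    exact isArtinian_of_tower K1 this
  have : Nontrivial N := (Submodule.nontrivial_iff_ne_bot).mpr hN
  obtain ⟨S₀, hS₀⟩ := IsAtomic.exists_atom (Submodule R N)
  let S := S₀.map N.subtype
  have hSN : S ≤ N := by simpa [S] using Submodule.map_subtype_le N S₀
  have hS : IsAtom S := by
    rw [← isSimpleModule_iff_isAtom] at hS₀ ⊢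
    exact IsSimpleModule.congr (Submodule.equivMapOfInjective N.subtype N.injective_subtype S₀).symm
  have : FiniteDimensional K1 (S.restrictScalars K1) :=
    FiniteDimensional.of_injective
      (Submodule.inclusion (show S.restrictScalars K1 ≤ N.restrictScalars K1 from hSN))
      (Submodule.inclusion_injective _)
  have hTS := theta_simple K1 R E ev nondeg S hS
  have hsimp : IsSimpleModule R S := isSimpleModule_iff_isAtom.mpr hS
  let i : ι := ⟨Module.annihilator R S, IsSimpleModule.annihilator_isMaximal, by
    rw [hTS]; exact hS.1⟩
  refine ⟨v i, hSN ?_, by rw [hθ]; exact one_ne_zero⟩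
  rw [← hTS]
  exact hv i

end ThetaFunctional

section BiDual

set_option linter.unusedSectionVars false
set_option linter.style.haveILetI false

/-- Additive maps `K2 → K1`, as a `K1`-`K2`-bimodule. -/
def BiE (K1 K2 : Type*) [Field K1] [Field K2] := K2 →+ K1

variable (K1 K2 : Type*) [Field K1] [Field K2]

noncomputable instance : AddCommGroup (BiE K1 K2) := inferInstanceAs (AddCommGroup (K2 →+ K1))

/-- Build an element of `BiE`. -/
def BiE.mk {K1 K2 : Type*} [Field K1] [Field K2] (g : K2 →+ K1) : BiE K1 K2 := g

/-- Underlying additive map. -/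
def BiE.fn {K1 K2 : Type*} [Field K1] [Field K2] (g : BiE K1 K2) : K2 →+ K1 := g

theorem BiE.ext' {g h : BiE K1 K2} (H : ∀ s, g.fn s = h.fn s) : g = h :=
  AddMonoidHom.ext H

@[simp] theorem BiE.mk_fn (g : K2 →+ K1) : (BiE.mk g).fn = g := rfl
@[simp] theorem BiE.add_fn (g h : BiE K1 K2) (s : K2) : (g + h).fn s = g.fn s + h.fn s := rfl
@[simp] theorem BiE.zero_fn (s : K2) : (0 : BiE K1 K2).fn s = 0 := rfl

noncomputable instance BiE.moduleLeft : Module K1 (BiE K1 K2) :=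
  inferInstanceAs (Module K1 (K2 →+ K1))

@[simp] theorem BiE.smul_left_fn (a : K1) (g : BiE K1 K2) (s : K2) :
    (a • g).fn s = a * g.fn s := rfl

noncomputable instance BiE.moduleRight : Module K2 (BiE K1 K2) where
  smul t g := BiE.mk (g.fn.comp (AddMonoidHom.mulRight t))
  one_smul g := BiE.ext' _ _ fun s => by
    change g.fn (s * 1) = _; rw [mul_one]
  mul_smul a b g := BiE.ext' _ _ fun s => by
    change g.fn (s * (a * b)) = g.fn (s * a * b); rw [mul_assoc]
  smul_zero a := BiE.ext' _ _ fun s => rfl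
  smul_add a g h := BiE.ext' _ _ fun s => rfl
  add_smul a b g := BiE.ext' _ _ fun s => by
    change g.fn (s * (a + b)) = g.fn (s * a) + g.fn (s * b); rw [mul_add, map_add]
  zero_smul g := BiE.ext' _ _ fun s => by
    change g.fn (s * 0) = 0; rw [mul_zero, map_zero]

theorem theta_bi_exists : ∃ θ : BiE K1 K2 →ₗ[K2] K2,
    ∀ N : Submodule K1 (BiE K1 K2), N ≠ ⊥ → FiniteDimensional K1 N →
      (∀ (t : K2), ∀ x ∈ N, t • x ∈ N) → ∃ x ∈ N, θ x ≠ 0 := by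
  let R := TensorProduct ℤ K1 K2
  have hcomm : SMulCommClass K1 K2 (BiE K1 K2) := ⟨fun a t g => rfl⟩
  let _i1 : Module R (BiE K1 K2) := TensorProduct.Algebra.module
  have hsm : ∀ (a : K1) (t : K2) (g : BiE K1 K2), (TensorProduct.tmul ℤ a t : R) • g = a • t • g :=
    fun a t g => TensorProduct.Algebra.smul_def a t g
  let _i : Algebra K2 R := Algebra.TensorProduct.rightAlgebra
  have : IsScalarTower K1 R (BiE K1 K2) := IsScalarTower.of_algebraMap_smul (fun a g => by
    have : algebraMap K1 R a = TensorProduct.tmul ℤ a 1 := rfl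
    rw [this, hsm, one_smul])
  have : IsScalarTower K2 R (BiE K1 K2) := IsScalarTower.of_algebraMap_smul (fun a g => by
    have : algebraMap K2 R a = TensorProduct.tmul ℤ 1 a := rfl
    rw [this, hsm, one_smul])
  let ev : BiE K1 K2 →ₗ[K1] K1 :=
    { toFun := fun g => g.fn 1
      map_add' := fun _ _ => rfl
      map_smul' := fun _ _ => rfl }
  obtain ⟨θ, hθ⟩ := theta_exists K1 K2 R (BiE K1 K2) ev (fun x hx => BiE.ext' _ _ fun s => by
    have := hx (TensorProduct.tmul ℤ 1 s)
    rw [hsm, one_smul] at this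
    change x.fn (1 * s) = 0 at this
    rw [one_mul] at this
    exact this)
  refine ⟨θ, fun N hN hfin hst => ?_⟩
  let N' : Submodule R (BiE K1 K2) :=
    { carrier := N
      add_mem' := N.add_mem
      zero_mem' := N.zero_mem
      smul_mem' := fun r x hx => by
        induction r using TensorProduct.induction_on with
        | zero =>
          have h0 : (0 : R) • x = 0 := zero_smul R x
          exact (congrArg (· ∈ N) h0).mpr N.zero_mem
        | tmul a t => rw [hsm]; exact N.smul_mem _ (hst _ _ hx)
        | add a b ha hb =>
          have h0 : ((a + b : R)) • x = a • x + b • x := add_smul (R := R) a b x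
          exact (congrArg (· ∈ N) h0).mpr (N.add_mem ha hb) }
  have h1 : N'.restrictScalars K1 = N := rfl
  exact hθ N' (fun h => hN (by rw [← h1, h]; rfl)) (by rw [h1]; exact hfin)

/-- A chosen functional. -/
noncomputable def thetaBi : BiE K1 K2 →ₗ[K2] K2 := (theta_bi_exists K1 K2).choose

theorem thetaBi_spec (N : Submodule K1 (BiE K1 K2)) (h : N ≠ ⊥) (hf : FiniteDimensional K1 N)
    (hs : ∀ (t : K2), ∀ x ∈ N, t • x ∈ N) : ∃ x ∈ N, thetaBi K1 K2 x ≠ 0 :=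
  (theta_bi_exists K1 K2).choose_spec N h hf hs

section
variable {M M' : Type*} [AddCommGroup M] [Module K1 M] [Module K2 M] [SMulCommClass K1 K2 M]
  [AddCommGroup M'] [Module K1 M'] [Module K2 M'] [SMulCommClass K1 K2 M']

/-- `m ↦ (s ↦ f (s • m))`. -/
noncomputable def toBiE (f : Module.Dual K1 M) : M →ₗ[K1] BiE K1 K2 where
  toFun m := BiE.mk (f.toAddMonoidHom.comp (AddMonoidHom.flip (smulAddHom K2 M) m))
  map_add' m m' := BiE.ext' _ _ fun s => by
    change f (s • (m + m')) = f (s • m) + f (s • m'); rw [smul_add, map_add]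
  map_smul' a m := BiE.ext' _ _ fun s => by
    change f (s • a • m) = a * f (s • m); rw [← smul_comm a s, map_smul, smul_eq_mul]

@[simp] theorem toBiE_fn (f : Module.Dual K1 M) (m : M) (s : K2) :
    (toBiE K1 K2 f m).fn s = f (s • m) := rfl

theorem toBiE_smul (f : Module.Dual K1 M) (t : K2) (m : M) :
    toBiE K1 K2 f (t • m) = t • toBiE K1 K2 f m := BiE.ext' _ _ fun s => by
  change f (s • t • m) = f ((s * t) • m); rw [mul_smul]

/-- Change of duality. -/
noncomputable def biPsi : Module.Dual K1 M →+ Module.Dual K2 M where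
  toFun f :=
    { toFun := fun m => thetaBi K1 K2 (toBiE K1 K2 f m)
      map_add' := fun m m' => by rw [map_add, map_add]
      map_smul' := fun t m => by rw [toBiE_smul, map_smul]; rfl }
  map_zero' := by
    ext m
    have : toBiE K1 K2 (0 : Module.Dual K1 M) m = 0 := BiE.ext' _ _ fun s => rfl
    simp [this]
  map_add' f g := by
    ext m
    have : toBiE K1 K2 (f + g) m = toBiE K1 K2 f m + toBiE K1 K2 g m := BiE.ext' _ _ fun s => rfl
    simp [this]

theorem biPsi_apply (f : Module.Dual K1 M) (m : M) :
    biPsi K1 K2 f m = thetaBi K1 K2 (toBiE K1 K2 f m) := rfl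

/-- naturality of change of duality -/
theorem biPsi_nat (φ : M → M') (hφ2 : ∀ (t : K2) m, φ (t • m) = t • φ m)
    (f : Module.Dual K1 M) (f' : Module.Dual K1 M') (hf : ∀ m, f m = f' (φ m)) (m : M) :
    biPsi K1 K2 f m = biPsi K1 K2 f' (φ m) := by
  rw [biPsi_apply, biPsi_apply]
  congr 1
  refine BiE.ext' _ _ fun s => ?_
  rw [toBiE_fn, toBiE_fn, hf, hφ2]

theorem biPsi_smul_left (a : K1) (f : Module.Dual K1 M) (m : M) :
    biPsi K1 K2 (a • f) m = biPsi K1 K2 f (a • m) :=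
  biPsi_nat K1 K2 (fun m : M => a • m) (fun t m => smul_comm a t m) (a • f) f
    (fun m => by simp) m

theorem biPsi_injective [FiniteDimensional K1 M] :
    Function.Injective (biPsi K1 K2 (M := M)) := by
  rw [injective_iff_map_eq_zero]
  intro f hf
  by_contra hne
  have hN : LinearMap.range (toBiE K1 K2 f) ≠ ⊥ := by
    intro h
    apply hne
    ext m
    have h1 : toBiE K1 K2 f m ∈ LinearMap.range (toBiE K1 K2 f) := ⟨m, rfl⟩
    rw [h, Submodule.mem_bot] at h1
    have h2 : (toBiE K1 K2 f m).fn 1 = 0 := by rw [h1]; rfl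
    simpa using h2
  obtain ⟨_, ⟨m, rfl⟩, hx⟩ := thetaBi_spec K1 K2 _ hN inferInstance (by
    rintro t _ ⟨m, rfl⟩
    exact ⟨t • m, toBiE_smul K1 K2 f t m⟩)
  exact hx (LinearMap.congr_fun hf m)

theorem biPsi_surjective_aux [FiniteDimensional K1 M] [FiniteDimensional K2 M] :
    haveI : SMulCommClass K2 K1 M := SMulCommClass.symm K1 K2 M
    Function.Surjective (biPsi K2 K1 (M := M)) := by
  have : SMulCommClass K2 K1 M := SMulCommClass.symm K1 K2 M
  let L : Module.Dual K1 M →ₗ[K1] Module.Dual K1 M :=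
    { toFun := fun f => biPsi K2 K1 (biPsi K1 K2 f)
      map_add' := fun f g => by rw [map_add, map_add]
      map_smul' := fun a f => by
        ext m
        have h := biPsi_nat K2 K1 (fun m : M => a • m) (fun t m => smul_comm a t m)
          (biPsi K1 K2 (a • f)) (biPsi K1 K2 f) (fun m => biPsi_smul_left K1 K2 a f m) m
        rw [h, map_smul]
        rfl }
  have hL : Function.Injective L :=
    (biPsi_injective K2 K1).comp (biPsi_injective K1 K2)
  have hs := LinearMap.injective_iff_surjective.mp hL
  intro g
  obtain ⟨f, hf⟩ := hs g
  exact ⟨_, hf⟩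

theorem biPsi_bijective [FiniteDimensional K1 M] [FiniteDimensional K2 M] :
    Function.Bijective (biPsi K1 K2 (M := M)) := by
  have : SMulCommClass K2 K1 M := SMulCommClass.symm K1 K2 M
  exact ⟨biPsi_injective K1 K2, biPsi_surjective_aux K2 K1⟩

end
end BiDual

section TwistedHom

set_option linter.unusedSectionVars false

/-- A copy of the field `k`. -/
def TwK (k : Type*) := k

noncomputable instance (k : Type*) [Field k] : Field (TwK k) := inferInstanceAs (Field k)

/-- identity to the copy -/
def TwK.of (k : Type*) [Field k] : k →+* TwK k := RingHom.id k

/-- identity from the copy -/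
def TwK.un (k : Type*) [Field k] : TwK k →+* k := RingHom.id k

instance (k : Type*) [Field k] : RingHomSurjective (TwK.of k) := ⟨fun x => ⟨x, rfl⟩⟩

variable (k : Type*) [Field k] {A B : Type*} [Category A] [Category B] [Preadditive A]
  [Preadditive B] [CategoryTheory.Linear k A] [CategoryTheory.Linear k B]
  (F : A ⥤ B) [F.Full] [F.Faithful] [F.Additive]

/-- A copy of the morphisms in `A`, with a second scalar action coming from `F`. -/
def TwHom (_F : A ⥤ B) (X Y : A) := X ⟶ Y

noncomputable instance (X Y : A) : AddCommGroup (TwHom F X Y) :=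
  inferInstanceAs (AddCommGroup (X ⟶ Y))

noncomputable instance TwHom.mod (X Y : A) : Module k (TwHom F X Y) :=
  inferInstanceAs (Module k (X ⟶ Y))

/-- wrap -/
def TwHom.of {X Y : A} (f : X ⟶ Y) : TwHom F X Y := f
/-- unwrap -/
def TwHom.un {X Y : A} (f : TwHom F X Y) : X ⟶ Y := f

noncomputable instance (X Y : A) : SMul (TwK k) (TwHom F X Y) where
  smul s f := TwHom.of F (F.preimage (TwK.un k s • F.map (TwHom.un F f)))

theorem TwHom.map_smul {X Y : A} (s : TwK k) (f : TwHom F X Y) :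
    F.map (TwHom.un F (s • f)) = TwK.un k s • F.map (TwHom.un F f) :=
  F.map_preimage _

theorem TwHom.ext' {X Y : A} {f g : TwHom F X Y}
    (h : F.map (TwHom.un F f) = F.map (TwHom.un F g)) : f = g := F.map_injective h

theorem TwHom.map_add {X Y : A} (f g : TwHom F X Y) :
    F.map (TwHom.un F (f + g)) = F.map (TwHom.un F f) + F.map (TwHom.un F g) :=
  F.map_add

theorem TwHom.map_zero {X Y : A} :
    F.map (TwHom.un F (0 : TwHom F X Y)) = 0 := F.map_zero _ _

noncomputable instance TwHom.modTw (X Y : A) : Module (TwK k) (TwHom F X Y) where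
  one_smul f := TwHom.ext' F (by rw [TwHom.map_smul, _root_.map_one, one_smul])
  mul_smul a b f := TwHom.ext' F (by
    rw [TwHom.map_smul, TwHom.map_smul, TwHom.map_smul, _root_.map_mul, mul_smul])
  smul_zero a := TwHom.ext' F (by rw [TwHom.map_smul, TwHom.map_zero, smul_zero])
  smul_add a f g := TwHom.ext' F (by
    rw [TwHom.map_smul, TwHom.map_add, TwHom.map_add, TwHom.map_smul, TwHom.map_smul, smul_add])
  add_smul a b f := TwHom.ext' F (by
    rw [TwHom.map_smul, TwHom.map_add, TwHom.map_smul, TwHom.map_smul, _root_.map_add, add_smul])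
  zero_smul f := TwHom.ext' F (by
    rw [TwHom.map_smul, TwHom.map_zero, _root_.map_zero, zero_smul])

theorem TwHom.smul_un {X Y : A} (a : k) (f : TwHom F X Y) :
    F.map (TwHom.un F (a • f)) = F.map (a • 𝟙 X) ≫ F.map (TwHom.un F f) := by
  rw [← F.map_comp]
  congr 1
  change a • (TwHom.un F f) = _
  simp

instance (X Y : A) : SMulCommClass k (TwK k) (TwHom F X Y) where
  smul_comm a s f := TwHom.ext' F (by
    rw [TwHom.smul_un, TwHom.map_smul, TwHom.map_smul, TwHom.smul_un, Linear.comp_smul])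

instance (X Y : A) [h : FiniteDimensional k (X ⟶ Y)] : FiniteDimensional k (TwHom F X Y) := h

/-- the comparison map -/
noncomputable def twSemi (X Y : A) : (F.obj X ⟶ F.obj Y) →ₛₗ[TwK.of k] TwHom F X Y where
  toFun g := TwHom.of F (F.preimage g)
  map_add' f g := TwHom.ext' F (by
    rw [TwHom.map_add]; simp [TwHom.un, TwHom.of])
  map_smul' s g := TwHom.ext' F (by
    rw [TwHom.map_smul]
    change F.map (F.preimage (s • g)) = s • F.map (F.preimage g)
    rw [F.map_preimage, F.map_preimage])

theorem twSemi_map {X Y : A} (f : X ⟶ Y) : twSemi k F X Y (F.map f) = TwHom.of F f :=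
  TwHom.ext' F (F.map_preimage _)

theorem twSemi_bij (X Y : A) : Function.Bijective (twSemi k F X Y) := by
  constructor
  · intro a b h
    have h1 : ∀ a, F.map (TwHom.un F (twSemi k F X Y a)) = a := fun a => F.map_preimage a
    rw [← h1 a, h, h1]
  · intro f
    exact ⟨F.map (TwHom.un F f), twSemi_map k F _⟩

instance (X Y : A) [h : FiniteDimensional k (F.obj X ⟶ F.obj Y)] :
    FiniteDimensional (TwK k) (TwHom F X Y) :=
  Module.Finite.of_surjective (twSemi k F X Y) (twSemi_bij k F X Y).2

/-- the identity as an element of the bimodule -/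
noncomputable def twOne : BiE k (TwK k) := BiE.mk (TwK.un k).toAddMonoidHom

/-- cast of functionals -/
def twD {X Y : A} (φ : Module.Dual k (X ⟶ Y)) : Module.Dual k (TwHom F X Y) := φ

/-- the scaling constant -/
noncomputable def twConst : TwK k := thetaBi k (TwK k) (twOne k)

theorem twConst_ne_zero : twConst k ≠ 0 := by
  obtain ⟨x, hx, h⟩ := thetaBi_spec k (TwK k) (Submodule.span k {twOne k}) (by
      rw [Ne, Submodule.span_singleton_eq_bot]
      intro h
      have : (twOne k).fn 1 = 0 := by rw [h]; rfl
      exact one_ne_zero (α := k) this) inferInstance (by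
      intro t x hx
      rw [Submodule.mem_span_singleton] at hx ⊢
      obtain ⟨a, rfl⟩ := hx
      refine ⟨TwK.un k t * a, BiE.ext' _ _ fun s => ?_⟩
      change (TwK.un k t * a) * (TwK.un k s) = a * (TwK.un k s * TwK.un k t)
      ring)
  rw [Submodule.mem_span_singleton] at hx
  obtain ⟨a, rfl⟩ := hx
  intro h0
  apply h
  have : a • twOne k =
      TwK.of k a • (twOne k) := BiE.ext' _ _ fun s => by
    change a * TwK.un k s = TwK.un k s * a
    ring
  rw [this, LinearMap.map_smul]
  change _ • twConst k = _
  rw [h0, smul_zero]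

/-- Transfer of duals along a fully faithful functor. -/
noncomputable def twPsi (X Y : A) :
    Module.Dual k (X ⟶ Y) →+ Module.Dual k (F.obj X ⟶ F.obj Y) where
  toFun φ :=
    { toFun := fun g => TwK.un k ((twConst k)⁻¹ *
        biPsi k (TwK k) (twD k F φ) (twSemi k F X Y g))
      map_add' := fun g g' => by rw [_root_.map_add, _root_.map_add, mul_add, _root_.map_add]
      map_smul' := fun s g => by
        rw [LinearMap.map_smulₛₗ, LinearMap.map_smul, smul_eq_mul, mul_left_comm, _root_.map_mul]
        rfl }
  map_zero' := by
    ext g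
    change TwK.un k ((twConst k)⁻¹ *
        biPsi k (TwK k) (M := TwHom F X Y) 0 (twSemi k F X Y g)) = 0
    simp
  map_add' φ ψ := by
    ext g
    change TwK.un k ((twConst k)⁻¹ * biPsi k (TwK k) (M := TwHom F X Y)
      (twD k F φ + twD k F ψ) _) = _
    rw [_root_.map_add, LinearMap.add_apply, mul_add, _root_.map_add]
    rfl

theorem twPsi_apply {X Y : A} (φ : Module.Dual k (X ⟶ Y)) (f : X ⟶ Y) :
    twPsi k F X Y φ (F.map f) = TwK.un k ((twConst k)⁻¹ *
        biPsi k (TwK k) (twD k F φ) (TwHom.of F f)) := by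
  rw [← twSemi_map k F f]; rfl

theorem twPsi_nat {X Y X' Y' : A} (a : X' ⟶ X) (b : Y ⟶ Y') (φ : Module.Dual k (X ⟶ Y))
    (φ' : Module.Dual k (X' ⟶ Y')) (h : ∀ f, φ f = φ' (a ≫ f ≫ b)) (f : X ⟶ Y) :
    twPsi k F X Y φ (F.map f) = twPsi k F X' Y' φ' (F.map (a ≫ f ≫ b)) := by
  rw [twPsi_apply, twPsi_apply]
  congr 2
  exact biPsi_nat k (TwK k) (M := TwHom F X Y) (M' := TwHom F X' Y')
    (fun f => TwHom.of F (a ≫ TwHom.un F f ≫ b))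
    (fun t m => TwHom.ext' F (by
      rw [TwHom.map_smul]
      change F.map (a ≫ _ ≫ b) = _ • F.map (a ≫ _ ≫ b)
      simp only [F.map_comp, TwHom.map_smul, Linear.comp_smul, Linear.smul_comp])) (twD k F φ) (twD k F φ') h
    (TwHom.of F f)

theorem twPsi_norm {X Y : A} (φ : Module.Dual k (X ⟶ Y)) (f : X ⟶ Y)
    (h : ∀ (s : k) (f' : X ⟶ Y), F.map f' = s • F.map f → φ f' = s * φ f) :
    twPsi k F X Y φ (F.map f) = φ f := by
  rw [twPsi_apply, biPsi_apply]
  have : toBiE k (TwK k) (twD k F φ) (TwHom.of F f) =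
      TwK.of k (φ f) • (twOne k) := BiE.ext' _ _ fun s => by
    rw [toBiE_fn]
    change _ = TwK.un k s * φ f
    exact h _ _ (TwHom.map_smul k F s (TwHom.of F f))
  rw [this, LinearMap.map_smul]
  change TwK.un k ((twConst k)⁻¹ * (TwK.of k (φ f) * twConst k)) = _
  rw [mul_left_comm, inv_mul_cancel₀ (twConst_ne_zero k), mul_one]
  rfl

theorem twPsi_bijective (X Y : A) [FiniteDimensional k (X ⟶ Y)]
    [FiniteDimensional k (F.obj X ⟶ F.obj Y)] : Function.Bijective (twPsi k F X Y) := by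
  have hb := biPsi_bijective k (TwK k) (M := TwHom F X Y)
  constructor
  · rw [injective_iff_map_eq_zero]
    intro φ hφ
    apply (injective_iff_map_eq_zero _).mp hb.1
    ext f
    have h1 := twPsi_apply k F φ (TwHom.un F f)
    rw [hφ] at h1
    have h2 : (twConst k)⁻¹ * biPsi k (TwK k) (twD k F φ) f = 0 := h1.symm
    exact (mul_eq_zero.mp h2).resolve_left (inv_ne_zero (twConst_ne_zero k))
  · intro ψ
    let ψ' : Module.Dual (TwK k) (TwHom F X Y) :=
      { toFun := fun f => twConst k * TwK.of k (ψ (F.map (TwHom.un F f)))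
        map_add' := fun f g => by
          rw [TwHom.map_add, _root_.map_add, _root_.map_add, mul_add]
        map_smul' := fun s f => by
          rw [TwHom.map_smul, LinearMap.map_smul, smul_eq_mul, _root_.map_mul, mul_left_comm]
          rfl }
    obtain ⟨φ, hφ⟩ : ∃ φ : Module.Dual k (X ⟶ Y), biPsi k (TwK k) (twD k F φ) = ψ' := hb.2 ψ'
    refine ⟨φ, ?_⟩
    ext g
    obtain ⟨f, rfl⟩ := F.map_surjective g
    rw [twPsi_apply]
    rw [hφ]
    change TwK.un k ((twConst k)⁻¹ * (twConst k * TwK.of k (ψ (F.map f)))) = _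
    rw [inv_mul_cancel_left₀ (twConst_ne_zero k)]
    rfl

end TwistedHom

section CommShiftOne

variable {C D : Type*} [Category C] [Category D] [HasShift C ℤ] [HasShift D ℤ] (F : C ⥤ D)

/-- all commutation isos -/
structure ShIso where
  n : ℤ
  e : shiftFunctor C n ⋙ F ≅ F ⋙ shiftFunctor D n

variable {F}

theorem ShIso.ext_add {a b c : ℤ} (h : a + b = c)
    (e₁ : shiftFunctor C a ⋙ F ≅ F ⋙ shiftFunctor D a)
    (e₂ : shiftFunctor C b ⋙ F ≅ F ⋙ shiftFunctor D b) :
    (⟨a + b, Functor.CommShift.isoAdd e₁ e₂⟩ : ShIso F) =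
      ⟨c, Functor.CommShift.isoAdd' h e₁ e₂⟩ := by
  subst h; rfl

noncomputable instance : Mul (ShIso F) := ⟨fun x y => ⟨x.n + y.n, Functor.CommShift.isoAdd x.e y.e⟩⟩
noncomputable instance : One (ShIso F) := ⟨⟨0, Functor.CommShift.isoZero F ℤ⟩⟩

theorem ShIso.exists_inv (x : ShIso F) : ∃ y : ShIso F, y * x = 1 := by
  obtain ⟨n, e⟩ := x
  have hn : -n + n = 0 := neg_add_cancel n
  let w : (shiftFunctor C (-n) ⋙ F) ⋙ shiftFunctor D n ≅
      (F ⋙ shiftFunctor D (-n)) ⋙ shiftFunctor D n :=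
    Functor.associator _ _ _ ≪≫ Functor.isoWhiskerLeft _ e.symm ≪≫
      (Functor.associator _ _ _).symm ≪≫
      Functor.isoWhiskerRight (shiftFunctorAdd' C _ _ _ hn).symm F ≪≫
      Functor.CommShift.isoZero F ℤ ≪≫ Functor.isoWhiskerLeft _ (shiftFunctorAdd' D _ _ _ hn) ≪≫
      (Functor.associator _ _ _).symm
  let e' : shiftFunctor C (-n) ⋙ F ≅ F ⋙ shiftFunctor D (-n) :=
    ((Functor.FullyFaithful.ofFullyFaithful (shiftFunctor D n)).whiskeringRight C).preimageIso w
  have he' : ∀ X, (shiftFunctor D n).map (e'.hom.app X) = w.hom.app X := fun X =>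
    (Functor.FullyFaithful.ofFullyFaithful (shiftFunctor D n)).map_preimage (w.hom.app X)
  refine ⟨⟨-n, e'⟩, (ShIso.ext_add hn e' e).trans ?_⟩
  change _ = (⟨0, Functor.CommShift.isoZero F ℤ⟩ : ShIso F)
  congr 1
  ext X
  rw [Functor.CommShift.isoAdd'_hom_app, he']
  simp [w]

noncomputable instance : Inv (ShIso F) := ⟨fun x => x.exists_inv.choose⟩

noncomputable instance : Group (ShIso F) := Group.ofLeftAxioms
  (fun x y z => by
    refine (ShIso.ext_add (add_assoc x.n y.n z.n) _ _).trans ?_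
    exact congrArg _ (Functor.CommShift.isoAdd'_assoc x.e y.e z.e rfl rfl
      (add_assoc x.n y.n z.n)))
  (fun x => (ShIso.ext_add (zero_add _) _ _).trans
      (congrArg (ShIso.mk x.n) (Functor.CommShift.isoZero_isoAdd'_ x.e)))
  (fun x => x.exists_inv.choose_spec)

theorem ShIso.zpow_n (x : ShIso F) (hx : x.n = 1) (m : ℤ) : (x ^ m).n = m := by
  let φ : ShIso F →* Multiplicative ℤ :=
    { toFun := fun x => Multiplicative.ofAdd x.n
      map_one' := rfl
      map_mul' := fun _ _ => rfl }
  have h := map_zpow φ x m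
  have h1 : φ x = Multiplicative.ofAdd 1 := congrArg Multiplicative.ofAdd hx
  rw [h1, ← ofAdd_zsmul] at h
  have h2 : Multiplicative.ofAdd (x ^ m).n = Multiplicative.ofAdd (m • (1 : ℤ)) := h
  simpa using Multiplicative.ofAdd.injective h2

theorem ShIso.eq_cast (x : ShIso F) (m : ℤ) (h : x.n = m) :
    ∃ e : shiftFunctor C m ⋙ F ≅ F ⋙ shiftFunctor D m, x = ⟨m, e⟩ := by
  subst h; exact ⟨x.e, rfl⟩

theorem exists_commShift (e₁ : shiftFunctor C (1 : ℤ) ⋙ F ≅ F ⋙ shiftFunctor D (1 : ℤ)) :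
    ∃ c : F.CommShift ℤ, c.commShiftIso 1 = e₁ := by
  let x : ShIso F := ⟨1, e₁⟩
  choose f hf using fun m : ℤ => ShIso.eq_cast (x ^ m) m (ShIso.zpow_n x rfl m)
  have inj : ∀ {m : ℤ} {e e' : shiftFunctor C m ⋙ F ≅ F ⋙ shiftFunctor D m},
      (⟨m, e⟩ : ShIso F) = ⟨m, e'⟩ → e = e' := fun h => by
    simpa using h
  refine ⟨{ commShiftIso := f, commShiftIso_zero := ?_, commShiftIso_add := ?_ }, ?_⟩
  · apply inj
    rw [← hf, zpow_zero]; rfl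
  · intro a b
    apply inj
    rw [← hf, zpow_add, hf a, hf b]; rfl
  · apply inj
    exact (hf 1).symm.trans (zpow_one x)

end CommShiftOne

section SerreTrace

variable {k : Type*} [Field k] {C : Type*} [Category C] [Preadditive C]
  [CategoryTheory.Linear k C] {S : C ⥤ C} (hS : RightSerreData k C S)

/-- the trace form of a Serre functor -/
noncomputable def RightSerreData.tr (X : C) : Module.Dual k (X ⟶ S.obj X) := hS.e X X (𝟙 X)

theorem RightSerreData.e_eq {X Y : C} (h : X ⟶ Y) (u : Y ⟶ S.obj X) :
    hS.e X Y h u = hS.tr X (h ≫ u) := by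
  have := hS.nat_right (𝟙 X) h u
  rwa [Category.id_comp] at this

theorem RightSerreData.tr_comm {X X' : C} (f : X' ⟶ X) (g : X ⟶ S.obj X') :
    hS.tr X' (f ≫ g) = hS.tr X (g ≫ S.map f) := by
  have := hS.nat_left f (𝟙 X) g
  rw [Category.comp_id, hS.e_eq, hS.e_eq, Category.id_comp] at this
  exact this

theorem RightSerreData.exists_unique [∀ X Y : C, FiniteDimensional k (X ⟶ Y)] {Z W : C}
    (φ : Module.Dual k (Z ⟶ W)) :
    ∃! d : W ⟶ S.obj Z, ∀ g : Z ⟶ W, φ g = hS.tr Z (g ≫ d) := by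
  let E := (Module.evalEquiv k (W ⟶ S.obj Z)).trans (hS.e Z W).dualMap
  have hE : ∀ d g, E d g = hS.tr Z (g ≫ d) := fun d g => by
    rw [← hS.e_eq]; rfl
  refine ⟨E.symm φ, fun g => by rw [← hE, E.apply_symm_apply], fun d hd => ?_⟩
  apply E.injective
  rw [E.apply_symm_apply]
  ext g
  rw [hE, ← hd]

theorem RightSerreData.hom_ext [∀ X Y : C, FiniteDimensional k (X ⟶ Y)] {Z W : C}
    {d d' : W ⟶ S.obj Z} (h : ∀ g : Z ⟶ W, hS.tr Z (g ≫ d) = hS.tr Z (g ≫ d')) : d = d' := by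
  obtain ⟨d₀, -, h2⟩ := hS.exists_unique ((hS.tr Z).comp (Linear.rightComp k Z d))
  rw [h2 d (fun g => rfl), h2 d' (fun g => h g)]

theorem RightSerreData.hom_ext_left {Z W : C}
    {g g' : Z ⟶ W} (h : ∀ d : W ⟶ S.obj Z, hS.tr Z (g ≫ d) = hS.tr Z (g' ≫ d)) : g = g' := by
  apply (hS.e Z W).injective
  ext d
  rw [hS.e_eq, hS.e_eq, h]

end SerreTrace

section SerreTriangle

set_option linter.unusedSectionVars false

theorem exists_dual_of_consistent {k A B M : Type*} [Field k] [AddCommGroup A] [AddCommGroup B]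
    [AddCommGroup M] [Module k A] [Module k B] [Module k M]
    (l : A →ₗ[k] M) (l' : B →ₗ[k] M) (p : Module.Dual k A) (q : Module.Dual k B)
    (h : ∀ a b, l a = l' b → p a = q b) :
    ∃ φ : Module.Dual k M, (∀ a, φ (l a) = p a) ∧ (∀ b, φ (l' b) = q b) := by
  let L : A × B →ₗ[k] M := LinearMap.coprod l (-l')
  let r : Module.Dual k (A × B) := LinearMap.coprod p (-q)
  have hr : r ∈ LinearMap.range L.dualMap := by
    rw [LinearMap.range_dualMap_eq_dualAnnihilator_ker, Submodule.mem_dualAnnihilator]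
    rintro ⟨a, b⟩ hab
    have h1 : l a + -l' b = 0 := hab
    change p a + -q b = 0
    rw [h a b (by rwa [← sub_eq_add_neg, sub_eq_zero] at h1), add_neg_cancel]
  obtain ⟨φ, hφ⟩ := hr
  refine ⟨φ, fun a => ?_, fun b => ?_⟩
  · have := LinearMap.congr_fun hφ (a, 0)
    simpa [L, r] using this
  · have := LinearMap.congr_fun hφ (0, b)
    simpa [L, r] using this

variable {k : Type*} [Field k] {C : Type*} [Category C] [HasShift C ℤ] [Preadditive C]
  [HasZeroObject C] [∀ n : ℤ, (shiftFunctor C n).Additive] [Pretriangulated C]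
  [CategoryTheory.Linear k C] [∀ X Y : C, FiniteDimensional k (X ⟶ Y)]

section
variable {S : C ⥤ C} (hS : RightSerreData k C S)

/-- The shifted trace. -/
noncomputable def RightSerreData.trSh (X : C) :
    Module.Dual k (X⟦(1 : ℤ)⟧ ⟶ (S.obj X)⟦(1 : ℤ)⟧) :=
  twPsi k (shiftFunctor C (1 : ℤ)) X (S.obj X) (hS.tr X)

theorem RightSerreData.exists_alpha (X : C) :
    ∃! α : (S.obj X)⟦(1 : ℤ)⟧ ⟶ S.obj (X⟦(1 : ℤ)⟧),
      ∀ g, (-hS.trSh X) g = hS.tr _ (g ≫ α) := hS.exists_unique (-hS.trSh X)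

/-- The comparison. -/
noncomputable def RightSerreData.alpha (X : C) : (S.obj X)⟦(1 : ℤ)⟧ ⟶ S.obj (X⟦(1 : ℤ)⟧) :=
  (hS.exists_alpha X).choose

theorem RightSerreData.tr_alpha (X : C) (g : X⟦(1 : ℤ)⟧ ⟶ (S.obj X)⟦(1 : ℤ)⟧) :
    hS.tr _ (g ≫ hS.alpha X) = -hS.trSh X g :=
  ((hS.exists_alpha X).choose_spec.1 g).symm

theorem RightSerreData.alpha_nat {X X' : C} (f : X ⟶ X') :
    (S.map f)⟦(1 : ℤ)⟧' ≫ hS.alpha X' = hS.alpha X ≫ S.map (f⟦(1 : ℤ)⟧') := by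
  apply hS.hom_ext
  intro g
  obtain ⟨g, rfl⟩ := (shiftFunctor C (1 : ℤ)).map_surjective g
  rw [← Category.assoc, ← Functor.map_comp, hS.tr_alpha, ← Category.assoc, ← hS.tr_comm,
    ← Category.assoc, ← Functor.map_comp, hS.tr_alpha]
  congr 1
  let φ : Module.Dual k (X' ⟶ S.obj X) := (hS.tr X).comp (Linear.leftComp k _ f)
  have h1 := twPsi_nat k (shiftFunctor C (1 : ℤ)) f (𝟙 _) φ (hS.tr X)
    (fun t => by rw [Category.comp_id]; rfl) g
  have h2 := twPsi_nat k (shiftFunctor C (1 : ℤ)) (𝟙 _) (S.map f) φ (hS.tr X')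
    (fun t => by rw [Category.id_comp, ← hS.tr_comm]; rfl) g
  rw [Category.comp_id] at h1
  rw [Category.id_comp] at h2
  exact h2.symm.trans h1

theorem RightSerreData.alpha_bij_aux (X Y : C) :
    Function.Bijective (fun g : Y⟦(1 : ℤ)⟧ ⟶ (S.obj X)⟦(1 : ℤ)⟧ => g ≫ hS.alpha X) := by
  have key : ∀ (g₀ : Y ⟶ S.obj X) (t₀ : X ⟶ Y),
      hS.tr _ (t₀⟦(1 : ℤ)⟧' ≫ g₀⟦(1 : ℤ)⟧' ≫ hS.alpha X) =
      - twPsi k (shiftFunctor C (1 : ℤ)) X Y ((hS.tr X).comp (Linear.rightComp k _ g₀))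
        (t₀⟦(1 : ℤ)⟧') := by
    intro g₀ t₀
    rw [← Category.assoc, ← Functor.map_comp, hS.tr_alpha]
    congr 1
    have h1 := twPsi_nat k (shiftFunctor C (1 : ℤ)) (𝟙 _) g₀
      ((hS.tr X).comp (Linear.rightComp k _ g₀)) (hS.tr X)
      (fun t => by rw [Category.id_comp]; rfl) t₀
    rw [Category.id_comp] at h1
    exact h1.symm
  have hbij := twPsi_bijective k (shiftFunctor C (1 : ℤ)) X Y
  constructor
  · intro g g' h
    obtain ⟨g, rfl⟩ := (shiftFunctor C (1 : ℤ)).map_surjective g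
    obtain ⟨g', rfl⟩ := (shiftFunctor C (1 : ℤ)).map_surjective g'
    congr 1
    apply hS.hom_ext
    intro t
    have : (hS.tr X).comp (Linear.rightComp k _ g) = (hS.tr X).comp (Linear.rightComp k _ g') := by
      apply hbij.1
      ext t
      obtain ⟨t, rfl⟩ := (shiftFunctor C (1 : ℤ)).map_surjective t
      apply neg_injective
      rw [← key, ← key]
      exact congrArg (fun x => hS.tr _ (t⟦(1 : ℤ)⟧' ≫ x)) h
    exact LinearMap.congr_fun this t
  · intro d
    obtain ⟨φ, hφ⟩ := hbij.2 (-((hS.tr _).comp (Linear.rightComp k _ d)))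
    obtain ⟨g₀, hg, -⟩ := hS.exists_unique φ
    refine ⟨g₀⟦(1 : ℤ)⟧', ?_⟩
    apply hS.hom_ext
    intro t
    obtain ⟨t, rfl⟩ := (shiftFunctor C (1 : ℤ)).map_surjective t
    have : (hS.tr X).comp (Linear.rightComp k _ g₀) = φ := by
      ext t
      exact (hg t).symm
    rw [key, this, hφ]
    exact neg_neg _

instance RightSerreData.alpha_iso (X : C) : IsIso (hS.alpha X) := by
  have hb : ∀ W : C, Function.Bijective (fun g : W ⟶ (S.obj X)⟦(1 : ℤ)⟧ => g ≫ hS.alpha X) := by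
    intro W
    let Y := (shiftFunctor C (1 : ℤ)).objPreimage W
    let e : Y⟦(1 : ℤ)⟧ ≅ W := (shiftFunctor C (1 : ℤ)).objObjPreimageIso W
    have h := hS.alpha_bij_aux X Y
    constructor
    · intro g g' hg
      have h2 : e.hom ≫ g = e.hom ≫ g' := h.1 (by
        change (e.hom ≫ g) ≫ _ = (e.hom ≫ g') ≫ _
        rw [Category.assoc, Category.assoc]
        exact congrArg (e.hom ≫ ·) hg)
      exact (cancel_epi e.hom).mp h2
    · intro d
      obtain ⟨g, hg⟩ := h.2 (e.hom ≫ d)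
      refine ⟨e.inv ≫ g, ?_⟩
      change (e.inv ≫ g) ≫ _ = _
      rw [Category.assoc, ← cancel_epi e.hom, e.hom_inv_id_assoc]
      exact hg
  obtain ⟨s, hs⟩ := (hb _).2 (𝟙 _)
  refine ⟨s, (hb _).1 ?_, hs⟩
  change (_ ≫ s) ≫ _ = 𝟙 _ ≫ _
  rw [Category.assoc, Category.id_comp]
  exact (congrArg (hS.alpha X ≫ ·) hs).trans (Category.comp_id _)

/-- Normalization. -/
theorem RightSerreData.tr_norm (T : Triangle C) (hT : T ∈ distTriang C)
    (c : T.obj₂ ⟶ S.obj T.obj₁) (a : T.obj₃ ⟶ S.obj T.obj₂)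
    (hca : T.mor₂ ≫ a = c ≫ S.map T.mor₁) :
    hS.trSh T.obj₁ ((T.mor₁ ≫ c)⟦(1 : ℤ)⟧') = hS.tr T.obj₁ (T.mor₁ ≫ c) := by
  apply twPsi_norm
  intro s f' hf'
  obtain ⟨τ, hτ⟩ := (shiftFunctor C (1 : ℤ)).map_surjective (s • 𝟙 (T.obj₁⟦(1 : ℤ)⟧))
  have hf : f' = τ ≫ T.mor₁ ≫ c := by
    apply (shiftFunctor C (1 : ℤ)).map_injective
    rw [hf', Functor.map_comp _ τ, hτ]
    simp
  obtain ⟨c₀, h1, h2⟩ := complete_distinguished_triangle_morphism₁ T T hT hT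
    (s • 𝟙 _) (s • 𝟙 _) (by simp)
  have h3 : T.mor₃ ≫ (c₀ - τ)⟦(1 : ℤ)⟧' = 0 := by
    rw [Functor.map_sub, Preadditive.comp_sub, h2, hτ]
    simp
  obtain ⟨y', hy'⟩ : ∃ y' : T.obj₂⟦(1 : ℤ)⟧ ⟶ T.obj₁⟦(1 : ℤ)⟧,
      (c₀ - τ)⟦(1 : ℤ)⟧' = (-T.mor₁⟦(1 : ℤ)⟧') ≫ y' :=
    Triangle.yoneda_exact₃ T.rotate (rot_of_distTriang T hT) _ h3
  obtain ⟨y, rfl⟩ := (shiftFunctor C (1 : ℤ)).map_surjective y'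
  have h4 : c₀ - τ = -(T.mor₁ ≫ y) := by
    apply (shiftFunctor C (1 : ℤ)).map_injective
    rw [hy']
    simp
  have h5 : τ ≫ T.mor₁ = s • T.mor₁ + T.mor₁ ≫ y ≫ T.mor₁ := by
    have : τ = c₀ + T.mor₁ ≫ y := by rw [← sub_eq_iff_eq_add', ← neg_sub, h4, neg_neg]
    rw [this, Preadditive.add_comp, ← h1]
    simp
  have h6 : hS.tr T.obj₁ (T.mor₁ ≫ y ≫ T.mor₁ ≫ c) = 0 := by
    rw [hS.tr_comm, Category.assoc, Category.assoc, ← hca, comp_distTriang_mor_zero₁₂_assoc _ hT]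
    simp
  rw [hf, ← Category.assoc, h5, Preadditive.add_comp, Linear.smul_comp, map_add, map_smul]
  simp only [Category.assoc]
  rw [h6, add_zero, smul_eq_mul]

theorem RightSerreData.exists_d (T : Triangle C) (hT : T ∈ distTriang C) {W : C}
    (v' : S.obj T.obj₂ ⟶ W) (w' : W ⟶ (S.obj T.obj₁)⟦(1 : ℤ)⟧)
    (hT' : Triangle.mk (S.map T.mor₁) v' w' ∈ distTriang C) :
    ∃ d : W ⟶ S.obj T.obj₃, v' ≫ d = S.map T.mor₂ ∧
      d ≫ S.map T.mor₃ = w' ≫ hS.alpha T.obj₁ := by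
  obtain ⟨φ, h1, h2⟩ := exists_dual_of_consistent (k := k)
    (Linear.rightComp k T.obj₃ v') (Linear.leftComp k W T.mor₃)
    ((hS.tr T.obj₃).comp (Linear.rightComp k T.obj₃ (S.map T.mor₂)))
    ((hS.tr (T.obj₁⟦(1 : ℤ)⟧)).comp (Linear.rightComp k _ (w' ≫ hS.alpha T.obj₁))) (by
      intro a b hab
      change a ≫ v' = T.mor₃ ≫ b at hab
      change hS.tr _ (a ≫ S.map T.mor₂) = hS.tr _ (b ≫ w' ≫ hS.alpha _)
      obtain ⟨c, hc1, hc2⟩ : ∃ c : T.obj₂ ⟶ S.obj T.obj₁, T.mor₂ ≫ a = c ≫ S.map T.mor₁ ∧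
          (-T.mor₁⟦(1 : ℤ)⟧') ≫ c⟦(1 : ℤ)⟧' = b ≫ w' :=
        complete_distinguished_triangle_morphism₁ T.rotate _
          (rot_of_distTriang T hT) hT' a b hab.symm
      rw [← Category.assoc b, ← hc2, hS.tr_alpha, Preadditive.neg_comp, ← Functor.map_comp,
        map_neg, neg_neg, hS.tr_norm T hT c a hc1, ← hS.tr_comm T.mor₂ a, hc1, ← hS.tr_comm])
  obtain ⟨d, hd, -⟩ := hS.exists_unique φ
  refine ⟨d, hS.hom_ext fun a => ?_, hS.hom_ext fun b => ?_⟩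
  · rw [← Category.assoc, ← hd]
    exact h1 a
  · rw [← Category.assoc, ← hS.tr_comm, ← Category.assoc, ← hd]
    exact h2 b

end

section
variable (S : C ≌ C)

theorem equiv_exact {D D' : Type*} [Category D] [Category D'] [Preadditive D] [Preadditive D']
    (S : D ≌ D') [S.functor.Additive] {X Y Z : D} (f : X ⟶ Y) (g : Y ⟶ Z)
    (h : ∀ {V : D} (x : V ⟶ Y), x ≫ g = 0 → ∃ y : V ⟶ X, x = y ≫ f)
    {U : D'} (x : U ⟶ S.functor.obj Y) (hx : x ≫ S.functor.map g = 0) :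
    ∃ y : U ⟶ S.functor.obj X, x = y ≫ S.functor.map f := by
  let V := S.functor.objPreimage U
  let e : S.functor.obj V ≅ U := S.functor.objObjPreimageIso U
  obtain ⟨x₀, hx₀⟩ := S.functor.map_surjective (e.hom ≫ x)
  obtain ⟨y, hy⟩ := h x₀ (by
    apply S.functor.map_injective
    rw [Functor.map_comp, hx₀, Category.assoc, hx, comp_zero, Functor.map_zero])
  refine ⟨e.inv ≫ S.functor.map y, ?_⟩
  rw [Category.assoc, ← Functor.map_comp, ← hy, hx₀, e.inv_hom_id_assoc]

instance equiv_functor_additive : S.functor.Additive := by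
  have : PreservesFiniteProducts S.functor := ⟨fun n => inferInstance⟩
  have : HasFiniteProducts C := inferInstance
  have : HasFiniteBiproducts C := HasFiniteBiproducts.of_hasFiniteProducts
  exact Functor.additive_of_preserves_binary_products S.functor

theorem serre_isTriangle (hS : RightSerreData k C S.functor) : IsTriangleFunctor S.functor := by
  let α : S.functor ⋙ shiftFunctor C (1 : ℤ) ≅ shiftFunctor C (1 : ℤ) ⋙ S.functor :=
    NatIso.ofComponents (fun X => asIso (hS.alpha X)) (fun f => hS.alpha_nat f)
  obtain ⟨c, hc⟩ := exists_commShift α.symm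
  refine ⟨c, ⟨fun T hT => ?_⟩⟩
  obtain ⟨W, v', w', hT'⟩ := distinguished_cocone_triangle (S.functor.map T.mor₁)
  obtain ⟨d, hd1, hd2⟩ := hS.exists_d T hT v' w' hT'
  have hα : ∀ X, hS.alpha X ≫ (S.functor.commShiftIso (1 : ℤ)).hom.app X = 𝟙 _ := fun X => by
    rw [hc]; exact IsIso.hom_inv_id (hS.alpha X)
  have split : ∃ s, s ≫ d = 𝟙 _ := by
    have h0 : (S.functor.map T.mor₃ ≫ inv (hS.alpha T.obj₁)) ≫
        (S.functor.map T.mor₁)⟦(1 : ℤ)⟧' = 0 := by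
      rw [← cancel_mono (hS.alpha T.obj₂), Category.assoc, Category.assoc, hS.alpha_nat,
        IsIso.inv_hom_id_assoc, ← Functor.map_comp, comp_distTriang_mor_zero₃₁ _ hT]
      simp
    obtain ⟨m, hm⟩ : ∃ m : S.functor.obj T.obj₃ ⟶ W,
        S.functor.map T.mor₃ ≫ inv (hS.alpha T.obj₁) = m ≫ w' :=
      Triangle.coyoneda_exact₁ _ hT' _ h0
    obtain ⟨n, hn⟩ := equiv_exact S T.mor₂ T.mor₃ (T.coyoneda_exact₃ hT) (𝟙 _ - m ≫ d) (by
      rw [Preadditive.sub_comp, Category.assoc, hd2, ← Category.assoc m, ← hm]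
      simp)
    refine ⟨m + n ≫ v', ?_⟩
    rw [Preadditive.add_comp, Category.assoc, hd1, ← hn]
    simp
  obtain ⟨s, hs⟩ := split
  have hmono : Mono d := by
    apply Preadditive.mono_of_cancel_zero
    intro U m hm
    have h1 : m ≫ w' = 0 := by
      rw [← cancel_mono (hS.alpha T.obj₁), Category.assoc, ← hd2, ← Category.assoc, hm]
      simp
    obtain ⟨n, hn⟩ : ∃ n : U ⟶ S.functor.obj T.obj₂, m = n ≫ v' :=
      Triangle.coyoneda_exact₃ _ hT' m h1
    obtain ⟨l, hl⟩ := equiv_exact S T.mor₁ T.mor₂ (T.coyoneda_exact₂ hT) n (by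
      rw [← hd1, ← Category.assoc, ← hn, hm])
    have h0 : S.functor.map T.mor₁ ≫ v' = 0 := comp_distTriang_mor_zero₁₂ _ hT'
    rw [hn, hl, Category.assoc, h0, comp_zero]
  have : IsSplitEpi d := ⟨⟨s, hs⟩⟩
  have : IsIso d := isIso_of_mono_of_isSplitEpi d
  refine isomorphic_distinguished _ hT' _ (Triangle.isoMk _ _ (Iso.refl _) (Iso.refl _)
    (asIso d).symm ?_ ?_ ?_)
  · change S.functor.map T.mor₁ ≫ 𝟙 _ = 𝟙 _ ≫ S.functor.map T.mor₁
    simp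
  · change S.functor.map T.mor₂ ≫ inv d = 𝟙 _ ≫ v'
    rw [← hd1]; simp
  · change (S.functor.map T.mor₃ ≫ _) ≫ (𝟙 _)⟦(1 : ℤ)⟧' = inv d ≫ w'
    rw [← cancel_epi d, IsIso.hom_inv_id_assoc, ← Category.assoc, ← Category.assoc, hd2,
      Category.assoc, Category.assoc, ← Category.assoc (hS.alpha _)]
    erw [hα]
    simp

theorem equiv_inverse_isTriangle {D D' : Type*} [Category D] [Category D'] [Preadditive D]
    [Preadditive D'] [HasShift D ℤ] [HasShift D' ℤ] [HasZeroObject D] [HasZeroObject D']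
    [∀ n : ℤ, (shiftFunctor D n).Additive] [∀ n : ℤ, (shiftFunctor D' n).Additive]
    [Pretriangulated D] [Pretriangulated D'] (S : D ≌ D') (h : IsTriangleFunctor S.functor) :
    IsTriangleFunctor S.inverse := by
  obtain ⟨c, hc⟩ := h
  let _ : S.inverse.CommShift ℤ := S.toAdjunction.rightAdjointCommShift ℤ
  have : S.toAdjunction.CommShift ℤ := S.toAdjunction.commShift_of_leftAdjoint ℤ
  exact ⟨_, S.toAdjunction.isTriangulated_rightAdjoint⟩

end
end SerreTriangle

section SerreSub

set_option linter.unusedSectionVars false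

variable {k : Type*} [Field k] {A B : Type*} [Category A] [Category B] [Preadditive A]
  [Preadditive B] [CategoryTheory.Linear k A] [CategoryTheory.Linear k B]
  [∀ X Y : A, FiniteDimensional k (X ⟶ Y)] [∀ X Y : B, FiniteDimensional k (X ⟶ Y)]
  {F : A ⥤ B} [F.Full] [F.Faithful] [F.Additive] {G : B ⥤ A} (adj : F ⊣ G)
  {S : B ⥤ B} (hS : RightSerreData k B S)

theorem sub_counit_bij (Y : A) (W : B) :
    Function.Bijective (Linear.rightComp k (F.obj Y) (adj.counit.app W)) := by
  constructor
  · intro g g' h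
    obtain ⟨g, rfl⟩ := F.map_surjective g
    obtain ⟨g', rfl⟩ := F.map_surjective g'
    change F.map g ≫ _ = F.map g' ≫ _ at h
    congr 1
    apply (adj.homEquiv Y W).symm.injective
    rw [adj.homEquiv_counit, adj.homEquiv_counit, h]
  · intro d
    refine ⟨F.map (adj.homEquiv Y W d), ?_⟩
    change F.map _ ≫ _ = _
    exact (adj.homEquiv_counit _ _ _).symm.trans ((adj.homEquiv Y W).symm_apply_apply d)

/-- auxiliary functional -/
noncomputable def subPsi (X Y : A) (h : X ⟶ Y) :
    Module.Dual k (F.obj Y ⟶ F.obj ((F ⋙ S ⋙ G).obj X)) :=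
  (hS.e _ _ (F.map h)).comp (Linear.rightComp k (F.obj Y) (adj.counit.app (S.obj (F.obj X))))

theorem subPsi_apply (X Y : A) (h : X ⟶ Y) (g : F.obj Y ⟶ F.obj ((F ⋙ S ⋙ G).obj X)) :
    subPsi adj hS X Y h g = hS.tr _ (F.map h ≫ g ≫ adj.counit.app (S.obj (F.obj X))) :=
  hS.e_eq _ _

theorem subPsi_bij (X Y : A) : Function.Bijective (subPsi adj hS X Y) := by
  constructor
  · intro h h' hh
    apply F.map_injective
    apply hS.hom_ext_left
    intro d
    obtain ⟨g, rfl⟩ := (sub_counit_bij (k := k) adj Y _).2 d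
    have := LinearMap.congr_fun hh g
    rw [subPsi_apply, subPsi_apply] at this
    exact this
  · intro ψ
    let E := LinearEquiv.ofBijective _ (sub_counit_bij (k := k) adj Y (S.obj (F.obj X)))
    obtain ⟨h, hh⟩ := F.map_surjective ((hS.e (F.obj X) (F.obj Y)).symm
      (ψ.comp E.symm.toLinearMap))
    refine ⟨h, ?_⟩
    ext g
    change hS.e _ _ (F.map h) (E g) = _
    rw [hh, LinearEquiv.apply_symm_apply]
    exact congrArg ψ (E.symm_apply_apply g)

/-- auxiliary equivalence -/
noncomputable def subTw (X Y : A) : Module.Dual k (Y ⟶ (F ⋙ S ⋙ G).obj X) ≃+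
    Module.Dual k (F.obj Y ⟶ F.obj ((F ⋙ S ⋙ G).obj X)) :=
  AddEquiv.ofBijective (twPsi k F Y _) (twPsi_bijective k F Y _)

/-- auxiliary functional -/
noncomputable def subPhi (X Y : A) (h : X ⟶ Y) : Module.Dual k (Y ⟶ (F ⋙ S ⋙ G).obj X) :=
  (subTw X Y).symm (subPsi adj hS X Y h)

theorem tw_subPhi (X Y : A) (h : X ⟶ Y) :
    twPsi k F Y _ (subPhi adj hS X Y h) = subPsi adj hS X Y h :=
  (subTw X Y).apply_symm_apply _

theorem subPhi_eq (X Y : A) (h : X ⟶ Y) (φ : Module.Dual k (Y ⟶ (F ⋙ S ⋙ G).obj X))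
    (hφ : ∀ u, twPsi k F Y _ φ (F.map u) =
      hS.tr _ (F.map h ≫ F.map u ≫ adj.counit.app (S.obj (F.obj X)))) :
    subPhi adj hS X Y h = φ := by
  apply (twPsi_bijective k F Y _).1
  rw [tw_subPhi]
  ext g
  obtain ⟨u, rfl⟩ := F.map_surjective g
  rw [hφ, subPsi_apply]

theorem tw_subPhi_apply (X Y : A) (h : X ⟶ Y) (u : Y ⟶ (F ⋙ S ⋙ G).obj X) :
    twPsi k F Y _ (subPhi adj hS X Y h) (F.map u) =
      hS.tr _ (F.map h ≫ F.map u ≫ adj.counit.app (S.obj (F.obj X))) := by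
  rw [tw_subPhi, subPsi_apply]

/-- linear map -/
noncomputable def subLin (X Y : A) : (X ⟶ Y) →ₗ[k] Module.Dual k (Y ⟶ (F ⋙ S ⋙ G).obj X) where
  toFun h := subPhi adj hS X Y h
  map_add' h h' := subPhi_eq _ _ _ _ _ _ fun u => by
    rw [map_add, LinearMap.add_apply, tw_subPhi_apply, tw_subPhi_apply, F.map_add,
      Preadditive.add_comp, map_add]
  map_smul' s h := subPhi_eq _ _ _ _ _ _ fun u => by
    rw [RingHom.id_apply, twPsi_nat k F (s • 𝟙 Y) (𝟙 _) (s • subPhi adj hS X Y h) (subPhi adj hS X Y h)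
      (fun f => by simp), tw_subPhi_apply, ← F.map_comp_assoc, ← F.map_comp_assoc]
    simp

theorem subLin_bij (X Y : A) : Function.Bijective (subLin adj hS X Y) :=
  ((subTw X Y).symm.bijective).comp (subPsi_bij adj hS X Y)

/-- Serre data on the source of a fully faithful left adjoint. -/
noncomputable def subSerre : RightSerreData k A (F ⋙ S ⋙ G) where
  e X Y := LinearEquiv.ofBijective (subLin adj hS X Y) (subLin_bij adj hS X Y)
  nat_right {X Y Y'} h g u := by
    refine LinearMap.congr_fun (g := (subPhi adj hS X Y h).comp (Linear.leftComp k _ g))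
      (subPhi_eq adj hS _ _ _ _ fun u => ?_) u
    rw [twPsi_nat k F g (𝟙 _) _ (subPhi adj hS X Y h) (fun f => by
      rw [Category.comp_id]; rfl), tw_subPhi_apply]
    simp
  nat_left {X X' Y} f h u := by
    refine LinearMap.congr_fun
      (g := (subPhi adj hS X Y h).comp (Linear.rightComp k _ ((F ⋙ S ⋙ G).map f)))
      (subPhi_eq adj hS _ _ _ _ fun u => ?_) u
    rw [twPsi_nat k F (𝟙 _) ((F ⋙ S ⋙ G).map f) _ (subPhi adj hS X Y h) (fun f => by
      rw [Category.id_comp]; rfl), tw_subPhi_apply, Category.id_comp, F.map_comp, F.map_comp]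
    have h1 := hS.tr_comm (F.map f) (F.map h ≫ F.map u ≫ adj.counit.app (S.obj (F.obj X')))
    have h2 := adj.counit.naturality (S.map (F.map f))
    simp only [Category.assoc] at h1 ⊢
    refine Eq.trans ?_ h1.symm
    dsimp at h2 ⊢
    rw [h2]

end SerreSub

section KeyIsos

set_option linter.unusedSectionVars false

section
variable {A B D : Type*}
  [Category A] [Category B] [Category D]
  [HasShift A ℤ] [HasShift B ℤ] [HasShift D ℤ]
  [Preadditive A] [Preadditive B] [Preadditive D]
  [HasZeroObject A] [HasZeroObject B] [HasZeroObject D]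
  [∀ n : ℤ, (shiftFunctor A n).Additive] [∀ n : ℤ, (shiftFunctor B n).Additive]
  [∀ n : ℤ, (shiftFunctor D n).Additive]
  [Pretriangulated A] [Pretriangulated B] [Pretriangulated D]

theorem IsTriangleFunctor.comp {F : A ⥤ B} {G : B ⥤ D} (hF : IsTriangleFunctor F)
    (hG : IsTriangleFunctor G) : IsTriangleFunctor (F ⋙ G) := by
  obtain ⟨c, hc⟩ := hF
  obtain ⟨d, hd⟩ := hG
  exact ⟨inferInstance, inferInstance⟩

theorem IsTriangleFunctor.id : IsTriangleFunctor (𝟭 A) :=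
  ⟨inferInstance, inferInstance⟩

theorem IsTriangleFunctor.additive {F : A ⥤ B} (hF : IsTriangleFunctor F) : F.Additive := by
  obtain ⟨c, hc⟩ := hF
  infer_instance

theorem IsTriangleFunctor.of_iso {F G : A ⥤ B} (e : F ≅ G) (hF : IsTriangleFunctor F) :
    IsTriangleFunctor G := by
  obtain ⟨c, hc⟩ := hF
  let c' : G.CommShift ℤ := Functor.CommShift.ofIso e ℤ
  have : NatTrans.CommShift e.hom ℤ := Functor.CommShift.ofIso_compatibility e ℤ
  exact ⟨c', Functor.isTriangulated_of_iso e⟩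

theorem IsTriangleFunctor.isIso_mor₂ {F : A ⥤ B} (hF : IsTriangleFunctor F) {X Y Z : A}
    {f : X ⟶ Y} {g : Y ⟶ Z} {h : Z ⟶ X⟦(1 : ℤ)⟧} (hT : Triangle.mk f g h ∈ distTriang A)
    (hz : IsZero (F.obj X)) : IsIso (F.map g) := by
  obtain ⟨c, hc⟩ := hF
  exact (Triangle.isZero₁_iff_isIso₂ _ (F.map_distinguished _ hT)).1 hz

theorem IsTriangleFunctor.isIso_mor₁ {F : A ⥤ B} (hF : IsTriangleFunctor F) {X Y Z : A}
    {f : X ⟶ Y} {g : Y ⟶ Z} {h : Z ⟶ X⟦(1 : ℤ)⟧} (hT : Triangle.mk f g h ∈ distTriang A)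
    (hz : IsZero (F.obj Z)) : IsIso (F.map f) := by
  obtain ⟨c, hc⟩ := hF
  exact (Triangle.isZero₃_iff_isIso₁ _ (F.map_distinguished _ hT)).1 hz
end

variable {k : Type*} [Field k]
variable {C C' C'' : Type*} [Category C] [Category C'] [Category C'']
  [HasShift C ℤ] [HasShift C' ℤ] [HasShift C'' ℤ]
  [Preadditive C] [Preadditive C'] [Preadditive C'']
  [HasZeroObject C] [HasZeroObject C'] [HasZeroObject C'']
  [∀ n : ℤ, (shiftFunctor C n).Additive] [∀ n : ℤ, (shiftFunctor C' n).Additive]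
  [∀ n : ℤ, (shiftFunctor C'' n).Additive]
  [Pretriangulated C] [Pretriangulated C'] [Pretriangulated C'']
  [CategoryTheory.Linear k C]
  [∀ X Y : C, FiniteDimensional k (X ⟶ Y)] {S : C ≌ C}
  {iStar : C ⥤ C'} {iPush : C' ⥤ C} {iShriek : C ⥤ C'}
  {jShriek : C'' ⥤ C} {jStar : C ⥤ C''} {jPush : C'' ⥤ C}

theorem van_shriek (hS : RightSerreData k C S.functor)
    (adjI₂ : iPush ⊣ iShriek) (adjJ₁ : jShriek ⊣ jStar)
    (h0 : ∀ X' : C', IsZero (jStar.obj (iPush.obj X'))) (V : C'') :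
    IsZero (iShriek.obj (S.functor.obj (jShriek.obj V))) := by
  rw [IsZero.iff_id_eq_zero]
  apply (adjI₂.homEquiv _ _).symm.injective
  apply hS.hom_ext
  intro f
  have hf : ∀ f' : jShriek.obj V ⟶ iPush.obj (iShriek.obj (S.functor.obj (jShriek.obj V))),
      f' = 0 := fun f' => by
    apply (adjJ₁.homEquiv _ _).injective
    exact (h0 _).eq_of_tgt _ _
  rw [hf f, zero_comp, zero_comp]

theorem van_star (hS : RightSerreData k C S.functor)
    (adjI₁ : iStar ⊣ iPush) (adjJ₂ : jStar ⊣ jPush)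
    (h0 : ∀ X' : C', IsZero (jStar.obj (iPush.obj X'))) (V : C'') :
    IsZero (iStar.obj (S.inverse.obj (jPush.obj V))) := by
  rw [IsZero.iff_id_eq_zero]
  apply (adjI₁.homEquiv _ _).injective
  apply hS.hom_ext_left
  intro d
  have hf : ∀ (W : C') (f : iPush.obj W ⟶ jPush.obj V), f = 0 := fun W f => by
    apply (adjJ₂.homEquiv _ _).symm.injective
    exact (h0 _).eq_of_src _ _
  have hd : d = 0 := by
    rw [← cancel_mono (S.counitIso.hom.app (jPush.obj V)), zero_comp]
    exact hf _ _
  rw [hd, comp_zero, comp_zero]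

theorem key_i (hS : RightSerreData k C S.functor)
    (tS : IsTriangleFunctor S.functor) (tiShriek : IsTriangleFunctor iShriek)
    (adjI₁ : iStar ⊣ iPush) (adjI₂ : iPush ⊣ iShriek) (adjJ₁ : jShriek ⊣ jStar)
    (h0 : ∀ X' : C', IsZero (jStar.obj (iPush.obj X')))
    (hl : ∀ X : C, ∃ h : iPush.obj (iStar.obj X) ⟶ (jShriek.obj (jStar.obj X))⟦(1 : ℤ)⟧,
      Triangle.mk (adjJ₁.counit.app X) (adjI₁.unit.app X) h ∈ distTriang C) :
    Nonempty (S.functor ⋙ iShriek ≅ iStar ⋙ (iPush ⋙ S.functor ⋙ iShriek)) := by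
  let α : S.functor ⋙ iShriek ⟶ iStar ⋙ (iPush ⋙ S.functor ⋙ iShriek) :=
    Functor.whiskerRight adjI₁.unit (S.functor ⋙ iShriek)
  have : ∀ X, IsIso (α.app X) := fun X => by
    obtain ⟨h, hh⟩ := hl X
    exact (tS.comp tiShriek).isIso_mor₂ hh (van_shriek hS adjI₂ adjJ₁ h0 _)
  have := NatIso.isIso_of_isIso_app α
  exact ⟨asIso α⟩

theorem key_j (hS : RightSerreData k C S.functor)
    (tS : IsTriangleFunctor S.functor) (tiPush : IsTriangleFunctor iPush)
    (adjI₂ : iPush ⊣ iShriek) (adjJ₁ : jShriek ⊣ jStar) (adjJ₂ : jStar ⊣ jPush)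
    (h0 : ∀ X' : C', IsZero (jStar.obj (iPush.obj X')))
    (hr : ∀ X : C, ∃ h : jPush.obj (jStar.obj X) ⟶ (iPush.obj (iShriek.obj X))⟦(1 : ℤ)⟧,
      Triangle.mk (adjI₂.counit.app X) (adjJ₂.unit.app X) h ∈ distTriang C) :
    Nonempty (jShriek ⋙ S.functor ≅ (jShriek ⋙ S.functor ⋙ jStar) ⋙ jPush) := by
  let α : jShriek ⋙ S.functor ⟶ (jShriek ⋙ S.functor ⋙ jStar) ⋙ jPush :=
    Functor.whiskerLeft (jShriek ⋙ S.functor) adjJ₂.unit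
  have := tiPush.additive
  have : ∀ X, IsIso (α.app X) := fun X => by
    obtain ⟨h, hh⟩ := hr (S.functor.obj (jShriek.obj X))
    exact (IsTriangleFunctor.id (A := C)).isIso_mor₂ hh
      (iPush.map_isZero (van_shriek hS adjI₂ adjJ₁ h0 _))
  have := NatIso.isIso_of_isIso_app α
  exact ⟨asIso α⟩

/-- `i^! S i i^* S⁻¹ i ≅ 1`. -/
theorem inv_i_left (hS : RightSerreData k C S.functor)
    (tS : IsTriangleFunctor S.functor) (tiShriek : IsTriangleFunctor iShriek)
    (hfull : iPush.Full) (hfaith : iPush.Faithful)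
    (adjI₁ : iStar ⊣ iPush) (adjI₂ : iPush ⊣ iShriek) (adjJ₁ : jShriek ⊣ jStar)
    (h0 : ∀ X' : C', IsZero (jStar.obj (iPush.obj X')))
    (hl : ∀ X : C, ∃ h : iPush.obj (iStar.obj X) ⟶ (jShriek.obj (jStar.obj X))⟦(1 : ℤ)⟧,
      Triangle.mk (adjJ₁.counit.app X) (adjI₁.unit.app X) h ∈ distTriang C) :
    Nonempty ((iPush ⋙ S.inverse ⋙ iStar) ⋙ (iPush ⋙ S.functor ⋙ iShriek) ≅ 𝟭 C') := by
  obtain ⟨e⟩ := key_i hS tS tiShriek adjI₁ adjI₂ adjJ₁ h0 hl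
  have e1 : (iPush ⋙ S.inverse ⋙ iStar) ⋙ (iPush ⋙ S.functor ⋙ iShriek) ≅
    (iPush ⋙ S.inverse) ⋙ (S.functor ⋙ iShriek) := Functor.isoWhiskerLeft (iPush ⋙ S.inverse) e.symm
  have e2 : (iPush ⋙ S.inverse) ⋙ (S.functor ⋙ iShriek) ≅ iPush ⋙ iShriek :=
    Functor.isoWhiskerLeft iPush (Functor.isoWhiskerRight S.counitIso iShriek)
  exact ⟨e1 ≪≫ e2 ≪≫ (asIso adjI₂.unit).symm⟩

theorem inv_i_right (hS : RightSerreData k C S.functor)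
    (tSi : IsTriangleFunctor S.inverse) (tiStar : IsTriangleFunctor iStar)
    (hfull : iPush.Full) (hfaith : iPush.Faithful)
    (adjI₁ : iStar ⊣ iPush) (adjI₂ : iPush ⊣ iShriek) (adjJ₂ : jStar ⊣ jPush)
    (h0 : ∀ X' : C', IsZero (jStar.obj (iPush.obj X')))
    (hr : ∀ X : C, ∃ h : jPush.obj (jStar.obj X) ⟶ (iPush.obj (iShriek.obj X))⟦(1 : ℤ)⟧,
      Triangle.mk (adjI₂.counit.app X) (adjJ₂.unit.app X) h ∈ distTriang C) :
    Nonempty ((iPush ⋙ S.functor ⋙ iShriek) ⋙ (iPush ⋙ S.inverse ⋙ iStar) ≅ 𝟭 C') := by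
  let α : (iShriek ⋙ iPush) ⋙ (S.inverse ⋙ iStar) ⟶ 𝟭 C ⋙ (S.inverse ⋙ iStar) :=
    Functor.whiskerRight adjI₂.counit (S.inverse ⋙ iStar)
  have : ∀ X, IsIso (α.app X) := fun X => by
    obtain ⟨h, hh⟩ := hr X
    exact (tSi.comp tiStar).isIso_mor₁ hh (van_star hS adjI₁ adjJ₂ h0 _)
  have := NatIso.isIso_of_isIso_app α
  have e1 : (iPush ⋙ S.functor ⋙ iShriek) ⋙ (iPush ⋙ S.inverse ⋙ iStar) ≅
    (iPush ⋙ S.functor) ⋙ 𝟭 C ⋙ (S.inverse ⋙ iStar) :=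
    Functor.isoWhiskerLeft (iPush ⋙ S.functor) (asIso α)
  have e2 : (iPush ⋙ S.functor) ⋙ 𝟭 C ⋙ (S.inverse ⋙ iStar) ≅ iPush ⋙ iStar :=
    Functor.isoWhiskerLeft iPush (Functor.isoWhiskerRight S.unitIso.symm iStar)
  exact ⟨e1 ≪≫ e2 ≪≫ asIso adjI₁.counit⟩

theorem inv_j_left (hS : RightSerreData k C S.functor)
    (tjShriek : IsTriangleFunctor iPush)
    (hfull : jPush.Full) (hfaith : jPush.Faithful)
    (adjI₁ : iStar ⊣ iPush) (adjJ₁ : jShriek ⊣ jStar) (adjJ₂ : jStar ⊣ jPush)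
    (h0 : ∀ X' : C', IsZero (jStar.obj (iPush.obj X')))
    (hl : ∀ X : C, ∃ h : iPush.obj (iStar.obj X) ⟶ (jShriek.obj (jStar.obj X))⟦(1 : ℤ)⟧,
      Triangle.mk (adjJ₁.counit.app X) (adjI₁.unit.app X) h ∈ distTriang C) :
    Nonempty ((jPush ⋙ S.inverse ⋙ jStar) ⋙ (jShriek ⋙ S.functor ⋙ jStar) ≅ 𝟭 C'') := by
  let α : (jPush ⋙ S.inverse ⋙ jStar) ⋙ jShriek ⟶ (jPush ⋙ S.inverse) :=
    Functor.whiskerLeft (jPush ⋙ S.inverse) adjJ₁.counit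
  have := tjShriek.additive
  have : ∀ X, IsIso (α.app X) := fun X => by
    obtain ⟨h, hh⟩ := hl (S.inverse.obj (jPush.obj X))
    exact (IsTriangleFunctor.id (A := C)).isIso_mor₁ hh
      (iPush.map_isZero (van_star hS adjI₁ adjJ₂ h0 _))
  have := NatIso.isIso_of_isIso_app α
  have e1 : (jPush ⋙ S.inverse ⋙ jStar) ⋙ (jShriek ⋙ S.functor ⋙ jStar) ≅
    (jPush ⋙ S.inverse) ⋙ S.functor ⋙ jStar :=
    Functor.isoWhiskerRight (asIso α) (S.functor ⋙ jStar)
  have e2 : (jPush ⋙ S.inverse) ⋙ S.functor ⋙ jStar ≅ jPush ⋙ jStar :=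
    Functor.isoWhiskerLeft jPush (Functor.isoWhiskerRight S.counitIso jStar)
  exact ⟨e1 ≪≫ e2 ≪≫ asIso adjJ₂.counit⟩

theorem inv_j_right (hS : RightSerreData k C S.functor)
    (tS : IsTriangleFunctor S.functor) (tiPush : IsTriangleFunctor iPush)
    (hfull : jShriek.Full) (hfaith : jShriek.Faithful)
    (adjI₂ : iPush ⊣ iShriek) (adjJ₁ : jShriek ⊣ jStar) (adjJ₂ : jStar ⊣ jPush)
    (h0 : ∀ X' : C', IsZero (jStar.obj (iPush.obj X')))
    (hr : ∀ X : C, ∃ h : jPush.obj (jStar.obj X) ⟶ (iPush.obj (iShriek.obj X))⟦(1 : ℤ)⟧,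
      Triangle.mk (adjI₂.counit.app X) (adjJ₂.unit.app X) h ∈ distTriang C) :
    Nonempty ((jShriek ⋙ S.functor ⋙ jStar) ⋙ (jPush ⋙ S.inverse ⋙ jStar) ≅ 𝟭 C'') := by
  obtain ⟨e⟩ := key_j hS tS tiPush adjI₂ adjJ₁ adjJ₂ h0 hr
  have e1 : (jShriek ⋙ S.functor ⋙ jStar) ⋙ (jPush ⋙ S.inverse ⋙ jStar) ≅
    (jShriek ⋙ S.functor) ⋙ (S.inverse ⋙ jStar) :=
    Functor.isoWhiskerRight e.symm (S.inverse ⋙ jStar)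
  have e2 : (jShriek ⋙ S.functor) ⋙ (S.inverse ⋙ jStar) ≅ jShriek ⋙ jStar :=
    Functor.isoWhiskerLeft jShriek (Functor.isoWhiskerRight S.unitIso.symm jStar)
  exact ⟨e1 ≪≫ e2 ≪≫ (asIso adjJ₁.unit).symm⟩

end KeyIsos

section LadderPow

/-- natural powers of an autoequivalence -/
def pwNat {A : Type*} [Category A] (e : A ≌ A) : ℕ → (A ≌ A)
  | 0 => CategoryTheory.Equivalence.refl
  | n + 1 => e.trans (pwNat e n)

/-- integer powers of an autoequivalence -/
def pw {A : Type*} [Category A] (e : A ≌ A) : ℤ → (A ≌ A)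
  | Int.ofNat n => pwNat e n
  | Int.negSucc n => pwNat e.symm (n + 1)

theorem pw_succ {A : Type*} [Category A] (e : A ≌ A) (n : ℤ) :
    Nonempty ((pw e (n + 1)).functor ≅ e.functor ⋙ (pw e n).functor) := by
  rcases n with n | n
  · exact ⟨Iso.refl _⟩
  · rcases n with - | n
    · exact ⟨e.unitIso⟩
    · exact ⟨Functor.isoWhiskerRight e.unitIso (pwNat e.symm (n + 1)).functor⟩

theorem pw_succ_inv {A : Type*} [Category A] (e : A ≌ A) (n : ℤ) :
    Nonempty ((pw e (n + 1)).inverse ≅ (pw e n).inverse ⋙ e.inverse) := by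
  obtain ⟨i⟩ := pw_succ e n
  exact ⟨Iso.isoInverseOfIsoFunctor (G := pw e (n + 1)) (G' := e.trans (pw e n)) i⟩

/-- conjugated functor -/
def cj {A B : Type*} [Category A] [Category B] (eA : A ≌ A) (eB : B ≌ B) (n : ℤ) (F : A ⥤ B) :
    A ⥤ B := (pw eA n).inverse ⋙ F ⋙ (pw eB n).functor

theorem cj_succ {A B : Type*} [Category A] [Category B] (eA : A ≌ A) (eB : B ≌ B) (n : ℤ)
    {F G : A ⥤ B} (i : F ⋙ eB.functor ≅ eA.functor ⋙ G) :
    Nonempty (cj eA eB (n + 1) F ≅ cj eA eB n G) := by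
  obtain ⟨i₁⟩ := pw_succ_inv eA n
  obtain ⟨i₂⟩ := pw_succ eB n
  have h₁ : cj eA eB (n + 1) F ≅ ((pw eA n).inverse ⋙ eA.inverse) ⋙ F ⋙ (pw eB (n + 1)).functor :=
    Functor.isoWhiskerRight i₁ (F ⋙ (pw eB (n + 1)).functor)
  have h₂ : ((pw eA n).inverse ⋙ eA.inverse) ⋙ F ⋙ (pw eB (n + 1)).functor ≅
      ((pw eA n).inverse ⋙ eA.inverse) ⋙ F ⋙ eB.functor ⋙ (pw eB n).functor :=
    Functor.isoWhiskerLeft (((pw eA n).inverse ⋙ eA.inverse) ⋙ F) i₂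
  have h₃ : ((pw eA n).inverse ⋙ eA.inverse) ⋙ F ⋙ eB.functor ⋙ (pw eB n).functor ≅
      ((pw eA n).inverse ⋙ eA.inverse) ⋙ eA.functor ⋙ G ⋙ (pw eB n).functor :=
    Functor.isoWhiskerLeft ((pw eA n).inverse ⋙ eA.inverse)
      (Functor.isoWhiskerRight i (pw eB n).functor)
  have h₄ : ((pw eA n).inverse ⋙ eA.inverse) ⋙ eA.functor ⋙ G ⋙ (pw eB n).functor ≅
      (pw eA n).inverse ⋙ 𝟭 A ⋙ G ⋙ (pw eB n).functor :=
    Functor.isoWhiskerLeft (pw eA n).inverse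
      (Functor.isoWhiskerRight eA.counitIso (G ⋙ (pw eB n).functor))
  exact ⟨h₁ ≪≫ h₂ ≪≫ h₃ ≪≫ h₄⟩

theorem cj_swap {A B : Type*} [Category A] [Category B] (eA : A ≌ A) (eB : B ≌ B)
    {F G : A ⥤ B} (i : F ⋙ eB.functor ≅ eA.functor ⋙ G) :
    Nonempty (G ⋙ eB.inverse ≅ eA.inverse ⋙ F) := by
  have h₁ : G ⋙ eB.inverse ≅ (eA.inverse ⋙ eA.functor) ⋙ G ⋙ eB.inverse :=
    Functor.isoWhiskerRight eA.counitIso.symm (G ⋙ eB.inverse)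
  have h₂ : (eA.inverse ⋙ eA.functor) ⋙ G ⋙ eB.inverse ≅
    eA.inverse ⋙ (F ⋙ eB.functor) ⋙ eB.inverse :=
    Functor.isoWhiskerLeft eA.inverse (Functor.isoWhiskerRight i.symm eB.inverse)
  have h₃ : eA.inverse ⋙ (F ⋙ eB.functor) ⋙ eB.inverse ≅ (eA.inverse ⋙ F) ⋙ 𝟭 B :=
    Functor.isoWhiskerLeft (eA.inverse ⋙ F) eB.unitIso.symm
  exact ⟨h₁ ≪≫ h₂ ≪≫ h₃⟩

theorem cj_one {A B : Type*} [Category A] [Category B] (eA : A ≌ A) (eB : B ≌ B)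
    (F : A ⥤ B) : Nonempty (F ⋙ eB.functor ≅ eA.functor ⋙ cj eA eB 1 F) :=
  ⟨Functor.isoWhiskerRight eA.unitIso (F ⋙ eB.functor)⟩

end LadderPow

section LadderTri

variable {C C' C'' : Type*} [Category C] [Category C'] [Category C'']
  [HasShift C ℤ] [HasShift C' ℤ] [HasShift C'' ℤ]
  [Preadditive C] [Preadditive C'] [Preadditive C'']
  [HasZeroObject C] [HasZeroObject C'] [HasZeroObject C'']
  [∀ n : ℤ, (shiftFunctor C n).Additive] [∀ n : ℤ, (shiftFunctor C' n).Additive]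
  [∀ n : ℤ, (shiftFunctor C'' n).Additive]
  [Pretriangulated C] [Pretriangulated C'] [Pretriangulated C'']

theorem pwNat_tri (e : C ≌ C) (h : IsTriangleFunctor e.functor)
    (h' : IsTriangleFunctor e.inverse) (n : ℕ) :
    IsTriangleFunctor (pwNat e n).functor ∧ IsTriangleFunctor (pwNat e n).inverse := by
  induction n with
  | zero => exact ⟨IsTriangleFunctor.id, IsTriangleFunctor.id⟩
  | succ n ih => exact ⟨h.comp ih.1, ih.2.comp h'⟩

theorem pw_tri (e : C ≌ C) (h : IsTriangleFunctor e.functor)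
    (h' : IsTriangleFunctor e.inverse) (n : ℤ) :
    IsTriangleFunctor (pw e n).functor ∧ IsTriangleFunctor (pw e n).inverse := by
  rcases n with n | n
  · exact pwNat_tri e h h' n
  · exact pwNat_tri e.symm h' h (n + 1)

theorem cj_tri (e : C ≌ C) (h : IsTriangleFunctor e.functor)
    (h' : IsTriangleFunctor e.inverse) (f : C' ≌ C') (hf : IsTriangleFunctor f.functor)
    (hf' : IsTriangleFunctor f.inverse) {F : C ⥤ C'} (hF : IsTriangleFunctor F) (n : ℤ) :
    IsTriangleFunctor (cj e f n F) :=
  (pw_tri e h h' n).2.comp (hF.comp (pw_tri f hf hf' n).1)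

theorem unit_triangle {p : C ⥤ C'} {a : C' ⥤ C} {b : C'' ⥤ C} {q : C ⥤ C''}
    (tp : IsTriangleFunctor p) (tq : IsTriangleFunctor q)
    (adjI : p ⊣ a) (adjJ : b ⊣ q) [a.Full] [a.Faithful] [b.Full] [b.Faithful]
    (h0 : ∀ X' : C', IsZero (q.obj (a.obj X')))
    {X : C} {V : C''} {W : C'} (f : b.obj V ⟶ X) (g : X ⟶ a.obj W)
    (h : a.obj W ⟶ (b.obj V)⟦(1 : ℤ)⟧) (hT : Triangle.mk f g h ∈ distTriang C) :
    ∃ h : a.obj (p.obj X) ⟶ (b.obj (q.obj X))⟦(1 : ℤ)⟧,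
      Triangle.mk (adjJ.counit.app X) (adjI.unit.app X) h ∈ distTriang C := by
  have hp : IsZero (p.obj (b.obj V)) := by
    rw [IsZero.iff_id_eq_zero]
    apply (adjI.homEquiv _ _).injective
    apply (adjJ.homEquiv _ _).injective
    exact (h0 _).eq_of_tgt _ _
  have hg : IsIso (p.map g) := tp.isIso_mor₂ hT hp
  have hf : IsIso (q.map f) := tq.isIso_mor₁ hT (h0 W)
  have hf2 : IsIso (adjJ.homEquiv _ _ f) := by
    rw [adjJ.homEquiv_unit]
    infer_instance
  have hg2 : IsIso ((adjI.homEquiv _ _).symm g) := by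
    rw [adjI.homEquiv_counit]
    infer_instance
  obtain ⟨eb, heb⟩ : ∃ eb : b.obj V ≅ b.obj (q.obj X), eb.hom ≫ adjJ.counit.app X = f :=
    ⟨b.mapIso (@asIso _ _ _ _ _ hf2), (adjJ.homEquiv_counit _ _ _).symm.trans
      ((adjJ.homEquiv V X).symm_apply_apply f)⟩
  obtain ⟨ea, hea⟩ : ∃ ea : a.obj (p.obj X) ≅ a.obj W, adjI.unit.app X ≫ ea.hom = g :=
    ⟨a.mapIso (@asIso _ _ _ _ _ hg2), (adjI.homEquiv_unit _ _ _).symm.trans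
      ((adjI.homEquiv X W).apply_symm_apply g)⟩
  refine ⟨ea.hom ≫ h ≫ eb.hom⟦(1 : ℤ)⟧', isomorphic_distinguished _ hT _ ?_⟩
  refine Triangle.isoMk _ _ eb.symm (Iso.refl X) ea ?_ ?_ ?_
  · change adjJ.counit.app X ≫ 𝟙 X = eb.inv ≫ f
    exact (Category.comp_id _).trans (by rw [← heb, Iso.inv_hom_id_assoc])
  · change adjI.unit.app X ≫ ea.hom = 𝟙 X ≫ g
    rw [Category.id_comp, hea]
  · change (ea.hom ≫ h ≫ eb.hom⟦(1 : ℤ)⟧') ≫ eb.inv⟦(1 : ℤ)⟧' = ea.hom ≫ h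
    rw [Category.assoc, Category.assoc, ← Functor.map_comp, Iso.hom_inv_id, CategoryTheory.Functor.map_id,
      Category.comp_id]

theorem tri_iso {X Y Z X' Y' Z' : C} {f : X ⟶ Y} {g : Y ⟶ Z} {h : Z ⟶ X⟦(1 : ℤ)⟧}
    (hT : Triangle.mk f g h ∈ distTriang C) (eX : X' ≅ X) (eY : Y' ≅ Y) (eZ : Z' ≅ Z) :
    Triangle.mk (eX.hom ≫ f ≫ eY.inv) (eY.hom ≫ g ≫ eZ.inv)
      (eZ.hom ≫ h ≫ eX.inv⟦(1 : ℤ)⟧') ∈ distTriang C := by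
  refine isomorphic_distinguished _ hT _ (Triangle.isoMk _ _ eX eY eZ ?_ ?_ ?_)
  · change (eX.hom ≫ f ≫ eY.inv) ≫ eY.hom = eX.hom ≫ f
    simp
  · change (eY.hom ≫ g ≫ eZ.inv) ≫ eZ.hom = eY.hom ≫ g
    simp
  · change (eZ.hom ≫ h ≫ eX.inv⟦(1 : ℤ)⟧') ≫ eX.hom⟦(1 : ℤ)⟧' = eZ.hom ≫ h
    rw [Category.assoc, Category.assoc, ← Functor.map_comp, Iso.inv_hom_id,
      CategoryTheory.Functor.map_id, Category.comp_id]

theorem transfer {p p₂ : C ⥤ C'} {a a₂ : C' ⥤ C} {b b₂ : C'' ⥤ C} {q q₂ : C ⥤ C''}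
    (E : C ≌ C) (E' : C' ≌ C') (E'' : C'' ≌ C'') (tE : IsTriangleFunctor E.functor)
    (tp₂ : IsTriangleFunctor p₂) (tq₂ : IsTriangleFunctor q₂)
    (hrec : IsLeftRecollement p a b q)
    (ip : p₂ ≅ E.inverse ⋙ p ⋙ E'.functor) (ia : a₂ ≅ E'.inverse ⋙ a ⋙ E.functor)
    (ib : b₂ ≅ E''.inverse ⋙ b ⋙ E.functor) (iq : q₂ ≅ E.inverse ⋙ q ⋙ E''.functor) :
    IsLeftRecollement p₂ a₂ b₂ q₂ := by
  obtain ⟨adjI, adjJ, ha, ha', hb, hb', h0, ht⟩ := hrec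
  have fa : a₂.Full := Functor.Full.of_iso ia.symm
  have fa' : a₂.Faithful := Functor.Faithful.of_iso ia.symm
  have fb : b₂.Full := Functor.Full.of_iso ib.symm
  have fb' : b₂.Faithful := Functor.Faithful.of_iso ib.symm
  have adj1 : E.inverse ⋙ p ⋙ E'.functor ⊣ E'.inverse ⋙ a ⋙ E.functor :=
    E.symm.toAdjunction.comp (adjI.comp E'.toAdjunction)
  have adj2 : E''.inverse ⋙ b ⋙ E.functor ⊣ E.inverse ⋙ q ⋙ E''.functor :=
    E''.symm.toAdjunction.comp (adjJ.comp E.toAdjunction)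
  have adjI₂ : p₂ ⊣ a₂ := (adj1.ofNatIsoLeft ip.symm).ofNatIsoRight ia.symm
  have adjJ₂ : b₂ ⊣ q₂ := (adj2.ofNatIsoLeft ib.symm).ofNatIsoRight iq.symm
  have hqa : ∀ X' : C', Nonempty (q₂.obj (a₂.obj X') ≅
      E''.functor.obj (q.obj (a.obj (E'.inverse.obj X')))) := fun X' =>
    ⟨q₂.mapIso (ia.app X') ≪≫ iq.app _ ≪≫
      E''.functor.mapIso (q.mapIso (E.unitIso.symm.app _))⟩
  have h0₂ : ∀ X' : C', IsZero (q₂.obj (a₂.obj X')) := fun X' => by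
    obtain ⟨i⟩ := hqa X'
    exact (E''.functor.map_isZero (h0 _)).of_iso i
  refine ⟨adjI₂, adjJ₂, fa, fa', fb, fb', h0₂, fun X => ?_⟩
  obtain ⟨h, hT⟩ := ht (E.inverse.obj X)
  obtain ⟨c, hc⟩ := tE
  have hT' := E.functor.map_distinguished _ hT
  let eX : X ≅ E.functor.obj (E.inverse.obj X) := E.counitIso.symm.app X
  obtain ⟨V, ⟨eV⟩⟩ : ∃ V, Nonempty (b₂.obj V ≅ E.functor.obj (b.obj (q.obj (E.inverse.obj X)))) :=
    ⟨_, ⟨ib.app (E''.functor.obj (q.obj (E.inverse.obj X))) ≪≫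
      E.functor.mapIso (b.mapIso (E''.unitIso.symm.app _))⟩⟩
  obtain ⟨W, ⟨eW⟩⟩ : ∃ W, Nonempty (a₂.obj W ≅ E.functor.obj (a.obj (p.obj (E.inverse.obj X)))) :=
    ⟨_, ⟨ia.app (E'.functor.obj (p.obj (E.inverse.obj X))) ≪≫
      E.functor.mapIso (a.mapIso (E'.unitIso.symm.app _))⟩⟩
  obtain ⟨f, g, h', hT''⟩ : ∃ (f : E.functor.obj (b.obj (q.obj (E.inverse.obj X))) ⟶
      E.functor.obj (E.inverse.obj X)) (g : E.functor.obj (E.inverse.obj X) ⟶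
      E.functor.obj (a.obj (p.obj (E.inverse.obj X))))
      (h : E.functor.obj (a.obj (p.obj (E.inverse.obj X))) ⟶
      (E.functor.obj (b.obj (q.obj (E.inverse.obj X))))⟦(1 : ℤ)⟧),
      Triangle.mk f g h ∈ distTriang C := ⟨_, _, _, hT'⟩
  exact unit_triangle tp₂ tq₂ adjI₂ adjJ₂ h0₂ _ _ _ (tri_iso hT'' eV eX eW)

end LadderTri

section Statement

universe w v v' v'' u u' u''

variable (k : Type w) [Field k]
variable {C : Type u} {C' : Type u'} {C'' : Type u''}
  [Category.{v} C] [Category.{v'} C'] [Category.{v''} C'']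
  [HasShift C ℤ] [HasShift C' ℤ] [HasShift C'' ℤ]
  [Preadditive C] [Preadditive C'] [Preadditive C'']
  [HasZeroObject C] [HasZeroObject C'] [HasZeroObject C'']
  [∀ n : ℤ, (shiftFunctor C n).Additive] [∀ n : ℤ, (shiftFunctor C' n).Additive]
  [∀ n : ℤ, (shiftFunctor C'' n).Additive]
  [Pretriangulated C] [Pretriangulated C'] [Pretriangulated C'']
  [CategoryTheory.Linear k C] [CategoryTheory.Linear k C'] [CategoryTheory.Linear k C'']
  [∀ X Y : C, FiniteDimensional k (X ⟶ Y)]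
  [∀ X Y : C', FiniteDimensional k (X ⟶ Y)]
  [∀ X Y : C'', FiniteDimensional k (X ⟶ Y)]

/-- **Proposition 3.1 (2).** Any recollement of a Hom-finite `k`-linear triangulated
category `𝒞` with a Serre functor `S` sits in an unbounded ladder of period `1`; moreover
`𝒞'` has a right Serre functor `i^! S i_*` with inverse `i^* S^{-1} i_*`, and `𝒞''` has a
right Serre functor `j^* S j_!` with inverse `j^* S^{-1} j_*`. -/
theorem recollement_sits_in_ladder_of_period_one_of_serre_on_middle
    (S : C ≌ C) (hS : RightSerreData k C S.functor)
    (iStar : C ⥤ C') (iPush : C' ⥤ C) (iShriek : C ⥤ C')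
    (jShriek : C'' ⥤ C) (jStar : C ⥤ C'') (jPush : C'' ⥤ C)
    (tiStar : IsTriangleFunctor iStar) (tiPush : IsTriangleFunctor iPush)
    (tiShriek : IsTriangleFunctor iShriek) (tjShriek : IsTriangleFunctor jShriek)
    (tjStar : IsTriangleFunctor jStar) (tjPush : IsTriangleFunctor jPush)
    (hrec : IsRecollement iStar iPush iShriek jShriek jStar jPush) :
    SitsInUnboundedLadderOfPeriod iStar iPush iShriek jShriek jStar jPush 1 ∧
    (Nonempty (RightSerreData k C' (iPush ⋙ S.functor ⋙ iShriek)) ∧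
      Nonempty ((iPush ⋙ S.inverse ⋙ iStar) ⋙ (iPush ⋙ S.functor ⋙ iShriek) ≅ 𝟭 C') ∧
      Nonempty ((iPush ⋙ S.functor ⋙ iShriek) ⋙ (iPush ⋙ S.inverse ⋙ iStar) ≅ 𝟭 C')) ∧
    (Nonempty (RightSerreData k C'' (jShriek ⋙ S.functor ⋙ jStar)) ∧
      Nonempty ((jPush ⋙ S.inverse ⋙ jStar) ⋙ (jShriek ⋙ S.functor ⋙ jStar) ≅ 𝟭 C'') ∧
      Nonempty ((jShriek ⋙ S.functor ⋙ jStar) ⋙ (jPush ⋙ S.inverse ⋙ jStar) ≅ 𝟭 C'')) := by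
  obtain ⟨adjI₁, adjI₂, adjJ₁, adjJ₂, hi, hi', hj, hj', hk, hk', h0, hl, hr⟩ := hrec
  have tS := serre_isTriangle S hS
  have tSi := equiv_inverse_isTriangle S tS
  have addi := tiPush.additive
  have addj := tjShriek.additive
  obtain ⟨il⟩ := inv_i_left hS tS tiShriek hi hi' adjI₁ adjI₂ adjJ₁ h0 hl
  obtain ⟨ir⟩ := inv_i_right hS tSi tiStar hi hi' adjI₁ adjI₂ adjJ₂ h0 hr
  obtain ⟨jl⟩ := inv_j_left hS tiPush hk hk' adjI₁ adjJ₁ adjJ₂ h0 hl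
  obtain ⟨jr⟩ := inv_j_right hS tS tiPush hj hj' adjI₂ adjJ₁ adjJ₂ h0 hr
  refine ⟨?_, ⟨⟨subSerre adjI₂ hS⟩, ⟨il⟩, ⟨ir⟩⟩, ⟨subSerre adjJ₁ hS⟩, ⟨jl⟩, ⟨jr⟩⟩
  obtain ⟨ki⟩ := key_i hS tS tiShriek adjI₁ adjI₂ adjJ₁ h0 hl
  obtain ⟨kj⟩ := key_j hS tS tiPush adjI₂ adjJ₁ adjJ₂ h0 hr
  obtain ⟨S', hS'f, hS'i⟩ : ∃ S' : C' ≌ C', S'.functor = iPush ⋙ S.functor ⋙ iShriek ∧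
      S'.inverse = iPush ⋙ S.inverse ⋙ iStar :=
    ⟨CategoryTheory.Equivalence.mk _ _ ir.symm il, rfl, rfl⟩
  obtain ⟨S'', hS''f, hS''i⟩ : ∃ S'' : C'' ≌ C'', S''.functor = jShriek ⋙ S.functor ⋙ jStar ∧
      S''.inverse = jPush ⋙ S.inverse ⋙ jStar :=
    ⟨CategoryTheory.Equivalence.mk _ _ jr.symm jl, rfl, rfl⟩
  have tS' : IsTriangleFunctor S'.functor := hS'f ▸ tiPush.comp (tS.comp tiShriek)
  have tSi' : IsTriangleFunctor S'.inverse := hS'i ▸ tiPush.comp (tSi.comp tiStar)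
  have tS'' : IsTriangleFunctor S''.functor := hS''f ▸ tjShriek.comp (tS.comp tjStar)
  have tSi'' : IsTriangleFunctor S''.inverse := hS''i ▸ tjPush.comp (tSi.comp tjStar)
  rw [← hS'f] at ki
  rw [← hS''f] at kj
  have recL : IsLeftRecollement iStar iPush jShriek jStar :=
    ⟨adjI₁, adjJ₁, hi, hi', hj, hj', h0, hl⟩
  have hvan : ∀ V : C'', IsZero (iShriek.obj (jPush.obj V)) := fun V => by
    rw [IsZero.iff_id_eq_zero]
    apply (adjI₂.homEquiv _ _).symm.injective
    apply (adjJ₂.homEquiv _ _).symm.injective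
    exact (h0 _).eq_of_src _ _
  have recR : IsLeftRecollement jStar jPush iPush iShriek :=
    ⟨adjJ₂, adjI₂, hk, hk', hi, hi', hvan, hr⟩
  obtain ⟨p, hp0, hp1, hp⟩ : ∃ p : ℤ → C ⥤ C', p 0 = iStar ∧ p 1 = iShriek ∧
      ∀ n, Nonempty (p n ≅ cj S S' n iStar) := by
    refine ⟨fun n => if n = 0 then iStar else if n = 1 then iShriek else cj S S' n iStar,
      by simp, by simp, fun n => ?_⟩
    by_cases h : n = 0
    · subst h
      exact ⟨Iso.refl _⟩
    · by_cases h' : n = 1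
      · subst h'
        obtain ⟨x⟩ := cj_succ S S' 0 ki.symm
        exact ⟨x.symm⟩
      · simp only [h, h', if_false]
        exact ⟨Iso.refl _⟩
  obtain ⟨b, hb0, hb1, hb⟩ : ∃ b : ℤ → C'' ⥤ C, b 0 = jShriek ∧ b 1 = jPush ∧
      ∀ n, Nonempty (b n ≅ cj S'' S n jShriek) := by
    refine ⟨fun n => if n = 0 then jShriek else if n = 1 then jPush else cj S'' S n jShriek,
      by simp, by simp, fun n => ?_⟩
    by_cases h : n = 0
    · subst h
      exact ⟨Iso.refl _⟩
    · by_cases h' : n = 1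
      · subst h'
        obtain ⟨x⟩ := cj_succ S'' S 0 kj
        exact ⟨x.symm⟩
      · simp only [h, h', if_false]
        exact ⟨Iso.refl _⟩
  have tp : ∀ n, IsTriangleFunctor (p n) := fun n => by
    obtain ⟨x⟩ := hp n
    exact (cj_tri S tS tSi S' tS' tSi' tiStar n).of_iso x.symm
  have tb : ∀ n, IsTriangleFunctor (b n) := fun n => by
    obtain ⟨x⟩ := hb n
    exact (cj_tri S'' tS'' tSi'' S tS tSi tjShriek n).of_iso x.symm
  have ta : ∀ n, IsTriangleFunctor (cj S' S n iPush) := cj_tri S' tS' tSi' S tS tSi tiPush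
  have tq : ∀ n, IsTriangleFunctor (cj S S'' n jStar) := cj_tri S tS tSi S'' tS'' tSi'' tjStar
  refine ⟨fun n => cj S' S n iPush, b, p, fun n => cj S S'' n jStar, ⟨ta, tb, tp, tq, ?_, ?_⟩,
    hp0, rfl, hp1, hb0, rfl, hb1, zero_lt_one, ?_, fun s h1 h2 => by omega⟩
  · intro n
    obtain ⟨x⟩ := hp n
    obtain ⟨y⟩ := hb n
    exact transfer (pw S n) (pw S' n) (pw S'' n) (pw_tri S tS tSi n).1 (tp n) (tq n) recL
      x (Iso.refl _) y (Iso.refl _)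
  · intro n
    obtain ⟨x⟩ := hp (n + 1)
    obtain ⟨y⟩ := hb (n + 1)
    obtain ⟨x'⟩ := cj_succ S S' n ki.symm
    obtain ⟨y'⟩ := cj_succ S'' S n kj
    exact transfer (pw S n) (pw S'' n) (pw S' n) (pw_tri S tS tSi n).1 (tq n) (tp (n + 1)) recR
      (Iso.refl _) (y ≪≫ y') (Iso.refl _) (x ≪≫ x')
  · refine ⟨S'.inverse, S.inverse, S''.inverse, inferInstance, inferInstance, inferInstance,
      tSi', tSi, tSi'', ?_, ?_, ?_, ?_⟩
    · rw [hp0, hp1]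
      exact cj_swap S S' ki.symm
    · obtain ⟨x⟩ := cj_one S' S iPush
      exact cj_swap S' S x
    · rw [hb0, hb1]
      exact cj_swap S'' S kj
    · obtain ⟨x⟩ := cj_one S S'' jStar
      exact cj_swap S S'' x

end Statement
end

section
/- Let 𝒞 and 𝒟 be Hom-finite k-linear categories over a field k, each having a Serre functor (right Serre functors S_𝒞 and S_𝒟 which are equivalences), and let F: 𝒞 → 𝒟 be an additive functor with a right adjoint G. Then F admits a left adjoint, namely S_𝒞^{-1} G S_𝒟, and G admits a right adjoint, namely S_𝒟 F S_𝒞^{-1}. -/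
/-!
STATEMENT 8: Let 𝒞 and 𝒟 be Hom-finite k-linear categories over a field k, each having a
Serre functor (right Serre functors S_𝒞 and S_𝒟 which are equivalences), and let F: 𝒞 → 𝒟
be an additive functor with a right adjoint G. Then F admits a left adjoint, namely
S_𝒞^{-1} G S_𝒟, and G admits a right adjoint, namely S_𝒟 F S_𝒞^{-1}.
-/

open CategoryTheory CategoryTheory.Limits
namespace SerreAux
universe u1 u2 u3

/-- `K`-linear functionals on `R`, viewed as an `R`-module. -/
def DualR (K : Type u1) (R : Type u2) [Field K] [CommRing R] [Algebra K R] : Type (max u1 u2) :=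
  R →ₗ[K] K

section
variable (K : Type u1) (L : Type u3) (R : Type u2) [Field K] [Field L] [CommRing R]
  [Algebra K R] [Algebra L R]

noncomputable instance : AddCommGroup (DualR K R) := inferInstanceAs (AddCommGroup (R →ₗ[K] K))

instance : FunLike (DualR K R) R K := inferInstanceAs (FunLike (R →ₗ[K] K) R K)

instance : LinearMapClass (DualR K R) K R K :=
  inferInstanceAs (LinearMapClass (R →ₗ[K] K) K R K)

variable {K R}

@[ext] lemma DualR.ext {f g : DualR K R} (h : ∀ r, f r = g r) : f = g := DFunLike.ext _ _ h

@[simp] lemma DualR.add_apply (f g : DualR K R) (r : R) : (f + g) r = f r + g r := rfl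
@[simp] lemma DualR.sub_apply (f g : DualR K R) (r : R) : (f - g) r = f r - g r := rfl
@[simp] lemma DualR.neg_apply (f : DualR K R) (r : R) : (-f) r = - f r := rfl
@[simp] lemma DualR.zero_apply (r : R) : (0 : DualR K R) r = 0 := rfl

noncomputable instance : SMul R (DualR K R) where
  smul r f := LinearMap.comp (show R →ₗ[K] K from f) (LinearMap.mulLeft K r)

@[simp] lemma DualR.smul_apply (r : R) (f : DualR K R) (s : R) : (r • f) s = f (r * s) := rfl

noncomputable instance : Module R (DualR K R) where
  one_smul f := by ext; simp
  mul_smul a b f := by ext; simp [mul_assoc, mul_left_comm]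
  smul_zero a := by ext; simp
  smul_add a f g := by ext; simp
  add_smul a b f := by ext; simp [add_mul]
  zero_smul f := by ext; simp

/-- the annihilator -/
noncomputable def ann (f : DualR K R) : Ideal R := LinearMap.ker (LinearMap.toSpanSingleton R _ f)

lemma mem_ann {f : DualR K R} {r : R} : r ∈ ann f ↔ r • f = 0 := by simp [ann]

variable (K)

/-- ideals of finite codimension for both structures -/
def Cof (I : Ideal R) : Prop := Module.Finite K (R ⧸ I) ∧ Module.Finite L (R ⧸ I)

variable {L}

lemma Cof.symm {I : Ideal R} (h : Cof K L I) : Cof L K I := ⟨h.2, h.1⟩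

lemma finite_mono {I J : Ideal R} (h : I ≤ J) [Module.Finite K (R ⧸ I)] :
    Module.Finite K (R ⧸ J) :=
  Module.Finite.of_surjective (Ideal.Quotient.factorₐ K h).toLinearMap
    (Ideal.Quotient.factor_surjective h)

lemma Cof.mono {I J : Ideal R} (hI : Cof K L I) (h : I ≤ J) : Cof K L J := by
  obtain ⟨h1, h2⟩ := hI
  exact ⟨finite_mono K h, finite_mono L h⟩

lemma eq_of_finrank {I J : Ideal R} (h : I ≤ J) [Module.Finite K (R ⧸ I)]
    (hd : Module.finrank K (R ⧸ I) ≤ Module.finrank K (R ⧸ J)) : I = J := by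
  have := finite_mono K h
  have hs : Function.Surjective (Ideal.Quotient.factorₐ K h).toLinearMap :=
    Ideal.Quotient.factor_surjective h
  have hd' := LinearMap.finrank_le_finrank_of_surjective hs
  have hi := (LinearMap.injective_iff_surjective_of_finrank_eq_finrank (le_antisymm hd hd')).2 hs
  refine le_antisymm h fun r hr => ?_
  rw [← Ideal.Quotient.eq_zero_iff_mem] at hr ⊢
  apply hi
  rw [map_zero]
  exact hr

/-- if multiplication by `r` is injective mod `I`, it is surjective. -/
lemma exists_inv {I : Ideal R} [Module.Finite K (R ⧸ I)] {r : R}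
    (h : ∀ s, s * r ∈ I → s ∈ I) : ∃ s, 1 - s * r ∈ I := by
  have hi : Function.Injective (LinearMap.mulLeft K (Ideal.Quotient.mk I r)) := by
    rw [injective_iff_map_eq_zero]
    intro a ha
    obtain ⟨s, rfl⟩ := Ideal.Quotient.mk_surjective a
    rw [LinearMap.mulLeft_apply, ← map_mul, Ideal.Quotient.eq_zero_iff_mem, mul_comm] at ha
    exact Ideal.Quotient.eq_zero_iff_mem.2 (h s ha)
  obtain ⟨a, ha⟩ := LinearMap.surjective_of_injective hi 1
  obtain ⟨s, rfl⟩ := Ideal.Quotient.mk_surjective a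
  refine ⟨s, ?_⟩
  rw [← Ideal.Quotient.eq_zero_iff_mem, map_sub, map_one, ← ha]
  simp [mul_comm]

/-- functionals killed by a maximal ideal: one-dimensional over the residue field. -/
lemma exists_smul_eq {J : Ideal R} [Module.Finite K (R ⧸ J)]
    (hJ : ∀ r, r ∉ J → ∃ s, 1 - s * r ∈ J)
    {n x : DualR K R} (hn : n ≠ 0) (hnJ : ∀ r ∈ J, r • n = 0) (hxJ : ∀ r ∈ J, r • x = 0) :
    ∃ r : R, x = r • n := by
  have vanish : ∀ f : DualR K R, (∀ r ∈ J, r • f = 0) → 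
      Submodule.restrictScalars K J ≤ LinearMap.ker (show R →ₗ[K] K from f) := by
    intro f hf r hr
    have := DFunLike.congr_fun (hf r hr) 1
    simp only [DualR.smul_apply, mul_one] at this
    exact this
  -- the map R/J → Dual K (R/J)
  let n' : (R ⧸ J) →ₗ[K] K := Submodule.liftQ (Submodule.restrictScalars K J) (show R →ₗ[K] K from n) (vanish n hnJ)
  let x' : (R ⧸ J) →ₗ[K] K := Submodule.liftQ (Submodule.restrictScalars K J) (show R →ₗ[K] K from x) (vanish x hxJ)
  have hn' : ∀ r, n' (Ideal.Quotient.mk J r) = n r := fun r => rfl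
  have hx' : ∀ r, x' (Ideal.Quotient.mk J r) = x r := fun r => rfl
  clear_value n' x'
  let T : (R ⧸ J) →ₗ[K] Module.Dual K (R ⧸ J) := 
    (LinearMap.compRight K n') ∘ₗ (LinearMap.mul K (R ⧸ J))
  have hT : ∀ a b, T a b = n' (a * b) := fun a b => rfl
  have hi : Function.Injective T := by
    rw [injective_iff_map_eq_zero]
    intro a ha
    obtain ⟨r, rfl⟩ := Ideal.Quotient.mk_surjective a
    rw [Ideal.Quotient.eq_zero_iff_mem]
    by_contra hr
    obtain ⟨s, hs⟩ := hJ r hr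
    apply hn
    ext t
    have h1 := LinearMap.congr_fun ha (Ideal.Quotient.mk J (s * t))
    rw [hT, ← map_mul, hn', LinearMap.zero_apply] at h1
    have h2 := DFunLike.congr_fun (hnJ _ hs) t
    simp only [DualR.smul_apply, DualR.zero_apply] at h2 ⊢
    have : t = (1 - s * r) * t + r * (s * t) := by ring
    rw [this, map_add, h1, h2, add_zero]
  have hsurj : Function.Surjective T :=
    (LinearMap.injective_iff_surjective_of_finrank_eq_finrank
      (Subspace.dual_finrank_eq (K := K) (V := R ⧸ J)).symm).1 hi
  obtain ⟨a, ha⟩ := hsurj x'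
  obtain ⟨r, rfl⟩ := Ideal.Quotient.mk_surjective a
  refine ⟨r, ?_⟩
  ext t
  rw [← hx', ← ha, hT, ← map_mul, hn']
  rfl

variable (L)
/-- graphs of partial isomorphisms -/
def PI (Γ : Submodule R (DualR K R × DualR L R)) : Prop :=
  ∀ p ∈ Γ, p.1 = 0 ↔ p.2 = 0

variable {K L}

lemma PI.extend {Γ : Submodule R (DualR K R × DualR L R)} (h : PI K L Γ)
    (hmax : ∀ Γ', PI K L Γ' → Γ ≤ Γ' → Γ' = Γ)
    (x : DualR K R) (y : DualR L R) (hx : ∀ y', (x, y') ∉ Γ) (hy : ∀ x', (x', y) ∉ Γ)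
    (hr : ∀ r : R, r • (x, y) ∈ Γ ∨ ∃ s : R, s • r • (x, y) = (x, y)) : False := by
  have key : PI K L (Γ ⊔ Submodule.span R {(x, y)}) := by
    intro p hp
    obtain ⟨q, hq, z, hz, rfl⟩ := Submodule.mem_sup.1 hp
    obtain ⟨r, rfl⟩ := Submodule.mem_span_singleton.1 hz
    rcases hr r with h1 | ⟨s, hs⟩
    · exact h _ (Γ.add_mem hq h1)
    · have e1 : s • (q + r • (x, y)) = s • q + (x, y) := by rw [smul_add, hs]
      have hsq := Γ.neg_mem (Γ.smul_mem s hq)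
      constructor
      · intro h0
        exfalso
        have h2 := congrArg Prod.fst e1
        rw [Prod.smul_fst, h0, smul_zero, Prod.fst_add] at h2
        apply hx (-(s • q)).2
        have : x = (-(s • q)).1 := by rw [Prod.fst_neg]; exact eq_neg_of_add_eq_zero_right h2.symm
        rw [this]; exact hsq
      · intro h0
        exfalso
        have h2 := congrArg Prod.snd e1
        rw [Prod.smul_snd, h0, smul_zero, Prod.snd_add] at h2
        apply hy (-(s • q)).1
        have : y = (-(s • q)).2 := by rw [Prod.snd_neg]; exact eq_neg_of_add_eq_zero_right h2.symm
        rw [this]; exact hsq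
  have := hmax _ key le_sup_left
  apply hx y
  rw [← this]
  exact Submodule.mem_sup_right (Submodule.mem_span_singleton_self _)

lemma PI.uniq {Γ : Submodule R (DualR K R × DualR L R)} (h : PI K L Γ)
    {x : DualR K R} {y y' : DualR L R} (h1 : (x, y) ∈ Γ) (h2 : (x, y') ∈ Γ) : y = y' := by
  have := (h _ (Γ.sub_mem h1 h2)).1 (by simp)
  exact sub_eq_zero.1 this

lemma PI.total {Γ : Submodule R (DualR K R × DualR L R)} (h : PI K L Γ)
    (hmax : ∀ Γ', PI K L Γ' → Γ ≤ Γ' → Γ' = Γ)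
    (x : DualR K R) (hx : Cof K L (ann x)) : ∃ y, (x, y) ∈ Γ := by
  by_contra hcon
  -- minimal counterexample
  let S : Set (DualR K R) := {z | Cof K L (ann z) ∧ ¬ ∃ y, (z, y) ∈ Γ}
  let μ : DualR K R → ℕ := fun z => Module.finrank K (R ⧸ ann z)
  have hS : S.Nonempty := ⟨x, hx, hcon⟩
  clear hx hcon x
  obtain ⟨x, ⟨hx, hxN⟩, hmin⟩ : ∃ x ∈ S, ∀ z ∈ S, μ x ≤ μ z :=
    ⟨Function.argminOn μ S hS, Function.argminOn_mem μ S hS,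
      fun z hz => Function.argminOn_le μ S hz⟩
  have hN : ∀ z y, (z, y) ∈ Γ → ∀ r : R, (r • z, r • y) ∈ Γ := fun z y hz r => Γ.smul_mem r hz
  have := hx.1
  -- dichotomy
  have hdich : ∀ r : R, (¬ ∃ y, (r • x, y) ∈ Γ) → ∃ s, 1 - s * r ∈ ann x := by
    intro r hr
    have hle : ann x ≤ ann (r • x) := fun s hs => by
      rw [mem_ann] at hs ⊢
      rw [smul_comm, hs, smul_zero]
    have heq := eq_of_finrank K hle (hmin (r • x) ⟨hx.mono K hle, hr⟩)
    apply exists_inv K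
    intro s hs
    rw [heq, mem_ann, ← mul_smul, ← mem_ann]
    exact hs
  -- the ideal J
  let J : Ideal R :=
    { carrier := {r | ∃ y, (r • x, y) ∈ Γ}
      add_mem' := by
        rintro a b ⟨y, hy⟩ ⟨z, hz⟩
        refine ⟨y + z, ?_⟩
        rw [add_smul]
        exact Γ.add_mem hy hz
      zero_mem' := ⟨0, by rw [zero_smul]; exact Γ.zero_mem⟩
      smul_mem' := by
        rintro c a ⟨y, hy⟩
        refine ⟨c • y, ?_⟩
        rw [smul_eq_mul, mul_smul]
        exact hN _ _ hy c }
  have hJmem : ∀ r, r ∈ J ↔ ∃ y, (r • x, y) ∈ Γ := fun r => Iff.rfl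
  have hannJ : ann x ≤ J := fun r hr => ⟨0, by rw [mem_ann.1 hr]; exact Γ.zero_mem⟩
  have h1J : (1 : R) ∉ J := fun h1 => hxN (by simpa using (hJmem 1).1 h1)
  choose! f hf using fun r (hr : r ∈ J) => hr
  have hf_add : ∀ a b, a ∈ J → b ∈ J → f (a + b) = f a + f b := by
    intro a b ha hb
    refine h.uniq (hf _ (J.add_mem ha hb)) ?_
    rw [add_smul]
    exact Γ.add_mem (hf a ha) (hf b hb)
  have hf_mul : ∀ c a, a ∈ J → f (c * a) = c • f a := by
    intro c a ha
    refine h.uniq (hf _ (J.mul_mem_left c ha)) ?_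
    rw [mul_smul]
    exact hN _ _ (hf a ha) c
  let g : (Submodule.restrictScalars L J) →ₗ[L] L :=
    { toFun := fun r => f r.1 1
      map_add' := fun a b => by
        rw [Submodule.coe_add, hf_add _ _ a.2 b.2]; rfl
      map_smul' := fun c a => by
        rw [Submodule.coe_smul, Algebra.smul_def, hf_mul _ _ a.2, DualR.smul_apply,
          ← Algebra.smul_def, map_smul]; rfl }
  obtain ⟨y0, hy0⟩ := LinearMap.exists_extend g
  let y : DualR L R := y0
  have hyJ : ∀ r ∈ J, r • y = f r := by
    intro r hr
    ext s
    have h1 : y (r * s) = f (r * s) 1 :=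
      LinearMap.congr_fun hy0 ⟨r * s, J.mul_mem_right s hr⟩
    rw [DualR.smul_apply, h1, mul_comm, hf_mul _ _ hr, DualR.smul_apply, mul_one]
  have hinv : ∀ r, r ∉ J → ∃ s, 1 - s * r ∈ ann x := fun r hr => hdich r hr
  by_cases hyN : ∃ n, (n, y) ∈ Γ
  · obtain ⟨n, hn⟩ := hyN
    have hx'J : ∀ r ∈ J, r • (x - n) = 0 := by
      intro r hr
      have h1 := Γ.sub_mem (hf r hr) (hN _ _ hn r)
      have h2 := (h _ h1).2 (by simp [hyJ r hr])
      rw [smul_sub]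
      exact h2
    have hx'N : ∀ y', (x - n, y') ∉ Γ := by
      intro y' hy'
      apply hxN
      refine ⟨y' + y, ?_⟩
      have := Γ.add_mem hy' hn
      simpa using this
    have hcJ := hx.mono K hannJ
    have := hcJ.1
    -- a nonzero functional killed by J
    have hne : (Ideal.Quotient.mk J 1 : R ⧸ J) ≠ 0 := fun h0 =>
      h1J (Ideal.Quotient.eq_zero_iff_mem.1 h0)
    obtain ⟨w, hw⟩ : ∃ w : Module.Dual L (R ⧸ J), w (Ideal.Quotient.mk J 1) ≠ 0 := by
      by_contra hall
      push Not at hall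
      exact hne ((Module.forall_dual_apply_eq_zero_iff L _).1 hall)
    let y' : DualR L R := w ∘ₗ (Ideal.Quotient.mkₐ L J).toLinearMap
    have hy'a : ∀ r, y' r = w (Ideal.Quotient.mk J r) := fun r => rfl
    have hy'J : ∀ r ∈ J, r • y' = 0 := by
      intro r hr
      ext s
      rw [DualR.smul_apply, hy'a, Ideal.Quotient.eq_zero_iff_mem.2 (J.mul_mem_right s hr),
        map_zero]
      rfl
    have hy'0 : y' ≠ 0 := fun h0 => hw (by rw [← hy'a, h0]; rfl)
    refine h.extend hmax (x - n) y' hx'N ?_ ?_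
    · intro n' hn'
      have hn'0 : n' ≠ 0 := fun h0 => hy'0 ((h _ hn').1 h0)
      have hn'J : ∀ r ∈ J, r • n' = 0 := by
        intro r hr
        have h1 := hN _ _ hn' r
        exact (h _ h1).2 (hy'J r hr)
      obtain ⟨r, hr⟩ := exists_smul_eq K (J := J)
        (fun r hr => (hinv r hr).imp fun s hs => hannJ hs) hn'0 hn'J hx'J
      apply hx'N (r • y')
      rw [hr]
      exact hN _ _ hn' r
    · intro r
      by_cases hr : r ∈ J
      · left
        rw [Prod.smul_mk, hx'J r hr, hy'J r hr]
        exact Γ.zero_mem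
      · right
        obtain ⟨s, hs⟩ := hinv r hr
        refine ⟨s, ?_⟩
        have h1 : (1 - s * r) • (x - n, y') = 0 := by
          rw [Prod.smul_mk, hx'J _ (hannJ hs), hy'J _ (hannJ hs)]; rfl
        rw [sub_smul, one_smul, mul_smul] at h1
        exact (sub_eq_zero.1 h1).symm
  · refine h.extend hmax x y (fun y' hy' => hxN ⟨y', hy'⟩) (fun n hn => hyN ⟨n, hn⟩) ?_
    intro r
    by_cases hr : r ∈ J
    · left
      rw [Prod.smul_mk, hyJ r hr]
      exact hf r hr
    · right
      obtain ⟨s, hs⟩ := hinv r hr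
      refine ⟨s, ?_⟩
      have h0 : (1 - s * r) • y = 0 := by
        rw [hyJ _ (hannJ hs)]
        have := hf _ (hannJ hs)
        rw [mem_ann.1 hs] at this
        exact (h _ this).1 rfl
      have h1 : (1 - s * r) • (x, y) = 0 := by
        rw [Prod.smul_mk, mem_ann.1 hs, h0]; rfl
      rw [sub_smul, one_smul, mul_smul] at h1
      exact (sub_eq_zero.1 h1).symm

variable (K L R)

lemma exists_max : ∃ Γ : Submodule R (DualR K R × DualR L R), PI K L Γ ∧
    ∀ Γ', PI K L Γ' → Γ ≤ Γ' → Γ' = Γ := by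
  obtain ⟨Γ, -, hΓ⟩ := zorn_le_nonempty₀ {Γ : Submodule R (DualR K R × DualR L R) | PI K L Γ}
    (fun c hc hchain Γ0 hΓ0 => by
      refine ⟨sSup c, ?_, fun z hz => le_sSup hz⟩
      intro p hp
      obtain ⟨Γ, hΓ, hpΓ⟩ := (Submodule.mem_sSup_of_directed ⟨Γ0, hΓ0⟩ hchain.directedOn).1 hp
      exact hc hΓ p hpΓ) ⊥ (by
        intro p hp
        rw [Submodule.mem_bot] at hp
        subst hp
        simp)
  exact ⟨Γ, hΓ.1, fun Γ' h1 h2 => le_antisymm (hΓ.2 h1 h2) h2⟩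

lemma exists_graph : ∃ Γ : Submodule R (DualR K R × DualR L R), PI K L Γ ∧
    (∀ x, Cof K L (ann x) → ∃ y, (x, y) ∈ Γ) ∧ (∀ y, Cof K L (ann y) → ∃ x, (x, y) ∈ Γ) := by
  obtain ⟨Γ, h, hmax⟩ := exists_max K L R
  refine ⟨Γ, h, h.total hmax, fun y hy => ?_⟩
  have h' : PI L K (Γ.comap (LinearEquiv.prodComm R (DualR L R) (DualR K R)).toLinearMap) := by
    intro p hp
    exact (h _ hp).symm
  refine h'.total (fun Γ' hΓ' hle => ?_) y hy.symm
  have h2 := hmax (Γ'.comap (LinearEquiv.prodComm R (DualR K R) (DualR L R)).toLinearMap)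
    (fun p hp => (hΓ' _ hp).symm) (fun p hp => hle (by exact hp))
  rw [← h2]
  rfl

end

section
variable {K : Type u1} {L : Type u3} {R : Type u2} [Field K] [Field L] [CommRing R]
  [Algebra K R] [Algebra L R] {M : Type*} [AddCommGroup M] [Module R M]
  [Module K M] [Module L M] [IsScalarTower K R M] [IsScalarTower L R M]

/-- orbit functional -/
def orb (u : Module.Dual K M) (m : M) : DualR K R :=
  u ∘ₗ (LinearMap.toSpanSingleton R M m).restrictScalars K

lemma orb_apply (u : Module.Dual K M) (m : M) (r : R) : orb u m r = u (r • m) := rfl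

lemma orb_add (u : Module.Dual K M) (m m' : M) :
    (orb u (m + m') : DualR K R) = orb u m + orb u m' := by
  ext; simp [orb_apply]

lemma orb_smul (u : Module.Dual K M) (m : M) (r : R) :
    (orb u (r • m) : DualR K R) = r • orb u m := by
  ext s
  rw [DualR.smul_apply, orb_apply, orb_apply, ← mul_smul, mul_comm]

variable (K) in
lemma finite_orbit (m : M) [Module.Finite K M] :
    Module.Finite K (R ⧸ LinearMap.ker (LinearMap.toSpanSingleton R M m)) := by
  let f : (R ⧸ LinearMap.ker (LinearMap.toSpanSingleton R M m)) →ₗ[R] M :=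
    (LinearMap.ker (LinearMap.toSpanSingleton R M m)).liftQ
      (LinearMap.toSpanSingleton R M m) le_rfl
  have hf : Function.Injective f :=
    LinearMap.ker_eq_bot.1 (Submodule.ker_liftQ_eq_bot' _ _ rfl)
  exact Module.Finite.of_injective (f.restrictScalars K) hf

variable [Module.Finite K M] [Module.Finite L M]

lemma cof_orb (u : Module.Dual K M) (m : M) : Cof K L (ann (orb u m : DualR K R)) := by
  refine Cof.mono K (I := LinearMap.ker (LinearMap.toSpanSingleton R M m))
    ⟨finite_orbit K m, finite_orbit L m⟩ ?_
  intro r hr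
  rw [LinearMap.mem_ker, LinearMap.toSpanSingleton_apply] at hr
  rw [mem_ann, ← orb_smul, hr]
  ext; simp [orb_apply]

lemma exists_dual {Γ : Submodule R (DualR K R × DualR L R)} (h : PI K L Γ)
    (ht : ∀ x, Cof K L (ann x) → ∃ y, (x, y) ∈ Γ) (u : Module.Dual K M) :
    ∃! v : Module.Dual L M, ∀ m, (orb u m, orb v m) ∈ Γ := by
  choose y hy using fun m => ht (orb u m) (cof_orb u m)
  have yadd : ∀ m m', y (m + m') = y m + y m' := fun m m' => by
    refine h.uniq (hy _) ?_
    rw [orb_add]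
    exact Γ.add_mem (hy m) (hy m')
  have ysmul : ∀ (r : R) m, y (r • m) = r • y m := fun r m => by
    refine h.uniq (hy _) ?_
    rw [orb_smul]
    exact Γ.smul_mem r (hy m)
  let v : Module.Dual L M :=
    { toFun := fun m => y m 1
      map_add' := fun m m' => by rw [yadd]; rfl
      map_smul' := fun c m => by
        rw [← algebraMap_smul R c m, ysmul, DualR.smul_apply, ← Algebra.smul_def, map_smul]; rfl }
  refine ⟨v, fun m => ?_, fun v' hv' => ?_⟩
  · have : orb v m = y m := by
      ext r
      change y (r • m) 1 = _
      rw [ysmul, DualR.smul_apply, mul_one]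
    rw [this]
    exact hy m
  · ext m
    have h1 := h.uniq (hv' m) (hy m)
    have h2 := DFunLike.congr_fun h1 1
    rw [orb_apply, one_smul] at h2
    exact h2


lemma exists_dual' {Γ : Submodule R (DualR K R × DualR L R)} (h : PI K L Γ)
    (ht : ∀ y, Cof K L (ann y) → ∃ x, (x, y) ∈ Γ) (v : Module.Dual L M) :
    ∃! u : Module.Dual K M, ∀ m, (orb u m, orb v m) ∈ Γ := by
  let Γ' := Γ.comap (LinearEquiv.prodComm R (DualR L R) (DualR K R)).toLinearMap
  have h' : PI L K Γ' := fun p hp => (h _ hp).symm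
  exact exists_dual (Γ := Γ') h' (fun y hy => ht y hy.symm) v

end

section
variable (K : Type u1) (L : Type u3) [Field K] [Field L]

attribute [local instance] TensorProduct.Algebra.module

open TensorProduct in
theorem exists_theta : ∃ θ : ∀ (M : Type u2) [AddCommGroup M] [Module K M] [Module L M]
    [SMulCommClass K L M] [Module.Finite K M] [Module.Finite L M],
      Module.Dual K M ≃ Module.Dual L M,
    ∀ (M M' : Type u2) [AddCommGroup M] [Module K M] [Module L M]
    [SMulCommClass K L M] [Module.Finite K M] [Module.Finite L M]
    [AddCommGroup M'] [Module K M'] [Module L M']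
    [SMulCommClass K L M'] [Module.Finite K M'] [Module.Finite L M']
    (t : M →+ M') (_ : ∀ (c : K) m, t (c • m) = c • t m) (_ : ∀ (c : L) m, t (c • m) = c • t m)
    (u : Module.Dual K M) (u' : Module.Dual K M') (_ : ∀ m, u m = u' (t m)) (m : M),
      θ M u m = θ M' u' (t m) := by
  let : Algebra L (K ⊗[ℤ] L) := Algebra.TensorProduct.rightAlgebra
  obtain ⟨Γ, h, h1, h2⟩ := exists_graph K L (K ⊗[ℤ] L)
  have tow : ∀ (M : Type u2) [AddCommGroup M] [Module K M] [Module L M]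
      [SMulCommClass K L M], IsScalarTower K (K ⊗[ℤ] L) M ∧ IsScalarTower L (K ⊗[ℤ] L) M := by
    intro M _ _ _ _
    constructor
    · refine IsScalarTower.of_algebraMap_smul (R := K) (A := K ⊗[ℤ] L) (M := M) fun c m => ?_
      rw [Algebra.TensorProduct.algebraMap_apply, TensorProduct.Algebra.smul_def]
      simp
    · refine IsScalarTower.of_algebraMap_smul (R := L) (A := K ⊗[ℤ] L) (M := M) fun c m => ?_
      rw [show algebraMap L (K ⊗[ℤ] L) c = 1 ⊗ₜ c from rfl, TensorProduct.Algebra.smul_def]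
      simp
  have key : ∀ (M : Type u2) [AddCommGroup M] [Module K M] [Module L M]
    [SMulCommClass K L M] [Module.Finite K M] [Module.Finite L M],
      ∃ θ : Module.Dual K M ≃ Module.Dual L M, 
        let := (tow M).1; let := (tow M).2;
        ∀ u m, ((orb u m, orb (θ u) m) : DualR K (K ⊗[ℤ] L) × DualR L (K ⊗[ℤ] L)) ∈ Γ := by
    intro M _ _ _ _ _ _
    let := (tow M).1; let := (tow M).2
    choose f hf hf' using fun u : Module.Dual K M => exists_dual h h1 u
    choose g hg hg' using fun u : Module.Dual L M => exists_dual' h h2 u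
    exact ⟨⟨f, g, fun u => (hg' _ _ (hf u)).symm, fun v => (hf' _ _ (hg v)).symm⟩, hf⟩
  choose θ hθ using key
  refine ⟨θ, ?_⟩
  intro M M' _ _ _ _ _ _ _ _ _ _ _ _ t htK htL u u' hu m
  let := (tow M).1; let := (tow M).2
  let := (tow M').1; let := (tow M').2
  have ht : ∀ (r : K ⊗[ℤ] L) (m : M), t (r • m) = r • t m := by
    intro r m
    induction r with
    | zero =>
      exact (congrArg t (zero_smul (K ⊗[ℤ] L) m)).trans
        ((map_zero t).trans (zero_smul (K ⊗[ℤ] L) (t m)).symm)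
    | add x y hx hy => rw [add_smul, map_add, hx, hy, add_smul]
    | tmul a b => rw [TensorProduct.Algebra.smul_def, TensorProduct.Algebra.smul_def, htK, htL]
  have e1 : (orb u m : DualR K (K ⊗[ℤ] L)) = orb u' (t m) := by
    ext r
    rw [orb_apply, orb_apply, hu, ht]
  have e2 := hθ M u m
  rw [e1] at e2
  have e3 := DFunLike.congr_fun (h.uniq e2 (hθ M' u' (t m))) 1
  rw [orb_apply, orb_apply, one_smul, one_smul] at e3
  exact e3

end

section Cat
open CategoryTheory
universe v v' u u'
variable {K : Type u1} {L : Type u3} [Field K] [Field L]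
  {C : Type u} {D : Type u'} [Category.{v} C] [Category.{v'} D]
  [Preadditive C] [Preadditive D]
  [CategoryTheory.Linear K C] [CategoryTheory.Linear L D]
  [∀ X Y : C, FiniteDimensional K (X ⟶ Y)]
  [∀ X Y : D, FiniteDimensional L (X ⟶ Y)]

lemma serre_bij {S : C ⥤ C} (h : RightSerreData K C S) (X Y : C) :
    Function.Bijective (LinearMap.flip (h.e X Y).toLinearMap) := by
  have hi : Function.Injective (LinearMap.flip (h.e X Y).toLinearMap) := by
    rw [injective_iff_map_eq_zero]
    intro w hw
    rw [← Module.forall_dual_apply_eq_zero_iff K]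
    intro φ
    obtain ⟨g, rfl⟩ := (h.e X Y).surjective φ
    exact LinearMap.congr_fun hw g
  refine ⟨hi, (LinearMap.injective_iff_surjective_of_finrank_eq_finrank ?_).1 hi⟩
  rw [Subspace.dual_finrank_eq, (h.e X Y).finrank_eq, Subspace.dual_finrank_eq]

/-- pairing equivalence -/
noncomputable def serreEquiv {S : C ⥤ C} (h : RightSerreData K C S) (X Y : C) :
    (Y ⟶ S.obj X) ≃ₗ[K] Module.Dual K (X ⟶ Y) :=
  LinearEquiv.ofBijective _ (serre_bij h X Y)

lemma serreEquiv_apply {S : C ⥤ C} (h : RightSerreData K C S) {X Y : C} (w : Y ⟶ S.obj X)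
    (g : X ⟶ Y) : serreEquiv h X Y w g = h.e X Y g w := rfl

variable (K) in
/-- the `K`-module structure on `Hom (F X, Y)` -/
abbrev modK (F : C ⥤ D) [F.Additive] (X : C) (Y : D) : Module K (F.obj X ⟶ Y) where
  smul c f := F.map (c • 𝟙 X) ≫ f
  one_smul f := by change F.map _ ≫ f = f; simp
  mul_smul a b f := by
    change F.map _ ≫ f = F.map _ ≫ F.map _ ≫ f
    rw [← Category.assoc, ← F.map_comp]
    simp [mul_smul, smul_comm a b]
  smul_zero a := by change F.map _ ≫ 0 = 0; simp
  smul_add a f g := by change F.map _ ≫ (f + g) = F.map _ ≫ f + F.map _ ≫ g; simp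
  add_smul a b f := by
    change F.map _ ≫ f = F.map _ ≫ f + F.map _ ≫ f
    simp [add_smul, F.map_add]
  zero_smul f := by change F.map _ ≫ f = 0; simp

attribute [local instance] modK

lemma modK_smul (F : C ⥤ D) [F.Additive] {X : C} {Y : D} (c : K) (f : F.obj X ⟶ Y) :
    c • f = F.map (c • 𝟙 X) ≫ f := rfl

lemma modK_comm (F : C ⥤ D) [F.Additive] (X : C) (Y : D) :
    SMulCommClass K L (F.obj X ⟶ Y) where
  smul_comm a b f := by rw [modK_smul, modK_smul]; simp

/-- the adjunction is `K`-linear -/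
def adjLin (F : C ⥤ D) [F.Additive] {G : D ⥤ C} (adj : F ⊣ G) (X : C) (Y : D) :
    (F.obj X ⟶ Y) ≃ₗ[K] (X ⟶ G.obj Y) :=
  { adj.homAddEquiv X Y with
    map_smul' := fun c f => by
      change adj.homEquiv X Y (c • f) = c • adj.homEquiv X Y f
      rw [modK_smul, adj.homEquiv_naturality_left]
      simp }

lemma modK_finite (F : C ⥤ D) [F.Additive] {G : D ⥤ C} (adj : F ⊣ G) (X : C) (Y : D) :
    Module.Finite K (F.obj X ⟶ Y) :=
  Module.Finite.equiv (adjLin F adj X Y).symm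

theorem exists_phi {SC : C ⥤ C} {SD : D ⥤ D} (hSC : RightSerreData K C SC)
    (hSD : RightSerreData L D SD) (F : C ⥤ D) [F.Additive] {G : D ⥤ C} (adj : F ⊣ G) :
    ∃ Φ : ∀ (X : C) (Y : D), (G.obj Y ⟶ SC.obj X) ≃ (Y ⟶ SD.obj (F.obj X)),
      (∀ X Y Y' (g : Y' ⟶ Y) (w : G.obj Y ⟶ SC.obj X), Φ X Y' (G.map g ≫ w) = g ≫ Φ X Y w) ∧
      (∀ X X' Y (f : X ⟶ X') (w : G.obj Y ⟶ SC.obj X),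
        Φ X' Y (w ≫ SC.map f) = Φ X Y w ≫ SD.map (F.map f)) := by
  obtain ⟨θ, hθ⟩ := exists_theta.{u1, v', u3} K L
  have icomm : ∀ X Y, SMulCommClass K L (F.obj X ⟶ Y) := modK_comm F
  have ifin : ∀ X Y, Module.Finite K (F.obj X ⟶ Y) := modK_finite F adj
  let U : ∀ (X : C) (Y : D), (G.obj Y ⟶ SC.obj X) ≃ Module.Dual K (F.obj X ⟶ Y) := fun X Y =>
    (serreEquiv hSC X (G.obj Y)).toEquiv.trans (adjLin F adj X Y).dualMap.toEquiv
  have hU : ∀ X Y (w : G.obj Y ⟶ SC.obj X) (h : F.obj X ⟶ Y),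
    U X Y w h = hSC.e X (G.obj Y) (adj.homEquiv X Y h) w := fun X Y w h => rfl
  let Φ : ∀ (X : C) (Y : D), (G.obj Y ⟶ SC.obj X) ≃ (Y ⟶ SD.obj (F.obj X)) := fun X Y =>
    ((U X Y).trans (θ (F.obj X ⟶ Y))).trans (serreEquiv hSD (F.obj X) Y).toEquiv.symm
  have hΦ : ∀ X Y (w : G.obj Y ⟶ SC.obj X) (h : F.obj X ⟶ Y),
      hSD.e (F.obj X) Y h (Φ X Y w) = θ (F.obj X ⟶ Y) (U X Y w) h := by
    intro X Y w h
    rw [← serreEquiv_apply]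
    exact LinearMap.congr_fun ((serreEquiv hSD (F.obj X) Y).apply_symm_apply _) h
  have hext : ∀ X Y (a b : Y ⟶ SD.obj (F.obj X)),
      (∀ h, hSD.e (F.obj X) Y h a = hSD.e (F.obj X) Y h b) → a = b := by
    intro X Y a b hab
    apply (serreEquiv hSD (F.obj X) Y).injective
    ext h
    exact hab h
  refine ⟨Φ, ?_, ?_⟩
  · intro X Y Y' g w
    apply hext
    intro h
    rw [hΦ, ← hSD.nat_right, hΦ]
    refine hθ (F.obj X ⟶ Y') (F.obj X ⟶ Y) (Preadditive.rightComp _ g) ?_ ?_ _ _ ?_ h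
    · intro c m
      simp [modK_smul, Preadditive.rightComp]
    · intro c m
      simp [Preadditive.rightComp]
    · intro m
      rw [hU, hU, ← hSC.nat_right, ← adj.homEquiv_naturality_right]
      rfl
  · intro X X' Y f w
    apply hext
    intro h
    rw [hΦ, ← hSD.nat_left, hΦ]
    refine hθ (F.obj X' ⟶ Y) (F.obj X ⟶ Y) (Preadditive.leftComp _ (F.map f)) ?_ ?_ _ _ ?_ h
    · intro c m
      simp only [modK_smul, Preadditive.leftComp, AddMonoidHom.mk'_apply]
      rw [← F.map_comp_assoc, ← F.map_comp_assoc]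
      simp
    · intro c m
      simp [Preadditive.leftComp]
    · intro m
      rw [hU, hU, ← hSC.nat_left, ← adj.homEquiv_naturality_left]
      rfl

theorem right_adj (SC : C ≌ C) {SD : D ⥤ D} (hSC : RightSerreData K C SC.functor)
    (hSD : RightSerreData L D SD) (F : C ⥤ D) [F.Additive] {G : D ⥤ C} (adj : F ⊣ G) :
    Nonempty (G ⊣ (SC.inverse ⋙ F ⋙ SD)) := by
  obtain ⟨Φ, h1, h2⟩ := exists_phi hSC hSD F adj
  refine ⟨Adjunction.mkOfHomEquiv
    { homEquiv := fun Y X =>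
        ((Iso.refl (G.obj Y)).homCongr (SC.counitIso.app X).symm).trans (Φ (SC.inverse.obj X) Y)
      homEquiv_naturality_left_symm := ?_
      homEquiv_naturality_right := ?_ }⟩
  · intro Y' Y X f g
    rw [Equiv.symm_apply_eq]
    obtain ⟨w, rfl⟩ := (((Iso.refl (G.obj Y)).homCongr (SC.counitIso.app X).symm).trans
      (Φ (SC.inverse.obj X) Y)).surjective g
    rw [Equiv.symm_apply_apply]
    simp [Iso.homCongr, h1]
  · intro Y X X' f g
    have := h2 _ _ Y (SC.inverse.map g) (f ≫ SC.counitIso.inv.app X)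
    simp [Iso.homCongr] at this ⊢
    exact this

end Cat
end SerreAux

section Statement

universe w v v' u u'

variable (k : Type w) [Field k]
variable {C : Type u} {D : Type u'} [Category.{v} C] [Category.{v'} D]
  [Preadditive C] [Preadditive D]
  [CategoryTheory.Linear k C] [CategoryTheory.Linear k D]
  [∀ X Y : C, FiniteDimensional k (X ⟶ Y)]
  [∀ X Y : D, FiniteDimensional k (X ⟶ Y)]

/-- **Lemma 1.7.** Let `𝒞` and `𝒟` be Hom-finite `k`-linear categories with Serre
functors `S_𝒞` and `S_𝒟`, and let `F : 𝒞 ⥤ 𝒟` be an additive functor with a right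
adjoint `G`. Then `S_𝒞^{-1} G S_𝒟` is a left adjoint of `F`, and `S_𝒟 F S_𝒞^{-1}` is a
right adjoint of `G`. -/
theorem serre_left_right_adjoint
    (SC : C ≌ C) (SD : D ≌ D)
    (hSC : RightSerreData k C SC.functor) (hSD : RightSerreData k D SD.functor)
    (F : C ⥤ D) (G : D ⥤ C) [F.Additive] (adj : F ⊣ G) :
    Nonempty ((SD.functor ⋙ G ⋙ SC.inverse) ⊣ F) ∧
    Nonempty (G ⊣ (SC.inverse ⋙ F ⋙ SD.functor)) := by
  obtain ⟨a⟩ := SerreAux.right_adj SC hSC hSD F adj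
  refine ⟨⟨?_⟩, ⟨a⟩⟩
  exact (SD.toAdjunction.comp (a.comp SC.symm.toAdjunction)).ofNatIsoRight
    (NatIso.ofComponents
      (fun X => SD.unitIso.symm.app _ ≪≫ F.mapIso (SC.unitIso.symm.app X)) (by
        intro X Y f
        have h1 := SD.unitIso.inv.naturality (F.map (SC.inverse.map (SC.functor.map f)))
        have h2 := SC.unitIso.inv.naturality f
        have h3 := congrArg F.map h2
        simp only [Functor.comp_map, Functor.id_map, F.map_comp] at h1 h2 h3
        dsimp
        rw [← Category.assoc, h1, Category.assoc, h3, Category.assoc]))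

end Statement
end

section
/- A recollement (𝒞′, 𝒞, 𝒞″, i^*, i_*, i^!, j_!, j^*, j_*) of triangulated categories sits in an unbounded ladder if and only if there is an infinite adjoint sequence (…, F_{-1}, i^*, i_*, i^!, F_1, …) of triangle functors extending the adjoint triple (i^*, i_*, i^!). -/
/-!
STATEMENT 16: A recollement `(𝒞′, 𝒞, 𝒞″, i^*, i_*, i^!, j_!, j^*, j_*)` of triangulated
categories sits in an unbounded ladder if and only if there is an infinite adjoint sequence
`(…, F_{-1}, i^*, i_*, i^!, F_1, …)` of triangle functors extending the adjoint triple
`(i^*, i_*, i^!)`.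
-/
open CategoryTheory CategoryTheory.Limits CategoryTheory.Pretriangulated

section Helpers

open CategoryTheory.Category

universe v v' v'' u u' u''

variable {C : Type u} {C' : Type u'} {C'' : Type u''}
  [Category.{v} C] [Category.{v'} C'] [Category.{v''} C'']

theorem exists_right_adjoint_of_universal (F : C ⥤ C')
    (h : ∀ Z : C', ∃ (W : C) (e : F.obj W ⟶ Z),
      ∀ (A : C) (g : F.obj A ⟶ Z), ∃! f : A ⟶ W, F.map f ≫ e = g) :
    ∃ G : C' ⥤ C, Nonempty (F ⊣ G) := by
  choose W e he using h
  let E : ∀ X Y, (F.obj X ⟶ Y) ≃ (X ⟶ W Y) := fun X Y =>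
    (Equiv.ofBijective (fun f : X ⟶ W Y => F.map f ≫ e Y)
      ((Function.bijective_iff_existsUnique _).2 (he Y X))).symm
  refine ⟨Adjunction.rightAdjointOfEquiv E ?_, ⟨Adjunction.adjunctionOfEquivRight E ?_⟩⟩ <;>
  · intro X' X Y f g
    obtain ⟨g, rfl⟩ := (E X Y).symm.surjective g
    rw [← Equiv.eq_symm_apply, Equiv.apply_symm_apply]
    simp [E]

theorem exists_left_adjoint_of_universal (G : C' ⥤ C)
    (h : ∀ Z : C, ∃ (W : C') (e : Z ⟶ G.obj W),
      ∀ (A : C') (g : Z ⟶ G.obj A), ∃! f : W ⟶ A, e ≫ G.map f = g) :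
    ∃ F : C ⥤ C', Nonempty (F ⊣ G) := by
  choose W e he using h
  let E : ∀ X Y, (W X ⟶ Y) ≃ (X ⟶ G.obj Y) := fun X Y =>
    (Equiv.ofBijective (fun f : W X ⟶ Y => e X ≫ G.map f)
      ((Function.bijective_iff_existsUnique _).2 (he X Y)))
  refine ⟨Adjunction.leftAdjointOfEquiv E ?_, ⟨Adjunction.adjunctionOfEquivLeft E ?_⟩⟩ <;>
  · intro X Y Y' f g
    simp [E]

theorem zero_left_of_adj {F : C ⥤ C'} {G : C' ⥤ C} [HasZeroMorphisms C] [HasZeroMorphisms C']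
    (adj : F ⊣ G)
    (h : ∀ X, IsZero (G.obj X)) (X : C) : IsZero (F.obj X) := by
  rw [IsZero.iff_id_eq_zero]
  exact (adj.homEquiv _ _).injective ((h _).eq_of_tgt _ _)

theorem zero_right_of_adj {F : C ⥤ C'} {G : C' ⥤ C} [HasZeroMorphisms C] [HasZeroMorphisms C']
    (adj : F ⊣ G)
    (h : ∀ X, IsZero (F.obj X)) (X : C') : IsZero (G.obj X) := by
  rw [IsZero.iff_id_eq_zero]
  exact (adj.homEquiv _ _).symm.injective ((h _).eq_of_src _ _)

theorem hom_zero_of_right {F : C ⥤ C'} {G : C' ⥤ C} [HasZeroMorphisms C'] (adj : F ⊣ G)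
    {A : C} {Y : C'} (h : IsZero (G.obj Y)) (f : F.obj A ⟶ Y) : f = 0 :=
  (adj.homEquiv _ _).injective (h.eq_of_tgt _ _)

theorem hom_zero_of_left {F : C ⥤ C'} {G : C' ⥤ C} [HasZeroMorphisms C] (adj : F ⊣ G)
    {A : C'} {Y : C} (h : IsZero (F.obj Y)) (f : Y ⟶ G.obj A) : f = 0 :=
  (adj.homEquiv _ _).symm.injective (h.eq_of_src _ _)

theorem hom_shift_zero_of_right [HasShift C ℤ] [HasShift C' ℤ]
    {F : C ⥤ C'} {G : C' ⥤ C} [HasZeroMorphisms C'] (adj : F ⊣ G) [F.CommShift ℤ] (n : ℤ)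
    {A : C} {Y : C'} (h : IsZero (G.obj Y)) (f : (F.obj A)⟦n⟧ ⟶ Y) : f = 0 := by
  rw [← cancel_epi ((F.commShiftIso n).hom.app A), comp_zero]
  exact hom_zero_of_right adj h (A := A⟦n⟧) _

theorem hom_shift_zero_of_left [HasShift C ℤ] [HasShift C' ℤ]
    {F : C ⥤ C'} {G : C' ⥤ C} [HasZeroMorphisms C] (adj : F ⊣ G) [G.CommShift ℤ] (n : ℤ)
    {A : C'} {Y : C} (h : IsZero (F.obj Y)) (f : Y ⟶ (G.obj A)⟦n⟧) : f = 0 := by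
  rw [← cancel_mono ((G.commShiftIso n).inv.app A), zero_comp]
  exact hom_zero_of_left adj h (A := A⟦n⟧) _

variable
  [HasShift C ℤ] [HasShift C' ℤ] [HasShift C'' ℤ]
  [Preadditive C] [Preadditive C'] [Preadditive C'']
  [HasZeroObject C] [HasZeroObject C'] [HasZeroObject C'']
  [∀ n : ℤ, (shiftFunctor C n).Additive] [∀ n : ℤ, (shiftFunctor C' n).Additive]
  [∀ n : ℤ, (shiftFunctor C'' n).Additive]
  [Pretriangulated C] [Pretriangulated C'] [Pretriangulated C'']

theorem IsTriangleFunctor.right {F : C ⥤ C'} {G : C' ⥤ C} (hF : IsTriangleFunctor F)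
    (adj : F ⊣ G) : IsTriangleFunctor G := by
  obtain ⟨c, hc⟩ := hF
  let _ := adj.rightAdjointCommShift ℤ
  have := adj.commShift_of_leftAdjoint ℤ
  exact ⟨inferInstance, adj.isTriangulated_rightAdjoint⟩

theorem IsTriangleFunctor.left {F : C ⥤ C'} {G : C' ⥤ C} (hG : IsTriangleFunctor G)
    (adj : F ⊣ G) : IsTriangleFunctor F := by
  obtain ⟨c, hc⟩ := hG
  let _ := adj.leftAdjointCommShift ℤ
  have := adj.commShift_of_rightAdjoint ℤ
  exact ⟨inferInstance, adj.isTriangulated_leftAdjoint⟩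

theorem IsTriangleFunctor.isZero₃ {F : C ⥤ C'} (hF : IsTriangleFunctor F)
    {X₁ X₂ X₃ : C} {a : X₁ ⟶ X₂} {b : X₂ ⟶ X₃} {c : X₃ ⟶ X₁⟦(1 : ℤ)⟧}
    (hT : Triangle.mk a b c ∈ distTriang C) (h : IsIso (F.map a)) : IsZero (F.obj X₃) := by
  obtain ⟨c, hc⟩ := hF
  exact Triangle.isZero₃_of_isIso₁ _ (F.map_distinguished _ hT) h

theorem IsTriangleFunctor.isZero₁ {F : C ⥤ C'} (hF : IsTriangleFunctor F)
    {X₁ X₂ X₃ : C} {a : X₁ ⟶ X₂} {b : X₂ ⟶ X₃} {c : X₃ ⟶ X₁⟦(1 : ℤ)⟧}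
    (hT : Triangle.mk a b c ∈ distTriang C) (h : IsIso (F.map b)) : IsZero (F.obj X₁) := by
  obtain ⟨c, hc⟩ := hF
  exact Triangle.isZero₁_of_isIso₂ _ (F.map_distinguished _ hT) h

theorem IsTriangleFunctor.isIso₁ {F : C ⥤ C'} (hF : IsTriangleFunctor F)
    {X₁ X₂ X₃ : C} {a : X₁ ⟶ X₂} {b : X₂ ⟶ X₃} {c : X₃ ⟶ X₁⟦(1 : ℤ)⟧}
    (hT : Triangle.mk a b c ∈ distTriang C) (h : IsZero (F.obj X₃)) : IsIso (F.map a) := by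
  obtain ⟨c, hc⟩ := hF
  exact (Triangle.isZero₃_iff_isIso₁ _ (F.map_distinguished _ hT)).1 h

theorem IsTriangleFunctor.isIso₂ {F : C ⥤ C'} (hF : IsTriangleFunctor F)
    {X₁ X₂ X₃ : C} {a : X₁ ⟶ X₂} {b : X₂ ⟶ X₃} {c : X₃ ⟶ X₁⟦(1 : ℤ)⟧}
    (hT : Triangle.mk a b c ∈ distTriang C) (h : IsZero (F.obj X₁)) : IsIso (F.map b) := by
  obtain ⟨c, hc⟩ := hF
  exact (Triangle.isZero₁_iff_isIso₂ _ (F.map_distinguished _ hT)).1 h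

theorem dist_exact_yoneda₂ {X₁ X₂ X₃ : C} {a : X₁ ⟶ X₂} {b : X₂ ⟶ X₃} {c : X₃ ⟶ X₁⟦(1 : ℤ)⟧}
    (hT : Triangle.mk a b c ∈ distTriang C) {Y : C} (f : X₂ ⟶ Y) (hf : a ≫ f = 0) :
    ∃ g : X₃ ⟶ Y, f = b ≫ g := Triangle.yoneda_exact₂ _ hT f hf

theorem dist_exact_yoneda₃ {X₁ X₂ X₃ : C} {a : X₁ ⟶ X₂} {b : X₂ ⟶ X₃} {c : X₃ ⟶ X₁⟦(1 : ℤ)⟧}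
    (hT : Triangle.mk a b c ∈ distTriang C) {Y : C} (f : X₃ ⟶ Y) (hf : b ≫ f = 0) :
    ∃ g : X₁⟦(1 : ℤ)⟧ ⟶ Y, f = c ≫ g := Triangle.yoneda_exact₃ _ hT f hf

theorem dist_exact_yoneda₁ {X₁ X₂ X₃ : C} {a : X₁ ⟶ X₂} {b : X₂ ⟶ X₃} {c : X₃ ⟶ X₁⟦(1 : ℤ)⟧}
    (hT : Triangle.mk a b c ∈ distTriang C) {Y : C} (f : X₁ ⟶ Y)
    (hf : ∀ k : X₃⟦(-1 : ℤ)⟧ ⟶ Y, k = 0) :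
    ∃ g : X₂ ⟶ Y, f = a ≫ g :=
  Triangle.yoneda_exact₂ _ (inv_rot_of_distTriang _ hT) f (hf _)

theorem dist_exact_coyoneda₂ {X₁ X₂ X₃ : C} {a : X₁ ⟶ X₂} {b : X₂ ⟶ X₃} {c : X₃ ⟶ X₁⟦(1 : ℤ)⟧}
    (hT : Triangle.mk a b c ∈ distTriang C) {Y : C} (f : Y ⟶ X₂) (hf : f ≫ b = 0) :
    ∃ g : Y ⟶ X₁, f = g ≫ a := Triangle.coyoneda_exact₂ _ hT f hf

theorem dist_exact_coyoneda₃ {X₁ X₂ X₃ : C} {a : X₁ ⟶ X₂} {b : X₂ ⟶ X₃} {c : X₃ ⟶ X₁⟦(1 : ℤ)⟧}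
    (hT : Triangle.mk a b c ∈ distTriang C) {Y : C} (f : Y ⟶ X₃) (hf : f ≫ c = 0) :
    ∃ g : Y ⟶ X₂, f = g ≫ b := Triangle.coyoneda_exact₃ _ hT f hf

theorem dist_exact_coyoneda₁ {X₁ X₂ X₃ : C} {a : X₁ ⟶ X₂} {b : X₂ ⟶ X₃} {c : X₃ ⟶ X₁⟦(1 : ℤ)⟧}
    (hT : Triangle.mk a b c ∈ distTriang C) {Y : C} (f : Y ⟶ X₁) (hf : f ≫ a = 0) :
    ∃ (k : X₃⟦(-1 : ℤ)⟧ ⟶ X₁) (g : Y ⟶ X₃⟦(-1 : ℤ)⟧), f = g ≫ k :=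
  ⟨_, Triangle.coyoneda_exact₂ _ (inv_rot_of_distTriang _ hT) f hf⟩

theorem pre_mor₁ {X₁ X₂ X₃ : C} {a : X₁ ⟶ X₂} {b : X₂ ⟶ X₃} {c : X₃ ⟶ X₁⟦(1 : ℤ)⟧}
    (hT : Triangle.mk a b c ∈ distTriang C) {Y : C}
    (h : ∀ f : X₃ ⟶ Y, f = 0) (h' : ∀ f : X₃⟦(-1 : ℤ)⟧ ⟶ Y, f = 0)
    (g : X₁ ⟶ Y) : ∃! f : X₂ ⟶ Y, a ≫ f = g := by
  obtain ⟨f, rfl⟩ := dist_exact_yoneda₁ hT g h'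
  refine ⟨f, rfl, fun f' (hf' : a ≫ f' = a ≫ f) => ?_⟩
  obtain ⟨k, hk⟩ := dist_exact_yoneda₂ hT (f' - f) (by
    rw [Preadditive.comp_sub, hf', sub_self])
  rwa [h k, comp_zero, sub_eq_zero] at hk

theorem post_mor₁ {X₁ X₂ X₃ : C} {a : X₁ ⟶ X₂} {b : X₂ ⟶ X₃} {c : X₃ ⟶ X₁⟦(1 : ℤ)⟧}
    (hT : Triangle.mk a b c ∈ distTriang C) {Y : C}
    (h : ∀ f : Y ⟶ X₃, f = 0) (h' : ∀ f : Y ⟶ X₃⟦(-1 : ℤ)⟧, f = 0)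
    (g : Y ⟶ X₂) : ∃! f : Y ⟶ X₁, f ≫ a = g := by
  obtain ⟨f, rfl⟩ := dist_exact_coyoneda₂ hT g (h _)
  refine ⟨f, rfl, fun f' (hf' : f' ≫ a = f ≫ a) => ?_⟩
  obtain ⟨l, k, hk⟩ := dist_exact_coyoneda₁ hT (f' - f) (by
    rw [Preadditive.sub_comp, hf', sub_self])
  rwa [h' k, zero_comp, sub_eq_zero] at hk

theorem post_mor₂ {X₁ X₂ X₃ : C} {a : X₁ ⟶ X₂} {b : X₂ ⟶ X₃} {c : X₃ ⟶ X₁⟦(1 : ℤ)⟧}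
    (hT : Triangle.mk a b c ∈ distTriang C) {Y : C}
    (h : ∀ f : Y ⟶ X₁, f = 0) (h' : ∀ f : Y ⟶ X₁⟦(1 : ℤ)⟧, f = 0)
    (g : Y ⟶ X₃) : ∃! f : Y ⟶ X₂, f ≫ b = g := by
  obtain ⟨f, rfl⟩ := dist_exact_coyoneda₃ hT g (h' _)
  refine ⟨f, rfl, fun f' (hf' : f' ≫ b = f ≫ b) => ?_⟩
  obtain ⟨k, hk⟩ := dist_exact_coyoneda₂ hT (f' - f) (by
    rw [Preadditive.sub_comp, hf', sub_self])
  rwa [h k, zero_comp, sub_eq_zero] at hk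

theorem pre_mor₂ {X₁ X₂ X₃ : C} {a : X₁ ⟶ X₂} {b : X₂ ⟶ X₃} {c : X₃ ⟶ X₁⟦(1 : ℤ)⟧}
    (hT : Triangle.mk a b c ∈ distTriang C) {Y : C}
    (h : ∀ f : X₁ ⟶ Y, f = 0) (h' : ∀ f : X₁⟦(1 : ℤ)⟧ ⟶ Y, f = 0)
    (g : X₂ ⟶ Y) : ∃! f : X₃ ⟶ Y, b ≫ f = g := by
  obtain ⟨f, rfl⟩ := dist_exact_yoneda₂ hT g (h _)
  refine ⟨f, rfl, fun f' (hf' : b ≫ f' = b ≫ f) => ?_⟩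
  obtain ⟨k, hk⟩ := dist_exact_yoneda₃ hT (f' - f) (by
    rw [Preadditive.comp_sub, hf', sub_self])
  rwa [h' k, comp_zero, sub_eq_zero] at hk

theorem dist_replace₃ {X₁ X₂ X₃ : C} {a : X₁ ⟶ X₂} {b : X₂ ⟶ X₃} {c : X₃ ⟶ X₁⟦(1 : ℤ)⟧}
    (hT : Triangle.mk a b c ∈ distTriang C) {X₃' : C} (e : X₃ ≅ X₃') {b' : X₂ ⟶ X₃'} (hb : b ≫ e.hom = b') :
    Triangle.mk a b' (e.inv ≫ c) ∈ distTriang C := by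
  refine isomorphic_distinguished _ hT _
    (Triangle.isoMk _ _ (Iso.refl _) (Iso.refl _) e.symm ?_ ?_ ?_)
  · change a ≫ 𝟙 X₂ = 𝟙 X₁ ≫ a
    simp
  · change b' ≫ e.inv = 𝟙 X₂ ≫ b
    simp [← hb]
  · change (e.inv ≫ c) ≫ (𝟙 X₁)⟦(1 : ℤ)⟧' = e.inv ≫ c
    simp

theorem dist_replace₁ {X₁ X₂ X₃ : C} {a : X₁ ⟶ X₂} {b : X₂ ⟶ X₃} {c : X₃ ⟶ X₁⟦(1 : ℤ)⟧}
    (hT : Triangle.mk a b c ∈ distTriang C) {X₁' : C} (e : X₁ ≅ X₁') {a' : X₁' ⟶ X₂} (ha : e.inv ≫ a = a') :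
    Triangle.mk a' b (c ≫ e.hom⟦(1 : ℤ)⟧') ∈ distTriang C := by
  refine isomorphic_distinguished _ hT _
    (Triangle.isoMk _ _ e.symm (Iso.refl _) (Iso.refl _) ?_ ?_ ?_)
  · change a' ≫ 𝟙 X₂ = e.inv ≫ a
    simp [ha]
  · change b ≫ 𝟙 X₃ = 𝟙 X₂ ≫ b
    simp
  · change (c ≫ e.hom⟦(1 : ℤ)⟧') ≫ e.inv⟦(1 : ℤ)⟧' = 𝟙 X₃ ≫ c
    rw [assoc, ← Functor.map_comp]
    simp

/-- Recognition of left recollements, I. -/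
theorem leftRec_of_ker_star {L : C ⥤ C'} {i : C' ⥤ C} {j : C'' ⥤ C} {R : C ⥤ C''}
    (tL : IsTriangleFunctor L) (tR : IsTriangleFunctor R)
    (adjI : L ⊣ i) (adjJ : j ⊣ R) [i.Full] [i.Faithful] [j.Full] [j.Faithful]
    (h0 : ∀ X, IsZero (R.obj (i.obj X)))
    (hker : ∀ X, IsZero (R.obj X) → IsIso (adjI.unit.app X)) :
    IsLeftRecollement L i j R := by
  refine ⟨adjI, adjJ, inferInstance, inferInstance, inferInstance, inferInstance, h0, ?_⟩
  intro X
  obtain ⟨Z, (g : X ⟶ Z), h, hT⟩ := distinguished_cocone_triangle (X := j.obj (R.obj X)) (Y := X) (adjJ.counit.app X)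
  have hZ : IsZero (R.obj Z) := tR.isZero₃ hT (inferInstance)
  have h1 : IsIso (adjI.unit.app Z) := hker Z hZ
  have h2 : IsIso (L.map g) := tL.isIso₂ hT
    (zero_left_of_adj (adjJ.comp adjI) h0 _)
  let e : Z ≅ i.obj (L.obj X) := asIso (adjI.unit.app Z) ≪≫ (i.mapIso (asIso (L.map g))).symm
  have he : g ≫ e.hom = adjI.unit.app X := by
    rw [← cancel_mono (i.map (L.map g))]
    simp [e]
  refine ⟨e.inv ≫ h, dist_replace₃ hT e he⟩

/-- Recognition of left recollements, II. -/
theorem leftRec_of_ker_shriek {L : C ⥤ C'} {i : C' ⥤ C} {j : C'' ⥤ C} {R : C ⥤ C''}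
    (tL : IsTriangleFunctor L) (tR : IsTriangleFunctor R)
    (adjI : L ⊣ i) (adjJ : j ⊣ R) [i.Full] [i.Faithful] [j.Full] [j.Faithful]
    (h0 : ∀ X, IsZero (R.obj (i.obj X)))
    (hker : ∀ X, IsZero (L.obj X) → IsIso (adjJ.counit.app X)) :
    IsLeftRecollement L i j R := by
  refine ⟨adjI, adjJ, inferInstance, inferInstance, inferInstance, inferInstance, h0, ?_⟩
  intro X
  obtain ⟨K, (f : K ⟶ X), h, hT⟩ := distinguished_cocone_triangle₁ (Z := i.obj (L.obj X)) (Y := X) (adjI.unit.app X)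
  have hK : IsZero (L.obj K) := tL.isZero₁ hT (inferInstance)
  have h1 : IsIso (adjJ.counit.app K) := hker K hK
  have h2 : IsIso (R.map f) := tR.isIso₁ hT (h0 _)
  let e : K ≅ j.obj (R.obj X) := (asIso (adjJ.counit.app K)).symm ≪≫ (j.mapIso (asIso (R.map f)))
  have he : e.inv ≫ f = adjJ.counit.app X := by
    rw [← cancel_epi (j.map (R.map f))]
    simp [e]
  refine ⟨h ≫ e.hom⟦(1 : ℤ)⟧', dist_replace₁ hT e he⟩

theorem IsLeftRecollement.unit_iso {L : C ⥤ C'} {i : C' ⥤ C} {j : C'' ⥤ C} {R : C ⥤ C''}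
    (h : IsLeftRecollement L i j R) (tj : IsTriangleFunctor j) (adjI : L ⊣ i) (X : C)
    (hX : IsZero (R.obj X)) : IsIso (adjI.unit.app X) := by
  obtain ⟨adjI', adjJ, h1, h2, h3, h4, h0, hT⟩ := h
  obtain ⟨k, hk⟩ := hT X
  obtain ⟨c, hc⟩ := tj
  have : IsIso (adjI'.unit.app X) := (Triangle.isZero₁_iff_isIso₂ _ hk).1 (j.map_isZero hX)
  rw [adjI.isIso_unit_app_iff_mem_essImage]
  exact ⟨_, ⟨(asIso (adjI'.unit.app X)).symm⟩⟩

theorem IsLeftRecollement.counit_iso {L : C ⥤ C'} {i : C' ⥤ C} {j : C'' ⥤ C} {R : C ⥤ C''}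
    (h : IsLeftRecollement L i j R) (ti : IsTriangleFunctor i) (adjJ : j ⊣ R) (X : C)
    (hX : IsZero (L.obj X)) : IsIso (adjJ.counit.app X) := by
  obtain ⟨adjI, adjJ', h1, h2, h3, h4, h0, hT⟩ := h
  obtain ⟨k, hk⟩ := hT X
  obtain ⟨c, hc⟩ := ti
  have : IsIso (adjJ'.counit.app X) := (Triangle.isZero₃_iff_isIso₁ _ hk).1 (i.map_isZero hX)
  rw [adjJ.isIso_counit_app_iff_mem_essImage]
  exact ⟨_, ⟨(asIso (adjJ'.counit.app X))⟩⟩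

section

variable {L : C ⥤ C'} {i : C' ⥤ C} {j : C'' ⥤ C} {R : C ⥤ C''}
  (h : IsLeftRecollement L i j R)
  (tL : IsTriangleFunctor L) (ti : IsTriangleFunctor i)
  (tj : IsTriangleFunctor j) (tR : IsTriangleFunctor R)

include h tL ti tj tR

theorem step_down {S : C ⥤ C'} {T : C'' ⥤ C} (adjS : i ⊣ S) (adjT : R ⊣ T) :
    IsLeftRecollement R T i S := by
  have hu : ∀ X, IsZero (R.obj X) → IsIso (adjS.counit.app X) := by
    intro X hX
    obtain ⟨adjI, adjJ, h1, h2, h3, h4, h0, hT⟩ := id h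
    have := h.unit_iso tj adjI X hX
    rw [adjS.isIso_counit_app_iff_mem_essImage]
    exact ⟨_, ⟨(asIso (adjI.unit.app X)).symm⟩⟩
  obtain ⟨adjI, adjJ, h1, h2, h3, h4, h0, hT⟩ := h
  have ff := (Adjunction.Triple.mk adjJ adjT).fullyFaithfulEquiv
    (Functor.FullyFaithful.ofFullyFaithful j)
  have := ff.full
  have := ff.faithful
  exact leftRec_of_ker_shriek tR (ti.right adjS) adjT adjS
    (zero_right_of_adj (adjS.comp adjT) h0) hu

theorem step_up {K : C ⥤ C''} {M : C' ⥤ C} (adjK : K ⊣ j) (adjM : M ⊣ L) :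
    IsLeftRecollement K j M L := by
  have hu : ∀ X, IsZero (L.obj X) → IsIso (adjK.unit.app X) := by
    intro X hX
    obtain ⟨adjI, adjJ, h1, h2, h3, h4, h0, hT⟩ := id h
    have := h.counit_iso ti adjJ X hX
    rw [adjK.isIso_unit_app_iff_mem_essImage]
    exact ⟨_, ⟨(asIso (adjJ.counit.app X))⟩⟩
  obtain ⟨adjI, adjJ, h1, h2, h3, h4, h0, hT⟩ := h
  have ff := (Adjunction.Triple.mk adjM adjI).fullyFaithfulEquiv.symm
    (Functor.FullyFaithful.ofFullyFaithful i)
  have := ff.full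
  have := ff.faithful
  exact leftRec_of_ker_star (tj.left adjK) tL adjK adjM
    (zero_left_of_adj (adjJ.comp adjI) h0) hu

theorem exists_T {S : C ⥤ C'} (adjS : i ⊣ S) : ∃ T : C'' ⥤ C, Nonempty (R ⊣ T) := by
  obtain ⟨adjI, adjJ, h1, h2, h3, h4, h0, hT⟩ := h
  have tS := ti.right adjS
  obtain ⟨c, hc⟩ := ti
  apply exists_right_adjoint_of_universal
  intro Z
  obtain ⟨Y, g, k, hY⟩ := distinguished_cocone_triangle (adjS.counit.app (j.obj Z))
  have hSY : IsZero (S.obj Y) := tS.isZero₃ hY (inferInstance)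
  have hg : IsIso (R.map g) := tR.isIso₂ hY (h0 _)
  refine ⟨Y, inv (R.map g) ≫ inv (adjJ.unit.app Z), ?_⟩
  intro A f
  obtain ⟨w, hw⟩ := hT A
  obtain ⟨x, hx, hx'⟩ := pre_mor₁ hw (Y := Y) (fun f => hom_zero_of_right adjS hSY f)
    (fun f => hom_shift_zero_of_right adjS (-1) hSY f)
    ((adjJ.homEquiv _ _).symm (f ≫ adjJ.unit.app Z ≫ R.map g))
  have key : ∀ y : A ⟶ Y, R.map y ≫ inv (R.map g) ≫ inv (adjJ.unit.app Z) = f ↔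
      adjJ.counit.app A ≫ y = (adjJ.homEquiv _ _).symm (f ≫ adjJ.unit.app Z ≫ R.map g) := by
    intro y
    rw [← Equiv.apply_eq_iff_eq_symm_apply, ← assoc, IsIso.comp_inv_eq, IsIso.comp_inv_eq]
    simp [Adjunction.homEquiv_unit]
  exact ⟨x, (key x).2 hx, fun y hy => hx' y ((key y).1 hy)⟩

theorem exists_M {K : C ⥤ C''} (adjK : K ⊣ j) : ∃ M : C' ⥤ C, Nonempty (M ⊣ L) := by
  obtain ⟨adjI, adjJ, h1, h2, h3, h4, h0, hT⟩ := h
  have tK := tj.left adjK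
  obtain ⟨c, hc⟩ := tj
  apply exists_left_adjoint_of_universal
  intro Z
  obtain ⟨Y, g, k, hY⟩ := distinguished_cocone_triangle₁ (adjK.unit.app (i.obj Z))
  have hKY : IsZero (K.obj Y) := tK.isZero₁ hY (inferInstance)
  have hg : IsIso (L.map g) := tL.isIso₁ hY (zero_left_of_adj (adjJ.comp adjI) h0 _)
  refine ⟨Y, inv (adjI.counit.app Z) ≫ inv (L.map g), ?_⟩
  intro A f
  obtain ⟨w, hw⟩ := hT A
  obtain ⟨x, hx, hx'⟩ := post_mor₂ hw (Y := Y) (fun f => hom_zero_of_left adjK hKY f)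
    (fun f => hom_shift_zero_of_left adjK 1 hKY f)
    ((adjI.homEquiv _ _) (L.map g ≫ adjI.counit.app Z ≫ f))
  have key : ∀ y : Y ⟶ A, (inv (adjI.counit.app Z) ≫ inv (L.map g)) ≫ L.map y = f ↔
      y ≫ adjI.unit.app A = (adjI.homEquiv _ _) (L.map g ≫ adjI.counit.app Z ≫ f) := by
    intro y
    rw [← Equiv.symm_apply_eq, assoc, IsIso.inv_comp_eq, IsIso.inv_comp_eq]
    simp [Adjunction.homEquiv_counit]
  exact ⟨x, (key x).2 hx, fun y hy => hx' y ((key y).1 hy)⟩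

theorem exists_S {T : C'' ⥤ C} (adjT : R ⊣ T) : ∃ S : C ⥤ C', Nonempty (i ⊣ S) := by
  have hu := h.unit_iso tj
  obtain ⟨adjI, adjJ, h1, h2, h3, h4, h0, hT⟩ := h
  have ff := (Adjunction.Triple.mk adjJ adjT).fullyFaithfulEquiv
    (Functor.FullyFaithful.ofFullyFaithful j)
  have := ff.full
  have := ff.faithful
  obtain ⟨c, hc⟩ := tR.right adjT
  apply exists_right_adjoint_of_universal
  intro X
  obtain ⟨Y, g, k, hY⟩ := distinguished_cocone_triangle₁ (adjT.unit.app X)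
  have hRY : IsZero (R.obj Y) := tR.isZero₁ hY (inferInstance)
  have := hu adjI Y hRY
  refine ⟨L.obj Y, inv (adjI.unit.app Y) ≫ g, ?_⟩
  intro A f
  obtain ⟨x, hx, hx'⟩ := post_mor₁ hY (Y := i.obj A)
    (fun f => hom_zero_of_left adjT (h0 _) f)
    (fun f => hom_shift_zero_of_left adjT (-1) (h0 _) f) f
  dsimp at x hx hx'
  refine ⟨i.preimage (x ≫ adjI.unit.app Y), by simpa using hx, fun y hy => ?_⟩
  apply i.map_injective
  rw [i.map_preimage, ← IsIso.comp_inv_eq]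
  exact hx' _ (by simpa using hy)

theorem exists_K {M : C' ⥤ C} (adjM : M ⊣ L) : ∃ K : C ⥤ C'', Nonempty (K ⊣ j) := by
  have hu := h.counit_iso ti
  obtain ⟨adjI, adjJ, h1, h2, h3, h4, h0, hT⟩ := h
  have ff := (Adjunction.Triple.mk adjM adjI).fullyFaithfulEquiv.symm
    (Functor.FullyFaithful.ofFullyFaithful i)
  have := ff.full
  have := ff.faithful
  obtain ⟨c, hc⟩ := tL.left adjM
  have h0' := zero_left_of_adj (adjJ.comp adjI) h0
  apply exists_left_adjoint_of_universal
  intro X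
  obtain ⟨Y, g, k, hY⟩ := distinguished_cocone_triangle (adjM.counit.app X)
  have hLY : IsZero (L.obj Y) := tL.isZero₃ hY (inferInstance)
  have := hu adjJ Y hLY
  refine ⟨R.obj Y, g ≫ inv (adjJ.counit.app Y), ?_⟩
  intro A f
  obtain ⟨x, hx, hx'⟩ := pre_mor₂ hY (Y := j.obj A)
    (fun f => hom_zero_of_right adjM (h0' _) f)
    (fun f => hom_shift_zero_of_right adjM 1 (h0' _) f) f
  dsimp at x hx hx'
  refine ⟨j.preimage (adjJ.counit.app Y ≫ x), by simpa using hx, fun y hy => ?_⟩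
  apply j.map_injective
  rw [j.map_preimage, ← IsIso.inv_comp_eq]
  exact hx' _ (by simpa using hy)

end

theorem int_chain {α : Type*} (P : ℤ → α → Prop) (r : ℤ → α → α → Prop)
    (hd : ∀ n s, P n s → ∃ t, P (n + 1) t ∧ r n s t)
    (hu : ∀ n t, P (n + 1) t → ∃ s, P n s ∧ r n s t)
    (s₀ s₁ : α) (h₀ : P 0 s₀) (h₁ : P 1 s₁) (h₀₁ : r 0 s₀ s₁) :
    ∃ f : ℤ → α, f 0 = s₀ ∧ f 1 = s₁ ∧ (∀ n, P n (f n)) ∧ ∀ n, r n (f n) (f (n + 1)) := by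
  choose! d hdP hdr using hd
  choose! e heP her using hu
  let u : ℕ → α := fun k => Nat.rec s₁ (fun k s => d (k + 1) s) k
  let w : ℕ → α := fun k => Nat.rec s₀ (fun k s => e (Int.negSucc k) s) k
  have hu0 : u 0 = s₁ := rfl
  have hw0 : w 0 = s₀ := rfl
  have hus : ∀ k : ℕ, u (k + 1) = d (k + 1) (u k) := fun k => rfl
  have hws : ∀ k : ℕ, w (k + 1) = e (Int.negSucc k) (w k) := fun k => rfl
  have hu : ∀ k : ℕ, P ((k : ℤ) + 1) (u k) := by
    intro k
    induction k with
    | zero => simpa [hu0] using h₁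
    | succ k ih =>
      rw [hus]
      have := hdP _ _ ih
      push_cast
      exact this
  have hneg : ∀ k : ℕ, Int.negSucc k + 1 = -(k : ℤ) := by intro k; omega
  have hw : ∀ k : ℕ, P (-(k : ℤ)) (w k) := by
    intro k
    induction k with
    | zero => simpa [hw0] using h₀
    | succ k ih =>
      rw [hws]
      have := heP (Int.negSucc k) (w k) (by rw [hneg]; exact ih)
      rwa [show -((k + 1 : ℕ) : ℤ) = Int.negSucc k by omega]
  let f : ℤ → α := fun n => if 0 < n then u (n - 1).toNat else w (-n).toNat
  have fpos : ∀ k : ℕ, f ((k : ℤ) + 1) = u k := by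
    intro k
    have : 0 < (k : ℤ) + 1 := by omega
    simp [f, this]
  have fneg : ∀ k : ℕ, f (-(k : ℤ)) = w k := by
    intro k
    simp [f]
  have cases : ∀ n : ℤ, (∃ k : ℕ, n = k + 1) ∨ (∃ k : ℕ, n = -(k : ℤ)) := by
    intro n
    by_cases hn : 0 < n
    · exact Or.inl ⟨(n - 1).toNat, by omega⟩
    · exact Or.inr ⟨(-n).toNat, by omega⟩
  have f0 : f 0 = s₀ := by simpa [hw0] using fneg 0
  have f1 : f 1 = s₁ := by simpa [hu0] using fpos 0
  refine ⟨f, f0, f1, ?_, ?_⟩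
  · intro n
    rcases cases n with ⟨k, rfl⟩ | ⟨k, rfl⟩
    · rw [fpos]; exact hu k
    · rw [fneg]; exact hw k
  · intro n
    rcases cases n with ⟨k, rfl⟩ | ⟨k, rfl⟩
    · have := fpos (k + 1)
      push_cast at this
      rw [this, fpos, hus]
      exact hdr _ _ (hu k)
    · cases k with
      | zero => simpa [f0, f1] using h₀₁
      | succ k =>
        have e1 : -((k + 1 : ℕ) : ℤ) + 1 = -(k : ℤ) := by omega
        rw [fneg, e1, fneg, hws, show -((k + 1 : ℕ) : ℤ) = Int.negSucc k by omega]
        exact her _ _ (by rw [hneg]; exact hw k)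

end Helpers
section Statement

universe v v' v'' u u' u''

variable {C : Type u} {C' : Type u'} {C'' : Type u''}
  [Category.{v} C] [Category.{v'} C'] [Category.{v''} C'']
  [HasShift C ℤ] [HasShift C' ℤ] [HasShift C'' ℤ]
  [Preadditive C] [Preadditive C'] [Preadditive C'']
  [HasZeroObject C] [HasZeroObject C'] [HasZeroObject C'']
  [∀ n : ℤ, (shiftFunctor C n).Additive] [∀ n : ℤ, (shiftFunctor C' n).Additive]
  [∀ n : ℤ, (shiftFunctor C'' n).Additive]
  [Pretriangulated C] [Pretriangulated C'] [Pretriangulated C'']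

/-- **Lemma 1.2.** A recollement sits in an unbounded ladder if and only if there is an
infinite adjoint sequence `(…, F_{-1}, i^*, i_*, i^!, F_1, …)` of triangle functors
extending the adjoint triple `(i^*, i_*, i^!)`; here `G n` are the functors `𝒞 ⥤ 𝒞'`
and `H n` the functors `𝒞' ⥤ 𝒞` of such a sequence, with `G 0 = i^*`, `H 0 = i_*`,
`G 1 = i^!`, and `(G n, H n)`, `(H n, G (n+1))` adjoint pairs for all `n ∈ ℤ`. -/
theorem recollement_sits_in_unbounded_ladder_iff_infinite_adjoint_sequence
    (iStar : C ⥤ C') (iPush : C' ⥤ C) (iShriek : C ⥤ C')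
    (jShriek : C'' ⥤ C) (jStar : C ⥤ C'') (jPush : C'' ⥤ C)
    (tiStar : IsTriangleFunctor iStar) (tiPush : IsTriangleFunctor iPush)
    (tiShriek : IsTriangleFunctor iShriek) (tjShriek : IsTriangleFunctor jShriek)
    (tjStar : IsTriangleFunctor jStar) (tjPush : IsTriangleFunctor jPush)
    (hrec : IsRecollement iStar iPush iShriek jShriek jStar jPush) :
    SitsInUnboundedLadder iStar iPush iShriek jShriek jStar jPush ↔
      ∃ (G : ℤ → C ⥤ C') (H : ℤ → C' ⥤ C),
        (∀ n, IsTriangleFunctor (G n)) ∧ (∀ n, IsTriangleFunctor (H n)) ∧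
        (∀ n, Nonempty (G n ⊣ H n)) ∧ (∀ n, Nonempty (H n ⊣ G (n + 1))) ∧
        G 0 = iStar ∧ H 0 = iPush ∧ G 1 = iShriek := by
  constructor
  · rintro ⟨a, b, p, q, hl, h1, h2, h3, -, -, -⟩
    refine ⟨p, a, hl.tri_p, hl.tri_a, fun n => ?_, fun n => ?_, h1, h2, h3⟩
    · obtain ⟨adj, -⟩ := hl.left n
      exact ⟨adj⟩
    · obtain ⟨-, adj, -⟩ := hl.right n
      exact ⟨adj⟩
  · rintro ⟨G, H, tG, tH, hGH, hHG, rfl, rfl, rfl⟩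
    obtain ⟨adjI₁, adjI₂, adjJ₁, adjJ₂, f1, f2, f3, f4, f5, f6, h0, hT1, hT2⟩ := hrec
    have left0 : IsLeftRecollement (G 0) (H 0) jShriek jStar :=
      ⟨adjI₁, adjJ₁, f1, f2, f3, f4, h0, hT1⟩
    have right0 : IsLeftRecollement jStar jPush (H 0) (G 1) :=
      ⟨adjJ₂, adjI₂, f5, f6, f1, f2, zero_right_of_adj (adjI₂.comp adjJ₂) h0, hT2⟩
    let P : ℤ → (C'' ⥤ C) × (C ⥤ C'') → Prop := fun n s =>
      IsTriangleFunctor s.1 ∧ IsTriangleFunctor s.2 ∧ IsLeftRecollement (G n) (H n) s.1 s.2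
    let r : ℤ → (C'' ⥤ C) × (C ⥤ C'') → (C'' ⥤ C) × (C ⥤ C'') → Prop := fun n s t =>
      IsLeftRecollement s.2 t.1 (H n) (G (n + 1))
    -- completing a right recollement to the next left one
    have next : ∀ (n : ℤ) (q : C ⥤ C'') (b : C'' ⥤ C), IsTriangleFunctor q →
        IsTriangleFunctor b → IsLeftRecollement q b (H n) (G (n + 1)) →
        ∃ q', P (n + 1) (b, q') := by
      intro n q b tq tb h
      obtain ⟨adj⟩ := hGH (n + 1)
      obtain ⟨q', ⟨adj'⟩⟩ := exists_S h tq tb (tH n) (tG _) adj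
      exact ⟨q', tb, tb.right adj', step_down h tq tb (tH n) (tG _) adj' adj⟩
    obtain ⟨q1, hq1⟩ := next 0 jStar jPush tjStar tjPush right0
    have hd : ∀ n s, P n s → ∃ t, P (n + 1) t ∧ r n s t := by
      rintro n ⟨b, q⟩ ⟨tb, tq, h⟩
      obtain ⟨adj⟩ := hHG n
      obtain ⟨b', ⟨adj'⟩⟩ := exists_T h (tG n) (tH n) tb tq adj
      have hr := step_down h (tG n) (tH n) tb tq adj adj'
      obtain ⟨q', hq'⟩ := next n q b' tq (tq.right adj') hr
      exact ⟨(b', q'), hq', hr⟩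
    have hu : ∀ n t, P (n + 1) t → ∃ s, P n s ∧ r n s t := by
      rintro n ⟨b', q'⟩ ⟨tb', tq', h⟩
      obtain ⟨adj⟩ := hHG n
      obtain ⟨q, ⟨adj'⟩⟩ := exists_K h (tG _) (tH _) tb' tq' adj
      have tq := tb'.left adj'
      have hr := step_up h (tG _) (tH _) tb' tq' adj' adj
      obtain ⟨adjn⟩ := hGH n
      obtain ⟨b, ⟨adjb⟩⟩ := exists_M hr tq tb' (tH n) (tG _) adjn
      exact ⟨(b, q), ⟨tq.left adjb, tq, step_up hr tq tb' (tH n) (tG _) adjn adjb⟩, hr⟩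
    obtain ⟨f, hf0, hf1, hP, hr⟩ := int_chain P r hd hu (jShriek, jStar) (jPush, q1)
      ⟨tjShriek, tjStar, left0⟩ hq1 right0
    refine ⟨H, fun n => (f n).1, G, fun n => (f n).2,
      ⟨tH, fun n => (hP n).1, tG, fun n => (hP n).2.1, fun n => (hP n).2.2, hr⟩,
      rfl, rfl, rfl, by simp [hf0], by simp [hf0], by simp [hf1]⟩

end Statement
end
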